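/- For every integer a ≥ 1 there exists a constant C > 0 such that for all n ≥ 0 and all i ≥ 1, the rational Betti number dim_ℚ H_i(UConf_n(ℂ ∖ {1, 2, …, a}); ℚ) is at most C · i^{a−1}; in particular these dimensions are bounded by a polynomial in i of degree a − 1, uniformly in n. -/

import Mathlib

open CategoryTheory AlgebraicTopology

/-- The `i`-th singular homology with rational coefficients, as a functor
`TopCat ⥤ ModuleCat ℚ` (singular chains via the singular simplicial set, free
`ℚ`-modules, the alternating face map complex, and homology). -/
noncomputable def singularHomologyFunctor (i : ℕ) : TopCat.{0} ⥤ ModuleCat.{0} ℚ :=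
  TopCat.toSSet ⋙ ((SimplicialObject.whiskering _ _).obj (ModuleCat.free ℚ)) ⋙
    alternatingFaceMapComplex _ ⋙ HomologicalComplex.homologyFunctor _ _ i

/-- The `i`-th rational Betti number of a topological space. -/
noncomputable def bettiNumber (i : ℕ) (Y : TopCat.{0}) : ℕ :=
  Module.finrank ℚ ((singularHomologyFunctor i).obj Y)

/-- The set `{1, 2, …, a} ⊆ ℂ`. -/
def punctures (a : ℕ) : Set ℂ := {z | ∃ k : ℕ, 1 ≤ k ∧ k ≤ a ∧ z = (k : ℂ)}

/-- The ordered configuration space `Conf_n(ℂ ∖ {1, …, a})`, as a subspace of `ℂ^n`. -/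
def ConfSp (n a : ℕ) : Type :=
  {x : Fin n → ℂ // Function.Injective x ∧ ∀ k, x k ∉ punctures a}

instance (n a : ℕ) : TopologicalSpace (ConfSp n a) :=
  inferInstanceAs (TopologicalSpace {x : Fin n → ℂ // _})

/-- Points of `Conf_n(ℂ ∖ {1, …, a})` are equivalent when they differ by a
permutation of the coordinates. -/
def confSetoid (n a : ℕ) : Setoid (ConfSp n a) where
  r x y := ∃ σ : Equiv.Perm (Fin n), x.1 ∘ ⇑σ = y.1
  iseqv := by
    constructor
    · exact fun x => ⟨1, rfl⟩
    · rintro x y ⟨σ, h⟩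
      exact ⟨σ⁻¹, by funext i; simpa using congrFun h.symm (σ⁻¹ i)⟩
    · rintro x y z ⟨σ, h⟩ ⟨τ, h'⟩
      exact ⟨σ * τ, by funext i; simpa [← congrFun h' i] using congrFun h (τ i)⟩

/-- The unordered configuration space `UConf_n(ℂ ∖ {1, …, a})`, with the quotient
topology. -/
def UConfSp (n a : ℕ) : Type := Quotient (confSetoid n a)

instance (n a : ℕ) : TopologicalSpace (UConfSp n a) :=
  inferInstanceAs (TopologicalSpace (Quotient (confSetoid n a)))

namespace CB

abbrev Dl (n : ℕ) : Type := stdSimplex ℝ (Fin (n + 1))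

noncomputable def dcomb {n m : ℕ} (w : Dl n) (v : Fin (n + 1) → Dl m) : Dl m :=
  ⟨fun k => ∑ i, w i * v i k, by
    refine ⟨fun k => Finset.sum_nonneg fun i _ => mul_nonneg (w.2.1 i) ((v i).2.1 k), ?_⟩
    rw [Finset.sum_comm]
    simp_rw [← Finset.mul_sum]
    have : ∀ i, ∑ k, (v i) k = 1 := fun i => (v i).2.2
    simp_rw [this, mul_one]
    exact w.2.2⟩

/-- abstract convex combinations -/
class Cvx (K : Type) [TopologicalSpace K] where
  comb : ∀ {n : ℕ}, Dl n → (Fin (n + 1) → K) → K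
  comb_cont : ∀ {n : ℕ} (v : Fin (n + 1) → K), Continuous (fun w => comb w v)
  comb_map : ∀ {n m : ℕ} (f : Fin (n + 1) → Fin (m + 1)) (w : Dl n) (v : Fin (m + 1) → K),
    comb (stdSimplex.map f w) v = comb w (v ∘ f)
  comb_vertex : ∀ {n : ℕ} (i : Fin (n + 1)) (v : Fin (n + 1) → K),
    comb (stdSimplex.vertex i) v = v i
  comb_assoc : ∀ {n m : ℕ} (w : Dl n) (u : Fin (n + 1) → Dl m) (v : Fin (m + 1) → K),
    comb (dcomb w u) v = comb w (fun i => comb (u i) v)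

open Cvx

noncomputable instance (m : ℕ) : Cvx (Dl m) where
  comb w v := dcomb w v
  comb_cont {n} v := by
    refine Continuous.subtype_mk ?_ _
    refine continuous_pi fun k => continuous_finsetSum _ fun i _ => ?_
    exact ((continuous_apply i).comp continuous_subtype_val).mul continuous_const
  comb_map {n m'} f w v := by
    apply Subtype.ext
    funext k
    have : ∀ i, (stdSimplex.map f w) i = ∑ x with f x = i, w x := by
      intro i
      have := congrFun (stdSimplex.map_coe f w) i
      rw [FunOnFinite.linearMap_apply_apply] at this
      exact this
    change ∑ i, (stdSimplex.map f w) i * v i k = ∑ i, w i * v (f i) k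
    simp_rw [this, Finset.sum_mul]
    rw [← Finset.sum_fiberwise (s := Finset.univ) (g := f) (f := fun i => w i * v (f i) k)]
    refine Finset.sum_congr rfl fun i _ => Finset.sum_congr rfl fun x hx => ?_
    rw [(Finset.mem_filter.1 hx).2]
  comb_vertex {n} i v := by
    apply Subtype.ext
    funext k
    have : ∀ j, (stdSimplex.vertex (S := ℝ) i) j = if i = j then 1 else 0 := fun j => by
      change (Pi.single i (1 : ℝ) : Fin (n + 1) → ℝ) j = _
      simp [Pi.single_apply, eq_comm]
    change ∑ j, (stdSimplex.vertex (S := ℝ) i) j * v j k = _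
    simp [this]
    rfl
  comb_assoc {n m'} w u v := by
    apply Subtype.ext
    funext k
    change ∑ i, (∑ j, w j * u j i) * v i k = ∑ j, w j * ∑ i, u j i * v i k
    simp_rw [Finset.sum_mul, Finset.mul_sum]
    rw [Finset.sum_comm]
    simp only [mul_assoc]

noncomputable instance {K L : Type} [TopologicalSpace K] [TopologicalSpace L] [Cvx K] [Cvx L] :
    Cvx (K × L) where
  comb w v := (comb w (fun i => (v i).1), comb w (fun i => (v i).2))
  comb_cont v := (comb_cont _).prodMk (comb_cont _)
  comb_map f w v := by
    rw [comb_map, comb_map]; rfl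
  comb_vertex i v := by rw [comb_vertex, comb_vertex]
  comb_assoc w u v := by rw [comb_assoc, comb_assoc]

/-- ordered tuples, free module -/
abbrev L (n : ℕ) (K : Type) := (Fin n → K) →₀ ℚ

variable {K K' : Type} {X Y Z : Type} [TopologicalSpace X] [TopologicalSpace Y] [TopologicalSpace Z]

noncomputable def tb (n : ℕ) : L (n + 1) K →ₗ[ℚ] L n K :=
  ∑ j : Fin (n + 1), ((-1 : ℚ) ^ (j : ℕ)) • Finsupp.lmapDomain ℚ ℚ (fun v => v ∘ j.succAbove)

noncomputable def lm (n : ℕ) (f : K → K') : L n K →ₗ[ℚ] L n K' :=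
  Finsupp.lmapDomain ℚ ℚ (fun v => f ∘ v)

noncomputable def cone (n : ℕ) (b : K) : L n K →ₗ[ℚ] L (n + 1) K :=
  Finsupp.lmapDomain ℚ ℚ (fun v => (Fin.cons b v : Fin (n + 1) → K))

lemma tb_single (n : ℕ) (v : Fin (n + 1) → K) : tb n (Finsupp.single v 1) =
    ∑ j : Fin (n + 1), ((-1 : ℚ) ^ (j : ℕ)) • Finsupp.single (v ∘ j.succAbove) 1 := by
  simp [tb, LinearMap.sum_apply, Finsupp.lmapDomain_apply, Finsupp.mapDomain_single]

lemma lm_single (n : ℕ) (f : K → K') (v : Fin n → K) :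
    lm n f (Finsupp.single v 1) = Finsupp.single (f ∘ v) 1 := by
  simp [lm, Finsupp.lmapDomain_apply, Finsupp.mapDomain_single]

lemma cone_single (n : ℕ) (b : K) (v : Fin n → K) :
    cone n b (Finsupp.single v 1) = Finsupp.single (Fin.cons b v : Fin (n + 1) → K) 1 := by
  simp [cone, Finsupp.lmapDomain_apply, Finsupp.mapDomain_single]

lemma ext1 {S M : Type*} [AddCommGroup M] [Module ℚ M] {f g : (S →₀ ℚ) →ₗ[ℚ] M}
    (h : ∀ s, f (Finsupp.single s 1) = g (Finsupp.single s 1)) : f = g :=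
  Finsupp.lhom_ext' fun s => LinearMap.ext_ring (h s)

lemma tb_cone (n : ℕ) (b : K) (c : L (n + 1) K) :
    tb (n + 1) (cone (n + 1) b c) = c - cone n b (tb n c) := by
  have : (tb (n + 1)) ∘ₗ (cone (n + 1) b) = LinearMap.id - cone n b ∘ₗ tb n := by
    apply ext1
    intro v
    simp only [LinearMap.comp_apply, LinearMap.sub_apply, LinearMap.id_apply, cone_single,
      tb_single, map_sum, map_smul]
    rw [Fin.sum_univ_succ]
    simp only [Fin.val_zero, pow_zero, one_smul, Fin.val_succ, pow_succ, mul_neg, mul_one,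
      neg_smul, Finset.sum_neg_distrib, ← sub_eq_add_neg]
    congr 2
    funext j
    congr 2
    funext k
    refine Fin.cases ?_ (fun k => ?_) k
    · simp
    · simp
  exact LinearMap.congr_fun this c

lemma tb_cone0 (b : K) (c : L 0 K) : tb 0 (cone 0 b c) = c := by
  have : (tb 0) ∘ₗ (cone 0 b) = LinearMap.id := by
    apply ext1
    intro v
    simp only [LinearMap.comp_apply, LinearMap.id_apply, cone_single, tb_single]
    simp
  exact LinearMap.congr_fun this c

lemma tb_tb (n : ℕ) (c : L (n + 2) K) : tb n (tb (n + 1) c) = 0 := by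
  induction n with
  | zero =>
    have : (tb 0) ∘ₗ (tb 1) = (0 : L 2 K →ₗ[ℚ] _) := by
      apply ext1
      intro v
      rw [← Fin.cons_self_tail v, ← cone_single, LinearMap.comp_apply, tb_cone, map_sub, tb_cone0]
      simp
    exact LinearMap.congr_fun this c
  | succ n ih =>
    have : (tb (n + 1)) ∘ₗ (tb (n + 2)) = (0 : L (n + 3) K →ₗ[ℚ] _) := by
      apply ext1
      intro v
      rw [← Fin.cons_self_tail v, ← cone_single, LinearMap.comp_apply, tb_cone, map_sub, tb_cone,
        ih]
      simp
    exact LinearMap.congr_fun this c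

lemma tb_lm (n : ℕ) (f : K → K') (c : L (n + 1) K) : tb n (lm (n + 1) f c) = lm n f (tb n c) := by
  have : (tb n) ∘ₗ (lm (n + 1) f) = lm n f ∘ₗ tb n := by
    apply ext1
    intro v
    simp only [LinearMap.comp_apply, lm_single, tb_single, map_sum, map_smul]
    rfl
  exact LinearMap.congr_fun this c

lemma lm_cone (n : ℕ) (f : K → K') (b : K) (c : L n K) :
    lm (n + 1) f (cone n b c) = cone n (f b) (lm n f c) := by
  have : (lm (n + 1) f) ∘ₗ (cone n b) = cone n (f b) ∘ₗ lm n f := by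
    apply ext1
    intro v
    simp only [LinearMap.comp_apply, lm_single, cone_single]
    congr 1
    funext k
    refine Fin.cases ?_ (fun k => ?_) k <;> simp
  exact LinearMap.congr_fun this c

variable [TopologicalSpace K] [TopologicalSpace K'] [Cvx K] [Cvx K']

noncomputable def bary {n : ℕ} (v : Fin (n + 1) → K) : K := comb (stdSimplex.barycenter) v

noncomputable def sd : (n : ℕ) → L n K →ₗ[ℚ] L n K
  | 0 => LinearMap.id
  | n + 1 => Finsupp.linearCombination ℚ
      (fun v => cone n (bary v) (sd n (tb n (Finsupp.single v 1))))

lemma sd_single (n : ℕ) (v : Fin (n + 1) → K) : sd (n + 1) (Finsupp.single v 1) =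
    cone n (bary v) (sd n (tb n (Finsupp.single v 1))) := by
  simp [sd]

lemma tb_sd (n : ℕ) (c : L (n + 1) K) : tb n (sd (n + 1) c) = sd n (tb n c) := by
  have : (tb n) ∘ₗ (sd (n + 1)) = sd n ∘ₗ tb (K := K) n := by
    clear c
    induction n with
    | zero =>
      apply ext1
      intro v
      simp only [LinearMap.comp_apply, sd_single, tb_cone0]
    | succ n ih =>
      apply ext1
      intro v
      simp only [LinearMap.comp_apply, sd_single, tb_cone]
      have := LinearMap.congr_fun ih (tb (n + 1) (Finsupp.single v 1))
      simp only [LinearMap.comp_apply] at this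
      rw [this, tb_tb]
      simp
  exact LinearMap.congr_fun this c

def IsAff (f : K → K') : Prop :=
  ∀ (n : ℕ) (w : Dl n) (v : Fin (n + 1) → K), f (comb w v) = comb w (f ∘ v)

lemma sd_lm (f : K → K') (hf : IsAff f) (n : ℕ) (c : L n K) :
    sd n (lm n f c) = lm n f (sd n c) := by
  have : sd n ∘ₗ lm n f = lm n f ∘ₗ sd n := by
    clear c
    induction n with
    | zero => apply ext1; intro v; simp [sd]
    | succ n ih =>
      apply ext1
      intro v
      simp only [LinearMap.comp_apply, lm_single, sd_single, lm_cone]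
      have := LinearMap.congr_fun ih (tb n (Finsupp.single v 1))
      simp only [LinearMap.comp_apply] at this
      rw [← this, ← tb_lm, lm_single]
      congr 1
      exact congrArg _ (hf _ _ _).symm
  exact LinearMap.congr_fun this c

noncomputable def v0 : Dl 1 := stdSimplex.vertex 0
noncomputable def v1 : Dl 1 := stdSimplex.vertex 1

noncomputable def Dd : (n : ℕ) → L n K →ₗ[ℚ] L (n + 1) (K × Dl 1)
  | 0 => 0
  | n + 1 => Finsupp.linearCombination ℚ
      (fun v => cone (n + 1) (v 0, v0)
        (lm (n + 1) (fun x => (x, v1)) (sd (n + 1) (Finsupp.single v 1))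
          - lm (n + 1) (fun x => (x, v0)) (Finsupp.single v 1)
          - Dd n (tb n (Finsupp.single v 1))))

lemma Dd_single (n : ℕ) (v : Fin (n + 1) → K) : Dd (n + 1) (Finsupp.single v 1) =
    cone (n + 1) (v 0, v0)
        (lm (n + 1) (fun x => (x, v1)) (sd (n + 1) (Finsupp.single v 1))
          - lm (n + 1) (fun x => (x, v0)) (Finsupp.single v 1)
          - Dd n (tb n (Finsupp.single v 1))) := by
  simp [Dd]

lemma tb_Dd (n : ℕ) (c : L (n + 1) K) : tb (n + 1) (Dd (n + 1) c) =
    lm (n + 1) (fun x => (x, v1)) (sd (n + 1) c) - lm (n + 1) (fun x => (x, v0)) c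
      - Dd n (tb n c) := by
  have : (tb (n + 1)) ∘ₗ (Dd (n + 1)) =
    lm (n + 1) (fun x => (x, v1)) ∘ₗ (sd (n + 1)) - lm (n + 1) (fun x => (x, v0))
      - Dd n ∘ₗ (tb (K := K) n) := by
    clear c
    induction n with
    | zero =>
      apply ext1
      intro v
      simp only [LinearMap.comp_apply, LinearMap.sub_apply, Dd_single, tb_cone]
      rw [sub_eq_self]
      simp only [map_sub, tb_lm, tb_sd]
      simp [sd, Dd, tb_single, lm_single]
      have : ∀ a b : L 0 (K × Dl 1), a = b → cone 0 (v 0, v0) a - cone 0 (v 0, v0) b = 0 := by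
        rintro a b rfl; simp
      apply this
      congr 1
      exact Subsingleton.elim _ _
    | succ n ih =>
      apply ext1
      intro v
      simp only [LinearMap.comp_apply, LinearMap.sub_apply, Dd_single, tb_cone]
      rw [sub_eq_self]
      have := LinearMap.congr_fun ih (tb (n + 1) (Finsupp.single v 1))
      simp only [LinearMap.comp_apply, LinearMap.sub_apply] at this
      simp only [map_sub, tb_lm, tb_sd, this, tb_tb, map_zero]
      abel
  have := LinearMap.congr_fun this c
  simpa only [LinearMap.comp_apply, LinearMap.sub_apply] using this

lemma isAff_prod (f : K → K') (hf : IsAff f) :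
    IsAff (fun p : K × Dl 1 => (f p.1, p.2)) := by
  intro n w v
  have := hf n w (fun i => (v i).1)
  exact Prod.ext this rfl

lemma Dd_lm (f : K → K') (hf : IsAff f) (n : ℕ) (c : L n K) :
    Dd n (lm n f c) = lm (n + 1) (fun p => (f p.1, p.2)) (Dd n c) := by
  have : Dd n ∘ₗ lm n f = lm (n + 1) (fun p => (f p.1, p.2)) ∘ₗ Dd n := by
    clear c
    induction n with
    | zero => apply ext1; intro v; simp [Dd]
    | succ n ih =>
      apply ext1
      intro v
      simp only [LinearMap.comp_apply, lm_single, Dd_single, lm_cone]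
      have := LinearMap.congr_fun ih (tb n (Finsupp.single v 1))
      simp only [LinearMap.comp_apply] at this
      simp only [map_sub]
      rw [← this, ← tb_lm, lm_single]
      have h2 : sd (n + 1) (Finsupp.single (f ∘ v) 1) = lm (n+1) f (sd (n+1) (Finsupp.single v 1)) := by
        rw [← sd_lm f hf, lm_single]
      rw [h2]
      have h3 : ∀ (p : Dl 1) (c : L (n+1) K), lm (n + 1) (fun x => (x, p)) (lm (n + 1) f c) =
          lm (n + 1) (fun p => (f p.1, p.2)) (lm (n + 1) (fun x => (x, p)) c) := by
        intro p c
        have : lm (n + 1) (fun x => (x, p)) ∘ₗ (lm (n + 1) f) =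
          lm (n + 1) (fun p : K × Dl 1 => (f p.1, p.2)) ∘ₗ (lm (n + 1) (fun x => (x, p))) := by
          apply ext1; intro v; simp only [LinearMap.comp_apply, lm_single]; rfl
        exact LinearMap.congr_fun this c
      rw [h3]
      simp only [lm_single]
      rfl
  exact LinearMap.congr_fun this c

end CB

namespace CB
open Cvx

variable {K K' : Type} {X Y Z : Type} [TopologicalSpace X] [TopologicalSpace Y] [TopologicalSpace Z]
variable [TopologicalSpace K] [TopologicalSpace K'] [Cvx K] [Cvx K']

abbrev Ch (n : ℕ) (X : Type) [TopologicalSpace X] := C(Dl n, X) →₀ ℚ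

noncomputable def fc (n : ℕ) (j : Fin (n + 2)) : C(Dl n, Dl (n + 1)) :=
  ⟨stdSimplex.map (Fin.succAbove j), stdSimplex.continuous_map _⟩

noncomputable def bd (n : ℕ) : Ch (n + 1) X →ₗ[ℚ] Ch n X :=
  ∑ j : Fin (n + 2), ((-1 : ℚ) ^ (j : ℕ)) • Finsupp.lmapDomain ℚ ℚ (fun σ => σ.comp (fc n j))

noncomputable def cmap (n : ℕ) (f : C(X, Y)) : Ch n X →ₗ[ℚ] Ch n Y :=
  Finsupp.lmapDomain ℚ ℚ (fun σ => f.comp σ)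

lemma bd_single (n : ℕ) (σ : C(Dl (n + 1), X)) : bd n (Finsupp.single σ 1) =
    ∑ j : Fin (n + 2), ((-1 : ℚ) ^ (j : ℕ)) • Finsupp.single (σ.comp (fc n j)) 1 := by
  simp [bd, LinearMap.sum_apply, Finsupp.lmapDomain_apply, Finsupp.mapDomain_single]

lemma cmap_single (n : ℕ) (f : C(X, Y)) (σ : C(Dl n, X)) :
    cmap n f (Finsupp.single σ 1) = Finsupp.single (f.comp σ) 1 := by
  simp [cmap, Finsupp.lmapDomain_apply, Finsupp.mapDomain_single]

lemma cmap_id (n : ℕ) (c : Ch n X) : cmap n (ContinuousMap.id X) c = c := by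
  have : cmap n (ContinuousMap.id X) = LinearMap.id := by
    apply ext1; intro v; rw [cmap_single]; rfl
  rw [this]; rfl

lemma cmap_comp (n : ℕ) (g : C(Y, Z)) (f : C(X, Y)) (c : Ch n X) :
    cmap n (g.comp f) c = cmap n g (cmap n f c) := by
  have : cmap n (g.comp f) = cmap n g ∘ₗ cmap n f := by
    apply ext1; intro v; simp only [LinearMap.comp_apply, cmap_single]; rfl
  rw [this]; rfl

lemma bd_cmap (n : ℕ) (f : C(X, Y)) (c : Ch (n + 1) X) :
    bd n (cmap (n + 1) f c) = cmap n f (bd n c) := by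
  have : bd n ∘ₗ cmap (n + 1) f = cmap n f ∘ₗ bd n := by
    apply ext1
    intro v
    simp only [LinearMap.comp_apply, cmap_single, bd_single, map_sum, map_smul]
    rfl
  exact LinearMap.congr_fun this c

noncomputable def aff {n : ℕ} (v : Fin (n + 1) → K) : C(Dl n, K) := ⟨fun w => comb w v, comb_cont v⟩

lemma aff_isAff {n : ℕ} (v : Fin (n + 1) → K) : IsAff (aff v) := by
  intro m w u
  exact comb_assoc w u v

noncomputable def push (n : ℕ) (σ : C(K, X)) : L (n + 1) K →ₗ[ℚ] Ch n X :=
  Finsupp.lmapDomain ℚ ℚ (fun v => σ.comp (aff v))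

lemma push_single (n : ℕ) (σ : C(K, X)) (v : Fin (n + 1) → K) :
    push n σ (Finsupp.single v 1) = Finsupp.single (σ.comp (aff v)) 1 := by
  simp [push, Finsupp.lmapDomain_apply, Finsupp.mapDomain_single]

lemma bd_push (n : ℕ) (σ : C(K, X)) (c : L (n + 2) K) :
    bd n (push (n + 1) σ c) = push n σ (tb (n + 1) c) := by
  have : bd n ∘ₗ push (n + 1) σ = push n σ ∘ₗ tb (n + 1) := by
    apply ext1
    intro v
    simp only [LinearMap.comp_apply, push_single, bd_single, tb_single, map_sum, map_smul]
    refine Finset.sum_congr rfl fun j _ => ?_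
    congr 2
    ext w
    exact congrArg σ (comb_map _ _ _)
  exact LinearMap.congr_fun this c

lemma push_lm (n : ℕ) (σ : C(K', X)) (f : C(K, K')) (hf : IsAff f) (c : L (n + 1) K) :
    push n σ (lm (n + 1) f c) = push n (σ.comp f) c := by
  have : push n σ ∘ₗ lm (n + 1) f = push n (σ.comp f) := by
    apply ext1
    intro v
    simp only [LinearMap.comp_apply, push_single, lm_single]
    congr 1
    ext w
    exact congrArg σ (hf _ _ _).symm
  exact LinearMap.congr_fun this c

lemma cmap_push (n : ℕ) (σ : C(K, X)) (f : C(X, Y)) (c : L (n + 1) K) :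
    cmap n f (push n σ c) = push n (f.comp σ) c := by
  have : cmap n f ∘ₗ push n σ = push n (f.comp σ) := by
    apply ext1
    intro v
    simp only [LinearMap.comp_apply, push_single, cmap_single]
    rfl
  exact LinearMap.congr_fun this c

noncomputable def ve (n : ℕ) : Fin (n + 1) → Dl n := fun i => stdSimplex.vertex i

lemma aff_ve (n : ℕ) : aff (ve n) = ContinuousMap.id (Dl n) := by
  ext w k
  change ∑ j, w j * (ve n j) k = w k
  have : ∀ j k, (ve n j) k = if j = k then 1 else 0 := fun j k => by
    change (Pi.single j (1 : ℝ) : Fin (n + 1) → ℝ) k = _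
    simp [Pi.single_apply, eq_comm]
  simp [this]

lemma aff_comp_ve {n : ℕ} (v : Fin (n + 1) → K) : aff v ∘ ve n = v := by
  funext i
  exact comb_vertex i v

lemma push_ve (n : ℕ) (σ : C(Dl n, X)) :
    push n σ (Finsupp.single (ve n) 1) = Finsupp.single σ 1 := by
  rw [push_single, aff_ve]; rfl

lemma bd_bd (n : ℕ) (c : Ch (n + 2) X) : bd n (bd (n + 1) c) = 0 := by
  have : bd n ∘ₗ bd (n + 1) = (0 : Ch (n + 2) X →ₗ[ℚ] _) := by
    apply ext1
    intro σ
    rw [← push_ve, LinearMap.comp_apply, bd_push, bd_push, tb_tb]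
    simp
  exact LinearMap.congr_fun this c

noncomputable def Sd (n : ℕ) : Ch n X →ₗ[ℚ] Ch n X :=
  Finsupp.linearCombination ℚ (fun σ => push n σ (sd (n + 1) (Finsupp.single (ve n) 1)))

lemma Sd_single (n : ℕ) (σ : C(Dl n, X)) : Sd n (Finsupp.single σ 1) =
    push n σ (sd (n + 1) (Finsupp.single (ve n) 1)) := by
  simp [Sd]

lemma Sd_push (n : ℕ) (σ : C(K, X)) (c : L (n + 1) K) :
    Sd n (push n σ c) = push n σ (sd (n + 1) c) := by
  have : Sd n ∘ₗ push n σ = push n σ ∘ₗ sd (n + 1) := by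
    apply ext1
    intro v
    rw [LinearMap.comp_apply, LinearMap.comp_apply, push_single, Sd_single,
      ← push_lm n σ _ (aff_isAff v), ← sd_lm _ (aff_isAff v), lm_single, aff_comp_ve]
  exact LinearMap.congr_fun this c

lemma bd_Sd (n : ℕ) (c : Ch (n + 1) X) : bd n (Sd (n + 1) c) = Sd n (bd n c) := by
  have : bd n ∘ₗ Sd (n + 1) = Sd n ∘ₗ bd (X := X) n := by
    apply ext1
    intro σ
    rw [← push_ve, LinearMap.comp_apply, LinearMap.comp_apply, Sd_push, bd_push, bd_push,
      Sd_push, tb_sd]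
  exact LinearMap.congr_fun this c

lemma cmap_Sd (n : ℕ) (f : C(X, Y)) (c : Ch n X) : cmap n f (Sd n c) = Sd n (cmap n f c) := by
  have : cmap n f ∘ₗ Sd n = Sd n ∘ₗ cmap n f := by
    apply ext1
    intro σ
    rw [← push_ve, LinearMap.comp_apply, LinearMap.comp_apply, Sd_push, cmap_push, cmap_push,
      Sd_push]
  exact LinearMap.congr_fun this c

noncomputable def Pr (n : ℕ) : Ch n X →ₗ[ℚ] Ch (n + 1) (X × Dl 1) :=
  Finsupp.linearCombination ℚ (fun σ => push (n + 1) (σ.prodMap (ContinuousMap.id _))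
    (Dd (n + 1) (Finsupp.single (ve n) 1)))

lemma Pr_single (n : ℕ) (σ : C(Dl n, X)) : Pr n (Finsupp.single σ 1) =
    push (n + 1) (σ.prodMap (ContinuousMap.id _)) (Dd (n + 1) (Finsupp.single (ve n) 1)) := by
  simp [Pr]

lemma Pr_push (n : ℕ) (σ : C(K, X)) (c : L (n + 1) K) :
    Pr n (push n σ c) = push (n + 1) (σ.prodMap (ContinuousMap.id _)) (Dd (n + 1) c) := by
  have : Pr n ∘ₗ push n σ = push (n + 1) (σ.prodMap (ContinuousMap.id _)) ∘ₗ Dd (n + 1) := by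
    apply ext1
    intro v
    rw [LinearMap.comp_apply, LinearMap.comp_apply, push_single, Pr_single]
    have h := Dd_lm _ (aff_isAff v) (n + 1) (Finsupp.single (ve n) 1)
    rw [lm_single, aff_comp_ve] at h
    rw [h]
    exact (push_lm (n + 1) (σ.prodMap (ContinuousMap.id _))
      ((aff v).prodMap (ContinuousMap.id (Dl 1))) (isAff_prod _ (aff_isAff v)) _).symm
  exact LinearMap.congr_fun this c

def ii (p : Y) : C(X, X × Y) := ⟨fun x => (x, p), by fun_prop⟩

lemma push_ii (n : ℕ) (p : Dl 1) (σ : C(K, X)) (c : L (n + 1) K) (m : IsAff (fun x : K => (x, p))) :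
    push n (σ.prodMap (ContinuousMap.id _)) (lm (n + 1) (fun x => (x, p)) c) =
      cmap n (ii p) (push n σ c) := by
  rw [cmap_push]
  exact push_lm n _ (ii p) m c

lemma isAff_ii (p : Dl 1) : IsAff (fun x : K => (x, p)) := by
  intro n w v
  refine Prod.ext rfl ?_
  apply Subtype.ext
  funext k
  change p k = ∑ i, w i * p k
  rw [← Finset.sum_mul]
  have : ∑ i, w i = 1 := w.2.2
  rw [this, one_mul]

lemma bd_Pr0 (c : Ch 0 X) : bd 0 (Pr 0 c) = cmap 0 (ii v1) (Sd 0 c) - cmap 0 (ii v0) c := by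
  have : bd 0 ∘ₗ Pr 0 = cmap 0 (ii v1) ∘ₗ (Sd 0) - cmap (X := X) 0 (ii v0) := by
    apply ext1
    intro σ
    rw [← push_ve]
    simp only [LinearMap.comp_apply, LinearMap.sub_apply]
    rw [Pr_push, bd_push, tb_Dd, Sd_push, map_sub, map_sub, push_ii _ _ _ _ (isAff_ii _),
      push_ii _ _ _ _ (isAff_ii _)]
    simp [Dd]
  exact LinearMap.congr_fun this c

lemma bd_Pr (n : ℕ) (c : Ch (n + 1) X) : bd (n + 1) (Pr (n + 1) c) =
    cmap (n + 1) (ii v1) (Sd (n + 1) c) - cmap (n + 1) (ii v0) c - Pr n (bd n c) := by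
  have : bd (n + 1) ∘ₗ Pr (n + 1) = cmap (n + 1) (ii v1) ∘ₗ (Sd (n + 1))
      - cmap (X := X) (n + 1) (ii v0) - Pr n ∘ₗ bd n := by
    apply ext1
    intro σ
    rw [← push_ve]
    simp only [LinearMap.comp_apply, LinearMap.sub_apply]
    rw [Pr_push, bd_push, tb_Dd, Sd_push, map_sub, map_sub, push_ii _ _ _ _ (isAff_ii _),
      push_ii _ _ _ _ (isAff_ii _), bd_push, Pr_push]
  exact LinearMap.congr_fun this c

/-- homology -/
noncomputable def bz : (i : ℕ) → Ch i X →ₗ[ℚ] Ch (i - 1) X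
  | 0 => 0
  | i + 1 => bd i

lemma bz_cmap (i : ℕ) (f : C(X, Y)) (c : Ch i X) : bz i (cmap i f c) = cmap (i - 1) f (bz i c) := by
  cases i with
  | zero => simp [bz]
  | succ i => exact bd_cmap i f c

lemma bz_bd (i : ℕ) (c : Ch (i + 1) X) : bz i (bd i c) = 0 := by
  cases i with
  | zero => simp [bz]
  | succ i => exact bd_bd i c

lemma bz_Sd (i : ℕ) (c : Ch i X) : bz i (Sd i c) = Sd (i - 1) (bz i c) := by
  cases i with
  | zero => simp [bz]
  | succ i => exact bd_Sd i c

abbrev HQ (i : ℕ) (X : Type) [TopologicalSpace X] :=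
  LinearMap.ker (bz (X := X) i) ⧸ (LinearMap.range (bd (X := X) i)).submoduleOf (LinearMap.ker (bz i))

def H (i : ℕ) (X : Type) [TopologicalSpace X] : Type := HQ i X

noncomputable instance (i : ℕ) (X : Type) [TopologicalSpace X] : AddCommGroup (H i X) :=
  inferInstanceAs (AddCommGroup (HQ i X))

noncomputable instance (i : ℕ) (X : Type) [TopologicalSpace X] : Module ℚ (H i X) :=
  inferInstanceAs (Module ℚ (HQ i X))

noncomputable def cls {i : ℕ} (c : Ch i X) (hc : bz i c = 0) : H i X :=
  (Submodule.Quotient.mk ⟨c, hc⟩ : HQ i X)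

lemma cls_surj {i : ℕ} (y : H i X) : ∃ c hc, y = cls c hc := by
  obtain ⟨⟨c, hc⟩, rfl⟩ := Submodule.Quotient.mk_surjective _ y
  exact ⟨c, hc, rfl⟩

lemma cls_eq {i : ℕ} {c c' : Ch i X} {hc : bz i c = 0} {hc' : bz i c' = 0} :
    cls c hc = cls c' hc' ↔ ∃ b, bd i b = c - c' := by
  exact Submodule.Quotient.eq ((LinearMap.range (bd (X := X) i)).submoduleOf (LinearMap.ker (bz i)))

lemma cls_eq_zero {i : ℕ} {c : Ch i X} {hc : bz i c = 0} :
    cls c hc = 0 ↔ ∃ b, bd i b = c := by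
  exact Submodule.Quotient.mk_eq_zero
    ((LinearMap.range (bd (X := X) i)).submoduleOf (LinearMap.ker (bz i)))

lemma cls_add {i : ℕ} {c c' : Ch i X} {hc : bz i c = 0} {hc' : bz i c' = 0} :
    cls c hc + cls c' hc' = cls (c + c') (by rw [map_add, hc, hc', add_zero]) := rfl

lemma cls_smul {i : ℕ} {c : Ch i X} {hc : bz i c = 0} (r : ℚ) :
    r • cls c hc = cls (r • c) (by rw [map_smul, hc, smul_zero]) := rfl

lemma cls_neg {i : ℕ} {c : Ch i X} {hc : bz i c = 0} :
    - cls c hc = cls (- c) (by rw [map_neg, hc, neg_zero]) := rfl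

noncomputable def hm (i : ℕ) (f : C(X, Y)) : H i X →ₗ[ℚ] H i Y :=
  Submodule.mapQ ((LinearMap.range (bd (X := X) i)).submoduleOf (LinearMap.ker (bz i)))
    ((LinearMap.range (bd (X := Y) i)).submoduleOf (LinearMap.ker (bz i))) ((cmap i f).restrict (fun c (hc : bz i c = 0) => by
    change bz i _ = 0; rw [bz_cmap, hc, map_zero])) (by
    rintro ⟨c, hc⟩ ⟨b, hb⟩
    refine ⟨cmap (i + 1) f b, ?_⟩
    rw [bd_cmap, hb]; rfl)

lemma hm_cls {i : ℕ} (f : C(X, Y)) {c : Ch i X} {hc : bz i c = 0} :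
    hm i f (cls c hc) = cls (cmap i f c) (by rw [bz_cmap, hc, map_zero]) := rfl

lemma cls_congr {i : ℕ} {c c' : Ch i X} {hc : bz i c = 0} {hc' : bz i c' = 0} (h : c = c') :
    cls c hc = cls c' hc' := by subst h; rfl

lemma hm_comp {i : ℕ} (g : C(Y, Z)) (f : C(X, Y)) (y : H i X) :
    hm i g (hm i f y) = hm i (g.comp f) y := by
  obtain ⟨c, hc, rfl⟩ := cls_surj y
  simp only [hm_cls]
  exact cls_congr (cmap_comp _ _ _ _).symm

lemma hm_id {i : ℕ} (y : H i X) : hm i (ContinuousMap.id X) y = y := by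
  obtain ⟨c, hc, rfl⟩ := cls_surj y
  simp only [hm_cls]
  exact cls_congr (cmap_id _ _)

lemma bd_Pr_cyc (i : ℕ) (c : Ch i X) (hc : bz i c = 0) :
    bd i (Pr i c) = cmap i (ii v1) (Sd i c) - cmap i (ii v0) c := by
  cases i with
  | zero => exact bd_Pr0 c
  | succ i => rw [bd_Pr, show bd i c = 0 from hc, map_zero, sub_zero]

lemma Sd_cls (i : ℕ) (c : Ch i X) (hc : bz i c = 0) (h' : bz i (Sd i c) = 0) :
    cls (Sd i c) h' = cls c hc := by
  rw [cls_eq]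
  refine ⟨cmap _ ⟨Prod.fst, continuous_fst⟩ (Pr i c), ?_⟩
  rw [bd_cmap, bd_Pr_cyc _ _ hc, map_sub, ← cmap_comp, ← cmap_comp]
  exact congrArg₂ _ (cmap_id _ _) (cmap_id _ _)

lemma hm_simplex_homotopy (i : ℕ) (F : C(X × Dl 1, Y)) :
    hm i (F.comp (ii v0)) = hm i (F.comp (ii v1)) := by
  refine LinearMap.ext fun y => ?_
  obtain ⟨c, hc, rfl⟩ := cls_surj y
  have h' : bz i (Sd i c) = 0 := by rw [bz_Sd, hc, map_zero]
  conv_rhs => rw [← Sd_cls i c hc h']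
  rw [hm_cls, hm_cls]
  symm
  rw [cls_eq]
  refine ⟨cmap _ F (Pr i c), ?_⟩
  rw [bd_cmap, bd_Pr_cyc _ _ hc, map_sub, ← cmap_comp, ← cmap_comp]

lemma hm_homotopic (i : ℕ) {f g : C(X, Y)} (h : f.Homotopic g) : hm i f = hm i g := by
  obtain ⟨G⟩ := h
  let q : C(Dl 1, unitInterval) :=
    ⟨fun w => ⟨w 1, w.2.1 1, by
      have : w 0 + w 1 = 1 := by have := w.2.2; rwa [Fin.sum_univ_two] at this
      have h0 : 0 ≤ w 0 := w.2.1 0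
      linarith⟩, by
      refine Continuous.subtype_mk ?_ _
      exact (continuous_apply 1).comp continuous_subtype_val⟩
  have := hm_simplex_homotopy i ((G : C(unitInterval × X, Y)).comp
    (⟨fun p : X × Dl 1 => (q p.2, p.1), by fun_prop⟩ : C(X × Dl 1, unitInterval × X)))
  have q0 : q v0 = 0 := Subtype.ext (by
    change (Pi.single 0 (1 : ℝ) : Fin 2 → ℝ) 1 = 0; simp)
  have q1 : q v1 = 1 := Subtype.ext (by
    change (Pi.single 1 (1 : ℝ) : Fin 2 → ℝ) 1 = 1; simp)
  convert this using 2
  · ext x; change f x = G (q v0, x); rw [q0]; simp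
  · ext x; change g x = G (q v1, x); rw [q1]; simp

end CB

namespace CB
open Cvx

variable {X Y Z : Type} [TopologicalSpace X] [TopologicalSpace Y] [TopologicalSpace Z]

lemma comb_convex {n m : ℕ} (C : Set (Fin (m + 1) → ℝ)) (hC : Convex ℝ C) (w : Dl n)
    (v : Fin (n + 1) → Dl m) (hv : ∀ i, (v i).1 ∈ C) : (comb w v).1 ∈ C := by
  have : (comb w v).1 = ∑ i, w i • (v i).1 := by
    funext k
    rw [Finset.sum_apply]
    rfl
  rw [this]
  exact hC.sum_mem (fun i _ => w.2.1 i) w.2.2 (fun i _ => hv i)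

lemma bary_dist {n m : ℕ} (v : Fin (n + 1) → Dl m) (d : ℝ) (hd : ∀ i j, dist (v i) (v j) ≤ d)
    (j : Fin (n + 1)) : dist (bary v) (v j) ≤ (n / (n + 1) : ℝ) * d := by
  have hn : (0 : ℝ) < n + 1 := by positivity
  rw [Subtype.dist_eq, dist_eq_norm]
  have : (bary v).1 - (v j).1 = ∑ i, ((n : ℝ) + 1)⁻¹ • ((v i).1 - (v j).1) := by
    funext k
    rw [Finset.sum_apply]
    have h1 : (bary v).1 k = ∑ i, ((n : ℝ) + 1)⁻¹ * (v i).1 k := by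
      change ∑ i, (stdSimplex.barycenter (𝕜 := ℝ) (X := Fin (n+1))).1 i * (v i).1 k = _
      refine Finset.sum_congr rfl fun i _ => ?_
      have := stdSimplex.barycenter_apply (𝕜 := ℝ) (X := Fin (n+1)) i
      rw [this]; simp
    simp only [Pi.sub_apply, Pi.smul_apply, smul_eq_mul, mul_sub, Finset.sum_sub_distrib, h1]
    simp
    field_simp
  rw [this]
  refine (norm_sum_le _ _).trans ?_
  have h2 : ∀ i, ‖((n : ℝ) + 1)⁻¹ • ((v i).1 - (v j).1)‖ ≤ if i = j then 0 else ((n : ℝ) + 1)⁻¹ * d := by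
    intro i
    split_ifs with h
    · subst h; simp
    · rw [norm_smul, Real.norm_of_nonneg (by positivity)]
      have := hd i j
      rw [Subtype.dist_eq, dist_eq_norm] at this
      gcongr
  refine (Finset.sum_le_sum fun i _ => h2 i).trans ?_
  rw [Finset.sum_ite]
  simp only [Finset.sum_const_zero, zero_add, Finset.sum_const, nsmul_eq_mul]
  rw [Finset.filter_ne', Finset.card_erase_of_mem (Finset.mem_univ _)]
  simp
  apply le_of_eq
  field_simp

lemma lmap_supp {S T : Type*} (f : S → T) (s : Set S) (t : Set T) (h : ∀ x ∈ s, f x ∈ t)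
    (c : S →₀ ℚ) (hc : c ∈ Finsupp.supported ℚ ℚ s) :
    Finsupp.lmapDomain ℚ ℚ f c ∈ Finsupp.supported ℚ ℚ t := by
  have : Finsupp.lmapDomain ℚ ℚ f c ∈ (Finsupp.supported ℚ ℚ s).map (Finsupp.lmapDomain ℚ ℚ f) :=
    ⟨c, hc, rfl⟩
  rw [Finsupp.lmapDomain_supported] at this
  exact Finsupp.supported_mono (Set.image_subset_iff.2 h) this

/-- a linear map sends `supported s` into N if it sends singles there -/
lemma supp_le {S M : Type*} [AddCommGroup M] [Module ℚ M] (f : (S →₀ ℚ) →ₗ[ℚ] M)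
    (N : Submodule ℚ M) (s : Set S) (h : ∀ x ∈ s, f (Finsupp.single x 1) ∈ N)
    (c : S →₀ ℚ) (hc : c ∈ Finsupp.supported ℚ ℚ s) : f c ∈ N := by
  rw [Finsupp.supported_eq_span_single] at hc
  induction hc using Submodule.span_induction with
  | mem x hx => obtain ⟨y, hy, rfl⟩ := hx; exact h y hy
  | zero => simp
  | add x y _ _ hx hy => rw [map_add]; exact N.add_mem hx hy
  | smul a x _ hx => rw [map_smul]; exact N.smul_mem _ hx

def Sml {n m : ℕ} (v u : Fin n → Dl m) (d : ℝ) : Prop :=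
  (∀ C : Set (Fin (m + 1) → ℝ), Convex ℝ C → (∀ i, (v i).1 ∈ C) → ∀ i, (u i).1 ∈ C) ∧
    ∀ i j, dist (u i) (u j) ≤ d

lemma r_mono (n : ℕ) : (n / (n + 1) : ℝ) ≤ ((n + 1 : ℕ) : ℝ) / ((n + 1 : ℕ) + 1) := by
  push_cast
  rw [div_le_div_iff₀ (by positivity) (by positivity)]
  nlinarith

lemma sd_small {m : ℕ} (n : ℕ) : ∀ (v : Fin n → Dl m) (d : ℝ) (_ : 0 ≤ d)
    (_ : ∀ i j, dist (v i) (v j) ≤ d),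
    sd n (Finsupp.single v 1) ∈ Finsupp.supported ℚ ℚ {u | Sml v u ((n / (n + 1) : ℝ) * d)} := by
  induction n with
  | zero =>
    intro v d hd h
    apply Finsupp.single_mem_supported
    exact ⟨fun C _ _ i => i.elim0, fun i => i.elim0⟩
  | succ n ih =>
    intro v d hd h
    rw [sd_single, tb_single, map_sum]
    simp only [map_smul]
    rw [map_sum]
    refine Submodule.sum_mem _ fun j _ => ?_
    rw [map_smul]
    refine Submodule.smul_mem _ _ ?_
    refine lmap_supp _ _ _ ?_ _ (ih (v ∘ j.succAbove) d hd (fun _ _ => h _ _))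
    rintro u ⟨h1, h2⟩
    have hb : ∀ i, dist (bary v) (u i) ≤ ((n + 1 : ℕ) / ((n + 1 : ℕ) + 1) : ℝ) * d := by
      intro i
      refine le_trans ?_ (mul_le_mul_of_nonneg_right (r_mono n) hd)
      have := h1 (Metric.closedBall (bary v).1 ((n / (n + 1) : ℝ) * d)) (convex_closedBall _ _)
        (fun i => by
          rw [Metric.mem_closedBall, dist_comm]
          exact bary_dist v d h _) i
      rw [Metric.mem_closedBall, dist_comm] at this
      exact this
    constructor
    · intro C hC hv i
      refine Fin.cases ?_ (fun i => ?_) i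
      · exact comb_convex C hC _ v hv
      · exact h1 C hC (fun i => hv _) i
    · intro i k
      refine Fin.cases ?_ (fun i => ?_) i
      · refine Fin.cases ?_ (fun k => ?_) k
        · simp; positivity
        · exact hb k
      · refine Fin.cases ?_ (fun k => ?_) k
        · rw [dist_comm]; exact hb i
        · exact (h2 i k).trans (mul_le_mul_of_nonneg_right (r_mono n) hd)

lemma sd_iter_small {m n : ℕ} (v : Fin n → Dl m) (d : ℝ) (hd : 0 ≤ d)
    (h : ∀ i j, dist (v i) (v j) ≤ d) (k : ℕ) :
    (sd n)^[k] (Finsupp.single v 1) ∈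
      Finsupp.supported ℚ ℚ {u | ∀ i j, dist (u i) (u j) ≤ ((n / (n + 1) : ℝ)) ^ k * d} := by
  induction k with
  | zero =>
    apply Finsupp.single_mem_supported
    simpa using h
  | succ k ih =>
    rw [Function.iterate_succ_apply']
    refine supp_le _ _ _ ?_ _ ih
    intro u hu
    refine Finsupp.supported_mono ?_ (sd_small n u _ (by positivity) hu)
    rintro w ⟨_, hw⟩ i j
    rw [pow_succ']
    rw [mul_assoc]
    exact hw i j

lemma Sd_iter_push {n m : ℕ} (σ : C(Dl m, X)) (c : L (n + 1) (Dl m)) (k : ℕ) :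
    (Sd n)^[k] (push n σ c) = push n σ ((sd (n + 1))^[k] c) := by
  induction k with
  | zero => rfl
  | succ k ih => rw [Function.iterate_succ_apply', ih, Sd_push, Function.iterate_succ_apply']

lemma Sd_range (n : ℕ) (U : Set X) (c : Ch n X)
    (hc : c ∈ Finsupp.supported ℚ ℚ {σ : C(Dl n, X) | Set.range σ ⊆ U}) :
    Sd n c ∈ Finsupp.supported ℚ ℚ {σ : C(Dl n, X) | Set.range σ ⊆ U} := by
  refine supp_le _ _ _ ?_ _ hc
  intro σ hσ
  rw [Sd_single]
  refine lmap_supp _ Set.univ _ ?_ _ (by simp)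
  rintro v - x ⟨y, rfl⟩
  exact hσ ⟨_, rfl⟩

lemma small_single (n : ℕ) (U V : Set X) (hU : IsOpen U) (hV : IsOpen V)
    (hUV : ∀ x, x ∈ U ∨ x ∈ V) (σ : C(Dl n, X)) : ∃ k, (Sd n)^[k] (Finsupp.single σ 1) ∈
      Finsupp.supported ℚ ℚ {τ : C(Dl n, X) | Set.range τ ⊆ U} ⊔
      Finsupp.supported ℚ ℚ {τ : C(Dl n, X) | Set.range τ ⊆ V} := by
  obtain ⟨δ, hδ, hL⟩ := lebesgue_number_lemma_of_metric (s := (Set.univ : Set (Dl n)))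
    (c := fun b : Bool => if b then σ ⁻¹' U else σ ⁻¹' V) isCompact_univ
    (by
      intro b; cases b
      · exact hV.preimage σ.continuous
      · exact hU.preimage σ.continuous)
    (by
      intro x _
      rcases hUV (σ x) with h | h
      · exact Set.mem_iUnion.2 ⟨true, h⟩
      · exact Set.mem_iUnion.2 ⟨false, h⟩)
  let D : ℝ := Metric.diam (Set.univ : Set (Dl n))
  have hD : ∀ i j, dist (ve n i) (ve n j) ≤ D := fun i j =>
    Metric.dist_le_diam_of_mem isCompact_univ.isBounded trivial trivial
  have hr : (((n + 1 : ℕ) : ℝ) / ((n + 1 : ℕ) + 1) : ℝ) < 1 := by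
    rw [div_lt_one (by positivity)]; linarith
  obtain ⟨k, hk⟩ : ∃ k, (((n + 1 : ℕ) : ℝ) / ((n + 1 : ℕ) + 1)) ^ k * D < δ := by
    have := (tendsto_pow_atTop_nhds_zero_of_lt_one (by positivity) hr).mul_const D
    rw [zero_mul] at this
    exact (this.eventually (gt_mem_nhds hδ)).exists
  refine ⟨k, ?_⟩
  rw [← push_ve, Sd_iter_push]
  refine supp_le _ _ _ ?_ _ (sd_iter_small (ve n) D Metric.diam_nonneg hD k)
  intro u hu
  rw [push_single]
  obtain ⟨b, hb⟩ := hL (u 0) trivial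
  have key : ∀ w, aff u w ∈ Metric.ball (u 0) δ := by
    intro w
    have := comb_convex (Metric.ball (u 0).1 δ) (convex_ball _ _) w u (fun i =>
      lt_of_le_of_lt (hu i 0) hk)
    exact this
  cases b
  · refine Submodule.mem_sup_right (Finsupp.single_mem_supported _ _ ?_)
    rintro _ ⟨w, rfl⟩
    exact hb (key w)
  · refine Submodule.mem_sup_left (Finsupp.single_mem_supported _ _ ?_)
    rintro _ ⟨w, rfl⟩
    exact hb (key w)

lemma small_iter (n : ℕ) (U V : Set X) (c : Ch n X) (k : ℕ)
    (hc : c ∈ Finsupp.supported ℚ ℚ {τ : C(Dl n, X) | Set.range τ ⊆ U} ⊔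
      Finsupp.supported ℚ ℚ {τ : C(Dl n, X) | Set.range τ ⊆ V}) : (Sd n)^[k] c ∈
      Finsupp.supported ℚ ℚ {τ : C(Dl n, X) | Set.range τ ⊆ U} ⊔
      Finsupp.supported ℚ ℚ {τ : C(Dl n, X) | Set.range τ ⊆ V} := by
  induction k with
  | zero => exact hc
  | succ k ih =>
    rw [Function.iterate_succ_apply']
    obtain ⟨a, ha, b, hb, h⟩ := Submodule.mem_sup.1 ih
    rw [← h, map_add]
    exact Submodule.add_mem_sup (Sd_range n U a ha) (Sd_range n V b hb)

lemma Sd_iter_eq (n k : ℕ) (c : Ch n X) : (Sd n)^[k] c = ((Sd n) ^ k : Module.End ℚ _) c := by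
  rw [Module.End.pow_apply]

lemma small (n : ℕ) (U V : Set X) (hU : IsOpen U) (hV : IsOpen V)
    (hUV : ∀ x, x ∈ U ∨ x ∈ V) (c : Ch n X) : ∃ k, ((Sd n) ^ k : Module.End ℚ _) c ∈
      Finsupp.supported ℚ ℚ {τ : C(Dl n, X) | Set.range τ ⊆ U} ⊔
      Finsupp.supported ℚ ℚ {τ : C(Dl n, X) | Set.range τ ⊆ V} := by
  simp_rw [← Sd_iter_eq]
  induction c using Finsupp.induction_linear with
  | zero => exact ⟨0, by simp⟩
  | add f g hf hg =>
    obtain ⟨k, hk⟩ := hf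
    obtain ⟨l, hl⟩ := hg
    refine ⟨k + l, ?_⟩
    have h1 : (Sd n)^[k + l] f = (Sd n)^[l] ((Sd n)^[k] f) := by
      rw [add_comm k l, Function.iterate_add_apply]
    have h2 : (Sd n)^[k + l] g = (Sd n)^[k] ((Sd n)^[l] g) := by
      rw [Function.iterate_add_apply]
    rw [Sd_iter_eq, map_add, ← Sd_iter_eq, ← Sd_iter_eq, h1, h2]
    exact Submodule.add_mem _ (small_iter _ _ _ _ _ hk) (small_iter _ _ _ _ _ hl)
  | single σ r =>
    obtain ⟨k, hk⟩ := small_single n U V hU hV hUV σ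
    refine ⟨k, ?_⟩
    have : Finsupp.single σ r = r • Finsupp.single σ (1 : ℚ) := by simp
    rw [this, Sd_iter_eq, map_smul, ← Sd_iter_eq]
    exact Submodule.smul_mem _ _ hk

/-- powers of subdivision -/
noncomputable def Sp (k n : ℕ) : Ch n X →ₗ[ℚ] Ch n X := (Sd n) ^ k

lemma Sp_succ (k n : ℕ) (c : Ch n X) : Sp (k + 1) n c = Sd n (Sp k n c) := by
  rw [Sp, pow_succ']; rfl

lemma bd_Sp (k n : ℕ) (c : Ch (n + 1) X) : bd n (Sp k (n + 1) c) = Sp k n (bd n c) := by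
  induction k with
  | zero => rfl
  | succ k ih => rw [Sp_succ, bd_Sd, ih, Sp_succ]

lemma bz_Sp (k i : ℕ) (c : Ch i X) (hc : bz i c = 0) : bz i (Sp k i c) = 0 := by
  induction k with
  | zero => exact hc
  | succ k ih => rw [Sp_succ, bz_Sd, ih, map_zero]

lemma cmap_Sp (k n : ℕ) (f : C(X, Y)) (c : Ch n X) :
    cmap n f (Sp k n c) = Sp k n (cmap n f c) := by
  induction k with
  | zero => rfl
  | succ k ih => rw [Sp_succ, cmap_Sd, ih, Sp_succ]

lemma Sp_cls (k i : ℕ) (c : Ch i X) (hc : bz i c = 0) :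
    cls (Sp k i c) (bz_Sp k i c hc) = cls c hc := by
  induction k with
  | zero => rfl
  | succ k ih =>
    rw [← ih, cls_congr (Sp_succ k i c)
      (hc' := by rw [← Sp_succ]; exact bz_Sp _ i c hc), Sd_cls _ _ (bz_Sp k i c hc)]

end CB

namespace CB

variable {X A B W : Type} [TopologicalSpace X] [TopologicalSpace A] [TopologicalSpace B]
  [TopologicalSpace W]

structure MV (f : C(A, X)) (g : C(B, X)) (k : C(W, A)) (l : C(W, B)) : Prop where
  hf : Topology.IsOpenEmbedding f
  hg : Topology.IsOpenEmbedding g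
  hk : Topology.IsEmbedding k
  hl : Topology.IsEmbedding l
  comm : f.comp k = g.comp l
  surj : ∀ x, x ∈ Set.range f ∨ x ∈ Set.range g
  pull : ∀ a b, f a = g b → ∃ w, k w = a

lemma MV.symm {f : C(A, X)} {g : C(B, X)} {k : C(W, A)} {l : C(W, B)} (h : MV f g k l) :
    MV g f l k where
  hf := h.hg
  hg := h.hf
  hk := h.hl
  hl := h.hk
  comm := h.comm.symm
  surj x := (h.surj x).symm
  pull a b hab := by
    obtain ⟨w, rfl⟩ := h.pull b a hab.symm
    refine ⟨w, ?_⟩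
    apply h.hg.injective
    rw [hab]
    exact (DFunLike.congr_fun h.comm w).symm

lemma lift_emb {n : ℕ} {f : C(A, X)} (hf : Topology.IsEmbedding f) (σ : C(Dl n, X))
    (h : ∀ x, σ x ∈ Set.range f) : ∃ τ : C(Dl n, A), f.comp τ = σ := by
  choose t ht using h
  refine ⟨⟨t, hf.isInducing.continuous_iff.2 ?_⟩, ?_⟩
  · rw [show f ∘ t = σ from funext ht]; exact σ.continuous
  · ext x; exact ht x

lemma cmap_inj {f : C(A, X)} (hf : Function.Injective f) (n : ℕ) :
    Function.Injective (cmap n f) := by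
  apply Finsupp.mapDomain_injective
  intro σ τ h
  ext x
  exact hf (DFunLike.congr_fun h x)

lemma supp_lift {n : ℕ} {f : C(A, X)} (hf : Topology.IsEmbedding f) (c : Ch n X)
    (hc : c ∈ Finsupp.supported ℚ ℚ {τ : C(Dl n, X) | Set.range τ ⊆ Set.range f}) :
    ∃ a, cmap n f a = c := by
  refine supp_le LinearMap.id (LinearMap.range (cmap n f)) _ ?_ c hc
  intro σ hσ
  obtain ⟨τ, hτ⟩ := lift_emb hf σ (fun x => hσ ⟨x, rfl⟩)
  exact ⟨Finsupp.single τ 1, by rw [cmap_single, hτ]; rfl⟩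

variable {f : C(A, X)} {g : C(B, X)} {k : C(W, A)} {l : C(W, B)}

lemma MV.small (h : MV f g k l) (n : ℕ) (c : Ch n X) :
    ∃ m a b, Sp m n c = cmap n f a + cmap n g b := by
  obtain ⟨m, hm⟩ := CB.small n (Set.range f) (Set.range g) h.hf.isOpen_range h.hg.isOpen_range
    h.surj c
  obtain ⟨x, hx, y, hy, e⟩ := Submodule.mem_sup.1 hm
  obtain ⟨a, rfl⟩ := supp_lift h.hf.isEmbedding x hx
  obtain ⟨b, rfl⟩ := supp_lift h.hg.isEmbedding y hy
  exact ⟨m, a, b, e.symm⟩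

lemma MV.comm_ch (h : MV f g k l) (n : ℕ) (c : Ch n W) :
    cmap n f (cmap n k c) = cmap n g (cmap n l c) := by
  rw [← cmap_comp, ← cmap_comp, h.comm]

lemma MV.inter (h : MV f g k l) (n : ℕ) (a : Ch n A) (b : Ch n B)
    (hab : cmap n f a + cmap n g b = 0) : ∃ w, cmap n k w = a ∧ cmap n l w = -b := by
  have h1 : cmap n f a = cmap n g (-b) := by rw [map_neg]; exact eq_neg_of_add_eq_zero_left hab
  have : ∃ w, cmap n k w = a := by
    apply supp_lift h.hk
    intro σ hσ
    rintro _ ⟨x, rfl⟩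
    have h2 : f.comp σ ∈ (cmap n f a).support := by
      rw [Finsupp.mem_support_iff]
      have hinj : Function.Injective (fun σ : C(Dl n, A) => f.comp σ) := by
        intro σ τ h'
        ext x
        exact h.hf.injective (DFunLike.congr_fun h' x)
      have := Finsupp.mapDomain_apply hinj a σ
      rw [cmap, Finsupp.lmapDomain_apply]
      change Finsupp.mapDomain _ a ((fun σ : C(Dl n, A) => f.comp σ) σ) ≠ 0
      rw [this]
      exact Finsupp.mem_support_iff.1 hσ
    rw [h1] at h2
    classical
    have h3 := Finsupp.mapDomain_support h2
    obtain ⟨τ, _, hτ⟩ := Finset.mem_image.1 h3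
    exact h.pull (σ x) (τ x) (DFunLike.congr_fun hτ x).symm
  obtain ⟨w, rfl⟩ := this
  refine ⟨w, rfl, ?_⟩
  apply cmap_inj h.hg.injective
  rw [← h1, h.comm_ch]

lemma MV.mv1 (h : MV f g k l) {i : ℕ} (α : H i A) (β : H i B)
    (hab : hm i f α + hm i g β = 0) : ∃ w, hm i k w = α ∧ hm i l w = -β := by
  obtain ⟨a, ha, rfl⟩ := cls_surj α
  obtain ⟨b, hb, rfl⟩ := cls_surj β
  rw [hm_cls, hm_cls, cls_add, cls_eq_zero] at hab
  obtain ⟨x, hx⟩ := hab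
  obtain ⟨m, p, q, hpq⟩ := h.small (i + 1) x
  have h1 := congrArg (bd i) hpq
  rw [bd_Sp, hx, map_add, map_add, ← cmap_Sp, ← cmap_Sp, bd_cmap, bd_cmap] at h1
  obtain ⟨w, hw1, hw2⟩ := h.inter i (Sp m i a - bd i p) (Sp m i b - bd i q) (by
    rw [map_sub, map_sub, sub_add_sub_comm, sub_eq_zero]; exact h1)
  have hw : bz i w = 0 := by
    apply cmap_inj h.hk.injective
    rw [← bz_cmap, hw1, map_sub, bz_Sp _ _ _ ha, bz_bd]; simp
  refine ⟨cls w hw, ?_, ?_⟩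
  · rw [← Sp_cls m i a ha, hm_cls, cls_eq]
    exact ⟨-p, by rw [hw1, map_neg]; abel⟩
  · rw [← Sp_cls m i b hb, hm_cls, cls_neg, cls_eq]
    exact ⟨q, by rw [hw2]; abel⟩

/-- the Mayer-Vietoris boundary, as a relation -/
def Rel (f : C(A, X)) (g : C(B, X)) (k : C(W, A)) (l : C(W, B)) (i : ℕ)
    (y : H (i + 1) X) (w : H i W) : Prop :=
  ∃ (a : Ch (i + 1) A) (b : Ch (i + 1) B) (z : Ch i W) (hz : bz i z = 0)
    (hy : bz (i + 1) (cmap _ f a + cmap _ g b) = 0),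
    bd i a = cmap i k z ∧ bd i b = -cmap i l z ∧ y = cls _ hy ∧ w = cls z hz

lemma MV.r1 (h : MV f g k l) {i : ℕ} (w : H i W) (h1 : hm i k w = 0) (h2 : hm i l w = 0) :
    ∃ y, Rel f g k l i y w := by
  obtain ⟨z, hz, rfl⟩ := cls_surj w
  rw [hm_cls, cls_eq_zero] at h1 h2
  obtain ⟨a, ha⟩ := h1
  obtain ⟨b, hb⟩ := h2
  have hy : bz (i + 1) (cmap _ f a + cmap _ g (-b)) = 0 := by
    change bd i _ = 0
    rw [map_add, bd_cmap, bd_cmap, map_neg, map_neg, ha, hb, h.comm_ch, add_neg_cancel]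
  exact ⟨_, a, -b, z, hz, hy, ha, by rw [map_neg, hb], rfl, rfl⟩

lemma MV.r2 (h : MV f g k l) {i : ℕ} (w : H i W) (α : H (i + 1) A) (β : H (i + 1) B)
    (hR : Rel f g k l i (hm _ f α + hm _ g β) w) : w = 0 := by
  obtain ⟨a, b, z, hz, hy, h1, h2, h3, rfl⟩ := hR
  obtain ⟨a', ha, rfl⟩ := cls_surj α
  obtain ⟨b', hb, rfl⟩ := cls_surj β
  rw [hm_cls, hm_cls, cls_add, cls_eq] at h3
  obtain ⟨x, hx⟩ := h3
  obtain ⟨m, p, q, hpq⟩ := h.small (i + 2) x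
  have e1 := congrArg (bd (i + 1)) hpq
  rw [bd_Sp, hx, map_sub, map_add, map_add, map_add] at e1
  simp only [← cmap_Sp, bd_cmap] at e1
  obtain ⟨c, hc1, hc2⟩ := h.inter (i + 1) (Sp m _ (a' - a) - bd (i + 1) p)
    (Sp m _ (b' - b) - bd (i + 1) q) (by
      simp only [map_sub]
      rw [← sub_eq_zero] at e1
      rw [← e1]; abel)
  have e2 := congrArg (bd i) hc1
  rw [bd_cmap, map_sub, bd_bd, bd_Sp, map_sub, show bd i a' = 0 from ha, h1, sub_zero, zero_sub,
    ← map_neg, ← cmap_Sp] at e2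
  have e3 := cmap_inj h.hk.injective _ e2
  rw [← Sp_cls m, cls_eq_zero]
  refine ⟨-c, ?_⟩
  rw [map_neg, e3, map_neg, neg_neg]

lemma MV.r3 (h : MV f g k l) {i : ℕ} (y : H (i + 1) X) : ∃ w, Rel f g k l i y w := by
  obtain ⟨c, hc, rfl⟩ := cls_surj y
  obtain ⟨m, a, b, hab⟩ := h.small (i + 1) c
  have hS := bz_Sp m (i + 1) c hc
  have e := hS
  rw [hab] at e
  have e1 := e
  change bd i _ = 0 at e1
  rw [map_add, bd_cmap, bd_cmap] at e1
  obtain ⟨z, hz1, hz2⟩ := h.inter i _ _ e1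
  have hz : bz i z = 0 := by
    apply cmap_inj h.hk.injective
    rw [← bz_cmap, hz1, bz_bd, map_zero]
  refine ⟨cls z hz, a, b, z, hz, e, hz1.symm, by rw [hz2, neg_neg], ?_, rfl⟩
  rw [← Sp_cls m]
  exact cls_congr hab

lemma MV.r4 (h : MV f g k l) {i : ℕ} (y : H (i + 1) X) (hR : Rel f g k l i y 0) :
    ∃ α β, y = hm _ f α + hm _ g β := by
  obtain ⟨a, b, z, hz, hy, h1, h2, rfl, h4⟩ := hR
  obtain ⟨c, hc⟩ := cls_eq_zero.1 h4.symm
  have ha : bz (i + 1) (a - cmap _ k c) = 0 := by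
    change bd i _ = 0
    rw [map_sub, bd_cmap, hc, h1, sub_self]
  have hb : bz (i + 1) (b + cmap _ l c) = 0 := by
    change bd i _ = 0
    rw [map_add, bd_cmap, hc, h2, neg_add_cancel]
  refine ⟨cls _ ha, cls _ hb, ?_⟩
  rw [hm_cls, hm_cls, cls_add]
  apply cls_congr
  rw [map_sub, map_add, h.comm_ch]; abel

lemma bz_zero (c : Ch 0 X) : bz 0 c = 0 := rfl

lemma MV.r0 (h : MV f g k l) (y : H 0 X) : ∃ α β, y = hm 0 f α + hm 0 g β := by
  obtain ⟨c, hc, rfl⟩ := cls_surj y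
  obtain ⟨m, a, b, hab⟩ := h.small 0 c
  refine ⟨cls a (bz_zero a), cls b (bz_zero b), ?_⟩
  rw [hm_cls, hm_cls, cls_add, ← Sp_cls m]
  exact cls_congr hab

lemma Rel.add {i : ℕ} {y y' : H (i + 1) X} {w w' : H i W} (h : Rel f g k l i y w)
    (h' : Rel f g k l i y' w') : Rel f g k l i (y + y') (w + w') := by
  obtain ⟨a, b, z, hz, hy, h1, h2, rfl, rfl⟩ := h
  obtain ⟨a', b', z', hz', hy', h1', h2', rfl, rfl⟩ := h'
  have e : cmap _ f a + cmap _ g b + (cmap _ f a' + cmap _ g b') =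
    cmap _ f (a + a') + cmap _ g (b + b') := by rw [map_add, map_add]; abel
  refine ⟨a + a', b + b', z + z', by rw [map_add, hz, hz', add_zero],
    by rw [← e, map_add, hy, hy', add_zero], ?_, ?_, ?_, rfl⟩
  · rw [map_add, h1, h1', map_add]
  · rw [map_add, h2, h2', map_add]; abel
  · rw [cls_add]; exact cls_congr e

lemma Rel.smul {i : ℕ} {y : H (i + 1) X} {w : H i W} (r : ℚ) (h : Rel f g k l i y w) :
    Rel f g k l i (r • y) (r • w) := by
  obtain ⟨a, b, z, hz, hy, h1, h2, rfl, rfl⟩ := h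
  have e : r • (cmap _ f a + cmap _ g b) = cmap _ f (r • a) + cmap _ g (r • b) := by
    rw [map_smul, map_smul, smul_add]
  refine ⟨r • a, r • b, r • z, by rw [map_smul, hz, smul_zero],
    by rw [← e, map_smul, hy, smul_zero], ?_, ?_, ?_, rfl⟩
  · rw [map_smul, h1, map_smul]
  · rw [map_smul, h2, map_smul, smul_neg]
  · rw [cls_smul]; exact cls_congr e

/-- boundary of the connecting relation dies in both pieces -/
lemma Rel.dies {i : ℕ} {y : H (i + 1) X} {w : H i W} (h : Rel f g k l i y w) :
    hm i k w = 0 ∧ hm i l w = 0 := by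
  obtain ⟨a, b, z, hz, hy, h1, h2, rfl, rfl⟩ := h
  rw [hm_cls, hm_cls, cls_eq_zero, cls_eq_zero]
  exact ⟨⟨a, h1⟩, ⟨-b, by rw [map_neg, h2, neg_neg]⟩⟩

/-- symmetry -/
lemma Rel.swap {i : ℕ} {y : H (i + 1) X} {w : H i W} (h : Rel f g k l i y w)
    (tX : C(X, X)) (tA : C(A, B)) (tB : C(B, A)) (tW : C(W, W))
    (h1 : tX.comp f = g.comp tA) (h2 : tX.comp g = f.comp tB)
    (h3 : tA.comp k = l.comp tW) (h4 : tB.comp l = k.comp tW) :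
    Rel f g k l i (hm _ tX y) (-hm i tW w) := by
  obtain ⟨a, b, z, hz, hy, e1, e2, rfl, rfl⟩ := h
  have e : cmap _ tX (cmap _ f a + cmap _ g b) =
      cmap _ f (cmap _ tB b) + cmap _ g (cmap _ tA a) := by
    rw [map_add, ← cmap_comp, ← cmap_comp, h1, h2, cmap_comp, cmap_comp]; abel
  refine ⟨cmap _ tB b, cmap _ tA a, - cmap _ tW z, by rw [map_neg, bz_cmap, hz]; simp,
    by rw [← e, bz_cmap, hy, map_zero], ?_, ?_, ?_, ?_⟩
  · rw [bd_cmap, e2, map_neg, map_neg, ← cmap_comp, ← cmap_comp, h4]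
  · rw [bd_cmap, e1, map_neg, neg_neg, ← cmap_comp, ← cmap_comp, h3]
  · rw [hm_cls]; exact cls_congr e
  · rw [hm_cls, cls_neg]

end CB

namespace CB

variable {X Y Z A B W : Type} [TopologicalSpace X] [TopologicalSpace Y] [TopologicalSpace Z]
  [TopologicalSpace A] [TopologicalSpace B] [TopologicalSpace W]

lemma Rel.zero (f : C(A, X)) (g : C(B, X)) (k : C(W, A)) (l : C(W, B)) (i : ℕ) :
    Rel f g k l i 0 0 :=
  ⟨0, 0, 0, by simp, by simp, by simp, by simp, (cls_eq_zero.2 ⟨0, by simp⟩).symm,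
    (cls_eq_zero.2 ⟨0, by simp⟩).symm⟩

lemma hm_of (i : ℕ) {f g : C(X, Y)} (F : unitInterval × X → Y) (hF : Continuous F)
    (h0 : ∀ x, F (0, x) = f x) (h1 : ∀ x, F (1, x) = g x) : hm i f = hm i g :=
  hm_homotopic i ⟨⟨⟨F, hF⟩, h0, h1⟩⟩

/-- product with a parameter space -/
def px (Z : Type) [TopologicalSpace Z] (f : C(X, Y)) : C(X × Z, Y × Z) :=
  f.prodMap (ContinuousMap.id Z)

lemma MV.prod {f : C(A, X)} {g : C(B, X)} {k : C(W, A)} {l : C(W, B)} (h : MV f g k l) (Z : Type)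
    [TopologicalSpace Z] : MV (px Z f) (px Z g) (px Z k) (px Z l) where
  hf := h.hf.prodMap Topology.IsOpenEmbedding.id
  hg := h.hg.prodMap Topology.IsOpenEmbedding.id
  hk := h.hk.prodMap Topology.IsEmbedding.id
  hl := h.hl.prodMap Topology.IsEmbedding.id
  comm := by
    ext1 ⟨w, z⟩
    exact Prod.ext (DFunLike.congr_fun h.comm w) rfl
  surj := by
    rintro ⟨x, z⟩
    rcases h.surj x with ⟨a, rfl⟩ | ⟨a, rfl⟩
    · exact Or.inl ⟨(a, z), rfl⟩
    · exact Or.inr ⟨(a, z), rfl⟩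
  pull := by
    rintro ⟨a, z⟩ ⟨b, z'⟩ hab
    obtain ⟨w, rfl⟩ := h.pull a b (congrArg Prod.fst hab)
    exact ⟨(w, z), rfl⟩

def inc {E : Type} [TopologicalSpace E] {P S : Set E} (h : P ⊆ S) : C(P, S) :=
  ⟨Set.inclusion h, continuous_inclusion h⟩

lemma inc_open {E : Type} [TopologicalSpace E] {P S : Set E} (h : P ⊆ S) (hP : IsOpen P) :
    Topology.IsOpenEmbedding (inc h) := by
  refine ⟨Topology.IsEmbedding.inclusion h, ?_⟩
  have : Set.range (inc h) = Subtype.val ⁻¹' P := by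
    ext ⟨x, hx⟩
    constructor
    · rintro ⟨y, hy⟩
      have := congrArg Subtype.val hy
      change y.1 = x at this
      exact this ▸ y.2
    · intro h'
      exact ⟨⟨x, h'⟩, rfl⟩
  rw [this]
  exact hP.preimage continuous_subtype_val

lemma mvSets {E : Type} [TopologicalSpace E] {P Q S N : Set E} (hP : IsOpen P) (hQ : IsOpen Q)
    (hPS : P ⊆ S) (hQS : Q ⊆ S) (hS : S ⊆ P ∪ Q) (hNP : N ⊆ P) (hNQ : N ⊆ Q) (hN : P ∩ Q ⊆ N) :
    MV (inc hPS) (inc hQS) (inc hNP) (inc hNQ) where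
  hf := inc_open _ hP
  hg := inc_open _ hQ
  hk := Topology.IsEmbedding.inclusion hNP
  hl := Topology.IsEmbedding.inclusion hNQ
  comm := rfl
  surj x := by
    rcases hS x.2 with h | h
    · exact Or.inl ⟨⟨x, h⟩, rfl⟩
    · exact Or.inr ⟨⟨x, h⟩, rfl⟩
  pull a b hab := by
    have h : a.1 = b.1 := congrArg Subtype.val hab
    exact ⟨⟨a.1, hN ⟨a.2, h ▸ b.2⟩⟩, rfl⟩

/-- slice inclusion and projection -/
def sl (Z : Type) [TopologicalSpace Z] (c : X) : C(Z, X × Z) := ⟨fun z => (c, z), by fun_prop⟩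
def pr (X Z : Type) [TopologicalSpace X] [TopologicalSpace Z] : C(X × Z, Z) :=
  ⟨Prod.snd, continuous_snd⟩

lemma hm_pr_sl (i : ℕ) (c : X) (y : H i Z) : hm i (pr X Z) (hm i (sl Z c) y) = y := by
  rw [hm_comp]; exact hm_id y

lemma contr [ContractibleSpace X] (i : ℕ) (c : X) (x : H i (X × Z)) :
    hm i (sl Z c) (hm i (pr X Z) x) = x := by
  obtain ⟨y, ⟨F⟩⟩ := id_nullhomotopic X
  have key : ∀ x : H i (X × Z), hm i (sl Z y) (hm i (pr X Z) x) = x := by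
    intro x
    rw [hm_comp]
    conv_rhs => rw [← hm_id x]
    symm
    refine LinearMap.congr_fun (hm_of i (fun p => (F (p.1, p.2.1), p.2.2)) (by fun_prop) ?_ ?_) x
    · rintro ⟨a, z⟩; simp
    · rintro ⟨a, z⟩; simp; rfl
  rw [← key (hm i (sl Z c) _), hm_pr_sl, key]

lemma contr_inj [ContractibleSpace X] (i : ℕ) (x : H i (X × Z)) (h : hm i (pr X Z) x = 0) :
    x = 0 := by
  obtain ⟨c⟩ : Nonempty X := inferInstance
  rw [← contr i c x, h, map_zero]

lemma sl_eq [ContractibleSpace X] (i : ℕ) (c c' : X) (y : H i Z) :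
    hm i (sl Z c) y = hm i (sl Z c') y := by
  rw [← contr i c' (hm i (sl Z c) y), hm_pr_sl]

lemma pr_px (f : C(X, Y)) : (pr Y Z).comp (px Z f) = pr X Z := rfl

lemma H_empty [IsEmpty X] (i : ℕ) (x : H i X) : x = 0 := by
  obtain ⟨c, hc, rfl⟩ := cls_surj x
  rw [cls_eq_zero]
  have : IsEmpty C(Dl i, X) := ⟨fun σ => IsEmpty.false (σ (ve i 0))⟩
  exact ⟨0, Subsingleton.elim _ _⟩

lemma MV.disj {f : C(A, X)} {g : C(B, X)} {k : C(W, A)} {l : C(W, B)} (h : MV f g k l) [IsEmpty W]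
    (i : ℕ) (y : H i X) : ∃ α β, y = hm i f α + hm i g β := by
  cases i with
  | zero => exact h.r0 y
  | succ i =>
    obtain ⟨w, hw⟩ := h.r3 y
    rw [H_empty i w] at hw
    exact h.r4 y hw

abbrev sT : Set ℂ := {z | z ≠ 0}
abbrev T : Type := sT
instance : One T := ⟨⟨1, one_ne_zero⟩⟩

/-! slit planes -/
abbrev sA : Set ℂ := Complex.slitPlane
abbrev sB : Set ℂ := {z | -z ∈ Complex.slitPlane}
abbrev sU : Set ℂ := {z | 0 < z.im}
abbrev sV : Set ℂ := {z | z.im < 0}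
abbrev sW : Set ℂ := {z | z.im ≠ 0}

lemma sA_mem (z : ℂ) : z ∈ sA ↔ 0 < z.re ∨ z.im ≠ 0 := Iff.rfl
lemma sB_mem (z : ℂ) : z ∈ sB ↔ z.re < 0 ∨ z.im ≠ 0 := by
  change (0 < (-z).re ∨ (-z).im ≠ 0) ↔ _
  simp

lemma slitMV : ∃ (h1 : sA ⊆ sT) (h2 : sB ⊆ sT) (h3 : sW ⊆ sA) (h4 : sW ⊆ sB),
    MV (inc h1) (inc h2) (inc h3) (inc h4) := by
  have h1 : sA ⊆ sT := fun z hz => Complex.slitPlane_ne_zero hz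
  have h2 : sB ⊆ sT := fun z hz => neg_ne_zero.1 (Complex.slitPlane_ne_zero hz)
  refine ⟨h1, h2, fun z hz => Or.inr hz, fun z hz => (sB_mem z).2 (Or.inr hz), ?_⟩
  refine mvSets (Q := sB) Complex.isOpen_slitPlane (Complex.isOpen_slitPlane.preimage continuous_neg) _ _
    ?_ _ _ ?_
  · intro z hz
    by_contra h
    rw [Set.mem_union, sA_mem, sB_mem] at h
    push Not at h
    exact hz (Complex.ext (le_antisymm h.1.1 h.2.1) h.1.2)
  · rintro z ⟨ha, hb⟩
    rw [sA_mem] at ha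
    rw [sB_mem] at hb
    rcases ha with ha | ha
    · rcases hb with hb | hb
      · linarith
      · exact hb
    · exact ha

lemma uvMV : ∃ (h1 : sU ⊆ sW) (h2 : sV ⊆ sW) (h3 : (∅ : Set ℂ) ⊆ sU) (h4 : (∅ : Set ℂ) ⊆ sV),
    MV (inc h1) (inc h2) (inc h3) (inc h4) := by
  refine ⟨fun z hz => ne_of_gt hz, fun z hz => ne_of_lt hz, Set.empty_subset _, Set.empty_subset _,
    mvSets (isOpen_lt continuous_const Complex.continuous_im)
      (isOpen_lt Complex.continuous_im continuous_const) _ _ ?_ _ _ ?_⟩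
  · intro z hz
    rcases lt_or_gt_of_ne (show z.im ≠ 0 from hz) with h | h
    · exact Or.inr h
    · exact Or.inl h
  · rintro z ⟨ha, hb⟩
    exact absurd (lt_trans (show 0 < z.im from ha) hb) (lt_irrefl _)

instance : ContractibleSpace sA :=
  Complex.starConvex_one_slitPlane.contractibleSpace ⟨1, Complex.one_mem_slitPlane⟩
instance : ContractibleSpace sB := by
  refine StarConvex.contractibleSpace (x := (-1 : ℂ)) ?_ ⟨-1, by simp⟩
  intro y hy a b ha hb hab
  have := Complex.starConvex_one_slitPlane hy ha hb hab
  change -(a • (-1 : ℂ) + b • y) ∈ Complex.slitPlane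
  convert this using 1
  simp
  ring
instance : ContractibleSpace sU :=
  (convex_halfSpace_im_gt 0).contractibleSpace ⟨Complex.I, by simp⟩
instance : ContractibleSpace sV :=
  (convex_halfSpace_im_lt 0).contractibleSpace ⟨-Complex.I, by simp⟩

theorem slit_one (i : ℕ) (y : H i (T × Z)) (hy : hm i (pr T Z) y = 0)
    (h : ∃ (h1 : sA ⊆ sT) (h2 : sB ⊆ sT) (α : H i (sA × Z)) (β : H i (sB × Z)),
      y = hm i (px Z (inc h1)) α + hm i (px Z (inc h2)) β) : y = 0 := by
  obtain ⟨h1, h2, α, β, rfl⟩ := h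
  rw [map_add, hm_comp, hm_comp, pr_px, pr_px] at hy
  have e : hm i (px Z (inc h1)) α = hm i (sl Z (1 : T)) (hm i (pr sA Z) α) := by
    conv_lhs => rw [← contr i (⟨1, Complex.one_mem_slitPlane⟩ : sA) α, hm_comp]
    rfl
  have hI : Complex.I ∈ sB := (sB_mem _).2 (Or.inr (by simp))
  have e2 : hm i (px Z (inc h2)) β = hm i (sl Z (1 : T)) (hm i (pr sB Z) β) := by
    conv_lhs => rw [← contr i (⟨Complex.I, hI⟩ : sB) β, hm_comp]
    have := congrArg (hm i (px Z (inc h1))) (sl_eq i (⟨1, Complex.one_mem_slitPlane⟩ : sA)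
      (⟨Complex.I, Or.inr (by simp)⟩ : sA) (hm i (pr sB Z) β))
    exact ((hm_comp _ _ _).symm.trans (this.symm.trans (hm_comp _ _ _)) : _)
  rw [e, e2, ← map_add, hy, map_zero]

theorem slit_zero (y : H 0 (T × Z)) (hy : hm 0 (pr T Z) y = 0) : y = 0 := by
  obtain ⟨h1, h2, h3, h4, h⟩ := slitMV
  obtain ⟨α, β, e⟩ := (h.prod Z).r0 y
  exact slit_one 0 y hy ⟨h1, h2, α, β, e⟩

theorem slit (i : ℕ) : ∃ G : Submodule ℚ (H (i + 1) (T × Z) × H i Z),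
    (∀ y, ∃ α, (y, α) ∈ G) ∧ (∀ y, hm (i + 1) (pr T Z) y = 0 → (y, 0) ∈ G → y = 0) := by
  obtain ⟨h1, h2, h3, h4, h⟩ := slitMV
  obtain ⟨g1, g2, g3, g4, g⟩ := uvMV
  let p : sU := ⟨Complex.I, by simp⟩
  let q : sV := ⟨-Complex.I, by simp⟩
  let φ : H i Z →ₗ[ℚ] H i (sW × Z) := hm i (sl Z (inc g1 p)) - hm i (sl Z (inc g2 q))
  let r := Rel (px Z (inc h1)) (px Z (inc h2)) (px Z (inc h3)) (px Z (inc h4)) i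
  let G : Submodule ℚ (H (i + 1) (T × Z) × H i Z) :=
    { carrier := {x | r x.1 (φ x.2)}
      add_mem' := fun {a b} ha hb => by
        have := Rel.add ha hb
        rw [← map_add] at this
        exact this
      zero_mem' := by
        have := Rel.zero (px Z (inc h1)) (px Z (inc h2)) (px Z (inc h3)) (px Z (inc h4)) i
        rw [← map_zero φ] at this
        exact this
      smul_mem' := fun c a ha => by
        have := Rel.smul c ha
        rw [← map_smul] at this
        exact this }
  refine ⟨G, ?_, ?_⟩
  · intro y
    obtain ⟨w, hw⟩ := (h.prod Z).r3 y
    have : IsEmpty (((∅ : Set ℂ) : Type) × Z) := inferInstance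
    obtain ⟨α, β, e⟩ := (g.prod Z).disj i w
    have e1 : w = hm i (sl Z (inc g1 p)) (hm i (pr _ _) α)
        + hm i (sl Z (inc g2 q)) (hm i (pr _ _) β) := by
      rw [e]
      congr 1
      · conv_lhs => rw [← contr i p α, hm_comp]
        rfl
      · conv_lhs => rw [← contr i q β, hm_comp]
        rfl
    have e2 := congrArg (hm i (pr _ _)) hw.dies.1
    have e3 : hm i (pr _ _) α + hm i (pr _ _) β = 0 := by
      rw [hm_comp, pr_px, e1, map_add, hm_pr_sl, hm_pr_sl, map_zero] at e2
      exact e2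
    refine ⟨hm i (pr _ _) α, ?_⟩
    change Rel _ _ _ _ i y (φ _)
    convert hw using 1
    rw [e1, eq_neg_of_add_eq_zero_right e3]
    simp [φ, sub_eq_add_neg]
  · intro y hy hR
    change Rel _ _ _ _ i y (φ 0) at hR
    rw [map_zero] at hR
    obtain ⟨α, β, e⟩ := (h.prod Z).r4 y hR
    exact slit_one (i + 1) y hy ⟨h1, h2, α, β, e⟩

theorem slit_dim (i : ℕ) [Module.Finite ℚ (H i Z)] :
    Module.Finite ℚ (LinearMap.ker (hm (i + 1) (pr T Z))) ∧
    Module.finrank ℚ (LinearMap.ker (hm (i + 1) (pr T Z))) ≤ Module.finrank ℚ (H i Z) := by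
  obtain ⟨G, h1, h2⟩ := slit (Z := Z) i
  let N := LinearMap.ker (hm (i + 1) (pr T Z))
  let G' : Submodule ℚ (N × H i Z) := G.comap (N.subtype.prodMap LinearMap.id)
  let f : G' →ₗ[ℚ] N := (LinearMap.fst _ _ _) ∘ₗ G'.subtype
  let g : G' →ₗ[ℚ] H i Z := (LinearMap.snd _ _ _) ∘ₗ G'.subtype
  have hf : Function.Surjective f := by
    intro y
    obtain ⟨α, hα⟩ := h1 y.1
    exact ⟨⟨(y, α), hα⟩, rfl⟩
  have hg : Function.Injective g := by
    refine (injective_iff_map_eq_zero g).2 ?_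
    rintro ⟨⟨y, α⟩, hG⟩ (h0 : α = 0)
    subst h0
    have : y = 0 := Subtype.ext (h2 y.1 y.2 hG)
    subst this
    rfl
  have : Module.Finite ℚ G' := Module.Finite.of_injective g hg
  have hN : Module.Finite ℚ N := Module.Finite.of_surjective f hf
  exact ⟨hN, (LinearMap.finrank_le_finrank_of_surjective hf).trans
    (LinearMap.finrank_le_finrank_of_injective hg)⟩

end CB

namespace CB

variable {X Y Z : Type} [TopologicalSpace X] [TopologicalSpace Y] [TopologicalSpace Z]

def p1 (Z : Type) [TopologicalSpace Z] : C(T × (T × Z), T × Z) := ⟨fun x => (x.1, x.2.2), by fun_prop⟩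
def th (Z : Type) [TopologicalSpace Z] : C(T × (T × Z), T × (T × Z)) :=
  ⟨fun x => (x.2.1, x.1, x.2.2), by fun_prop⟩

def Hff {i : ℕ} (x : H i (T × (T × Z))) : Prop := hm i (p1 Z) x = 0 ∧ hm i (pr T (T × Z)) x = 0

abbrev sS : Set (ℂ × ℂ) := {p | p ≠ 0}
abbrev sP : Set (ℂ × ℂ) := {p | p.1 ≠ 0}
abbrev sQ : Set (ℂ × ℂ) := {p | p.2 ≠ 0}
abbrev sN : Set (ℂ × ℂ) := {p | p.1 ≠ 0 ∧ p.2 ≠ 0}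

lemma sPS : sP ⊆ sS := fun _ hp h => hp (by rw [h]; rfl)
lemma sQS : sQ ⊆ sS := fun _ hp h => hp (by rw [h]; rfl)
lemma sNP : sN ⊆ sP := fun p hp => hp.1
lemma sNQ : sN ⊆ sQ := fun p hp => hp.2

lemma c2MV : MV (inc sPS) (inc sQS) (inc sNP) (inc sNQ) := by
  refine mvSets (isOpen_ne_fun continuous_fst continuous_const)
    (isOpen_ne_fun continuous_snd continuous_const) _ _ ?_ _ _ ?_
  · intro p hp
    by_contra h
    simp only [Set.mem_union, not_or, Set.mem_ofPred_eq, not_not] at h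
    exact hp (Prod.ext h.1 h.2)
  · exact fun p hp => hp

def tSm (S S' : Set (ℂ × ℂ)) (h : ∀ p ∈ S, (p.2, p.1) ∈ S') : C(S, S') :=
  ⟨fun p => ⟨(p.1.2, p.1.1), h _ p.2⟩, by fun_prop⟩

lemma tS_id (i : ℕ) (h : ∀ p ∈ sS, (p.2, p.1) ∈ sS) (y : H i (sS × Z)) :
    hm i (px Z (tSm sS sS h)) y = y := by
  conv_rhs => rw [← hm_id y]
  let u : ℝ → ℂ := fun t => Complex.exp (Real.pi * t * Complex.I)
  have hu : Continuous u := by fun_prop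
  have u0 : u 0 = 1 := by simp [u]
  have u1 : u 1 = -1 := by simp [u]
  let F : ℝ → ℂ × ℂ → ℂ × ℂ := fun t p => ((1 - u t) / 2 * p.1 + (1 + u t) / 2 * p.2,
    (1 + u t) / 2 * p.1 + (1 - u t) / 2 * p.2)
  have hF : ∀ t p, p ≠ 0 → F t p ≠ 0 := by
    intro t p hp h0
    apply hp
    have e1 : (1 - u t) / 2 * p.1 + (1 + u t) / 2 * p.2 = 0 := congrArg Prod.fst h0
    have e2 : (1 + u t) / 2 * p.1 + (1 - u t) / 2 * p.2 = 0 := congrArg Prod.snd h0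
    have hne : u t ≠ 0 := Complex.exp_ne_zero _
    have e3 : p.1 + p.2 = 0 := by linear_combination e1 + e2
    have e4 : p.1 - p.2 = 0 := by
      have : u t * (p.1 - p.2) = 0 := by linear_combination e2 - e1
      exact (mul_eq_zero.1 this).resolve_left hne
    refine Prod.ext ?_ ?_
    · change p.1 = 0; linear_combination (e3 + e4) / 2
    · change p.2 = 0; linear_combination (e3 - e4) / 2
  refine LinearMap.congr_fun (hm_of i (fun q : unitInterval × (sS × Z) =>
    ((⟨F q.1 q.2.1.1, hF _ _ q.2.1.2⟩ : sS), q.2.2)) ?_ ?_ ?_) y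
  · simp only [F]; fun_prop
  · rintro ⟨⟨p, hp⟩, z⟩
    refine Prod.ext (Subtype.ext ?_) rfl
    change F 0 p = (p.2, p.1)
    simp [F, u0]
  · rintro ⟨⟨p, hp⟩, z⟩
    refine Prod.ext (Subtype.ext ?_) rfl
    change F 1 p = p
    simp [F, u1]

def toN (Z : Type) [TopologicalSpace Z] : C(T × (T × Z), sN × Z) :=
  ⟨fun x => (⟨(x.1.1, x.2.1.1), x.1.2, x.2.1.2⟩, x.2.2), by fun_prop⟩
def ofN (Z : Type) [TopologicalSpace Z] : C(sN × Z, T × (T × Z)) :=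
  ⟨fun x => (⟨x.1.1.1, x.1.2.1⟩, ⟨x.1.1.2, x.1.2.2⟩, x.2), by fun_prop⟩

theorem swap (i : ℕ) (x : H i (T × (T × Z))) (hx : Hff x) : hm i (th Z) x = -x := by
  let w := hm i (toN Z) x
  have k1 : hm i (px Z (inc sNP)) w = 0 := by
    let j : C(T × Z, sP × Z) := ⟨fun x => (⟨(x.1.1, 1), x.1.2⟩, x.2), by fun_prop⟩
    have : hm i ((px Z (inc sNP)).comp (toN Z)) = hm i (j.comp (p1 Z)) := by
      refine hm_of i (fun q => (⟨(q.2.1.1, q.2.2.1.1 + ((q.1 : ℝ) : ℂ) * (1 - q.2.2.1.1)),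
        q.2.1.2⟩, q.2.2.2)) (by fun_prop) ?_ ?_
      · intro x
        refine Prod.ext (Subtype.ext (Prod.ext rfl ?_)) rfl
        simp; rfl
      · intro x
        refine Prod.ext (Subtype.ext (Prod.ext rfl ?_)) rfl
        simp; rfl
    rw [hm_comp, this, ← hm_comp, hx.1, map_zero]
  have k2 : hm i (px Z (inc sNQ)) w = 0 := by
    let j : C(T × Z, sQ × Z) := ⟨fun x => (⟨(1, x.1.1), x.1.2⟩, x.2), by fun_prop⟩
    have : hm i ((px Z (inc sNQ)).comp (toN Z)) = hm i (j.comp (pr T (T × Z))) := by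
      refine hm_of i (fun q => (⟨(q.2.1.1 + ((q.1 : ℝ) : ℂ) * (1 - q.2.1.1), q.2.2.1.1),
        q.2.2.1.2⟩, q.2.2.2)) (by fun_prop) ?_ ?_
      · intro x
        refine Prod.ext (Subtype.ext (Prod.ext ?_ rfl)) rfl
        simp; rfl
      · intro x
        refine Prod.ext (Subtype.ext (Prod.ext ?_ rfl)) rfl
        simp; rfl
    rw [hm_comp, this, ← hm_comp, hx.2, map_zero]
  have M := c2MV.prod Z
  obtain ⟨y, hy⟩ := M.r1 w k1 k2
  have hs : ∀ p ∈ sS, (p.2, p.1) ∈ sS := fun p hp h =>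
    hp (Prod.ext (congrArg Prod.snd h) (congrArg Prod.fst h))
  have := hy.swap (px Z (tSm sS sS hs)) (px Z (tSm sP sQ fun p hp => hp))
    (px Z (tSm sQ sP fun p hp => hp)) (px Z (tSm sN sN fun p hp => ⟨hp.2, hp.1⟩)) rfl rfl rfl rfl
  rw [tS_id] at this
  have h2 := hy.add (this.smul (-1))
  have h3 : y + (-1 : ℚ) • y = hm _ (px Z (inc sPS)) 0 + hm _ (px Z (inc sQS)) 0 := by simp
  rw [h3] at h2
  have h4 := M.r2 _ _ _ h2
  have h5 := congrArg (hm i (ofN Z)) h4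
  simp only [neg_smul, one_smul, neg_neg, map_add, map_zero, w, hm_comp] at h5
  rw [eq_neg_iff_add_eq_zero, add_comm]
  conv_lhs => rw [← hm_id x]
  rw [hm_comp]
  exact h5

/-- multiplication and shear -/
noncomputable def mu (Z : Type) [TopologicalSpace Z] : C(T × (T × Z), T × Z) :=
  ⟨fun x => (⟨x.1.1 * x.2.1.1, mul_ne_zero x.1.2 x.2.1.2⟩, x.2.2), by fun_prop⟩
noncomputable def sh (Z : Type) [TopologicalSpace Z] : C(T × (T × Z), T × (T × Z)) :=
  ⟨fun x => (x.1, ⟨x.1.1 * x.2.1.1, mul_ne_zero x.1.2 x.2.1.2⟩, x.2.2), by fun_prop⟩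
noncomputable def shi (Z : Type) [TopologicalSpace Z] : C(T × (T × Z), T × (T × Z)) :=
  ⟨fun x => (x.1, ⟨x.2.1.1 / x.1.1, div_ne_zero x.2.1.2 x.1.2⟩, x.2.2), by
    have : ∀ x : T × (T × Z), x.1.1 ≠ 0 := fun x => x.1.2
    fun_prop (disch := exact this)⟩

lemma eq_zero_of_neg {i : ℕ} {x : H i X} (h : x = -x) : x = 0 := by
  have : (2 : ℚ) • x = 0 := by rw [two_smul]; nth_rewrite 1 [h]; simp
  exact (smul_eq_zero.1 this).resolve_left two_ne_zero

lemma mu_kills (i : ℕ) (x : H i (T × (T × Z))) (hx : Hff x) : hm i (mu Z) x = 0 := by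
  apply eq_zero_of_neg
  have := congrArg (hm i (mu Z)) (swap i x hx)
  rw [hm_comp, map_neg] at this
  rw [← this]
  congr 2
  ext1 ⟨a, b, c⟩
  refine Prod.ext (Subtype.ext (mul_comm _ _)) rfl

lemma th_ff (i : ℕ) (x : H i (T × (T × Z))) (hx : Hff x) : Hff (hm i (th Z) x) := by
  rw [swap i x hx]
  exact ⟨by rw [map_neg, hx.1, neg_zero], by rw [map_neg, hx.2, neg_zero]⟩

lemma sh_ff (i : ℕ) (x : H i (T × (T × Z))) (hx : Hff x) : Hff (hm i (sh Z) x) := by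
  constructor
  · rw [hm_comp]; exact hx.1
  · rw [hm_comp]; exact mu_kills i x hx

lemma shi_sh : (shi Z).comp (sh Z) = ContinuousMap.id _ := by
  ext1 ⟨a, b, c⟩
  refine Prod.ext rfl (Prod.ext (Subtype.ext ?_) rfl)
  exact mul_div_cancel_left₀ _ a.2

noncomputable def nv (Z : Type) [TopologicalSpace Z] : C(T × (T × Z), T × (T × Z)) :=
  ⟨fun x => (⟨x.1.1⁻¹, inv_ne_zero x.1.2⟩, x.2), by
    have : ∀ x : T × (T × Z), x.1.1 ≠ 0 := fun x => x.1.2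
    fun_prop (disch := exact this)⟩

lemma nv_ff (i : ℕ) (x : H i (T × (T × Z))) (hx : Hff x) : Hff (hm i (nv Z) x) := by
  constructor
  · let j : C(T × Z, T × Z) := ⟨fun x => (⟨x.1.1⁻¹, inv_ne_zero x.1.2⟩, x.2), by
      have : ∀ x : T × Z, x.1.1 ≠ 0 := fun x => x.1.2
      fun_prop (disch := exact this)⟩
    have : (p1 Z).comp (nv Z) = j.comp (p1 Z) := rfl
    rw [hm_comp, this, ← hm_comp, hx.1, map_zero]
  · rw [hm_comp]; exact hx.2

lemma shi_ff (i : ℕ) (x : H i (T × (T × Z))) (hx : Hff x) : Hff (hm i (shi Z) x) := by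
  constructor
  · rw [hm_comp]; exact hx.1
  · have := mu_kills i _ (nv_ff i x hx)
    rw [hm_comp] at this
    rw [hm_comp, ← this]
    congr 2
    ext1 ⟨a, b, c⟩
    refine Prod.ext (Subtype.ext ?_) rfl
    change b.1 / a.1 = a.1⁻¹ * b.1
    rw [div_eq_mul_inv, mul_comm]

/-- (r,z) ↦ (rz, 1/z) -/
noncomputable def aa (Z : Type) [TopologicalSpace Z] : C(T × (T × Z), T × (T × Z)) :=
  ⟨fun x => (⟨x.1.1 * x.2.1.1, mul_ne_zero x.1.2 x.2.1.2⟩, ⟨(x.2.1.1)⁻¹, inv_ne_zero x.2.1.2⟩, x.2.2), by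
    have : ∀ x : T × (T × Z), x.2.1.1 ≠ 0 := fun x => x.2.1.2
    fun_prop (disch := exact this)⟩

lemma aa_neg (i : ℕ) (x : H i (T × (T × Z))) (hx : Hff x) : hm i (aa Z) x = -x := by
  have e : aa Z = (shi Z).comp ((th Z).comp (sh Z)) := by
    ext1 ⟨a, b, c⟩
    refine Prod.ext rfl (Prod.ext (Subtype.ext ?_) rfl)
    change b.1⁻¹ = a.1 / (a.1 * b.1)
    have h1 : a.1 ≠ 0 := a.2
    have h2 : b.1 ≠ 0 := b.2
    field_simp
  rw [e, ← hm_comp, ← hm_comp, swap i _ (sh_ff i x hx), map_neg, hm_comp, shi_sh, hm_id]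

end CB

namespace CB

variable {X Y Z : Type} [TopologicalSpace X] [TopologicalSpace Y] [TopologicalSpace Z]

lemma hm_lin (i : ℕ) {S : Set ℂ} (f g : C(X, S × Y)) (h2 : ∀ x, (f x).2 = (g x).2)
    (h : ∀ t : ℝ, 0 ≤ t → t ≤ 1 → ∀ x, (f x).1.1 + t * ((g x).1.1 - (f x).1.1) ∈ S) :
    hm i f = hm i g := by
  refine hm_of i (fun q => (⟨(f q.2).1.1 + ((q.1 : ℝ) : ℂ) * ((g q.2).1.1 - (f q.2).1.1),
    h q.1 q.1.2.1 q.1.2.2 q.2⟩, (f q.2).2)) (by fun_prop) ?_ ?_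
  · intro x
    refine Prod.ext (Subtype.ext ?_) rfl
    simp
  · intro x
    refine Prod.ext (Subtype.ext ?_) (h2 x)
    simp

noncomputable def ng (Z : Type) [TopologicalSpace Z] : C(T × Z, T × Z) :=
  ⟨fun x => (⟨-x.1.1, neg_ne_zero.2 x.1.2⟩, x.2), by fun_prop⟩

lemma ng_id (i : ℕ) (x : H i (T × Z)) : hm i (ng Z) x = x := by
  conv_rhs => rw [← hm_id x]
  symm
  refine LinearMap.congr_fun (hm_of i (fun q => (⟨Complex.exp (Real.pi * (q.1 : ℝ) * Complex.I)
    * q.2.1.1, mul_ne_zero (Complex.exp_ne_zero _) q.2.1.2⟩, q.2.2)) (by fun_prop) ?_ ?_) x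
  · intro x
    refine Prod.ext (Subtype.ext ?_) rfl
    simp
  · intro x
    refine Prod.ext (Subtype.ext ?_) rfl
    simp; rfl

abbrev s1 : Set ℂ := {z | z ≠ 1}
abbrev s01 : Set ℂ := {z | z ≠ 0 ∧ z ≠ 1}

lemma s01T : s01 ⊆ sT := fun _ h => h.1
lemma s01s1 : s01 ⊆ s1 := fun _ h => h.2

lemma c01MV : MV (inc (Set.subset_univ sT)) (inc (Set.subset_univ s1)) (inc s01T) (inc s01s1) := by
  refine mvSets (isOpen_ne_fun continuous_id continuous_const)
    (isOpen_ne_fun continuous_id continuous_const) _ _ ?_ _ _ fun _ h => h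
  intro z _
  by_cases h : z = 0
  · right; rw [h]; exact zero_ne_one
  · exact Or.inl h

instance : ContractibleSpace (Set.univ : Set ℂ) :=
  convex_univ.contractibleSpace ⟨0, trivial⟩

lemma l1_inj (i : ℕ) (w : H i (s01 × Z)) (h0 : hm i (px Z (inc s01T)) w = 0)
    (h1 : hm i (px Z (inc s01s1)) w = 0) : w = 0 := by
  have M := c01MV.prod Z
  obtain ⟨y, hy⟩ := M.r1 w h0 h1
  refine M.r2 w (hm _ (sl Z (1 : T)) (hm _ (pr _ Z) y)) 0 ?_
  rw [map_zero, add_zero, hm_comp]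
  have := contr (i + 1) (⟨1, trivial⟩ : (Set.univ : Set ℂ)) y
  rw [← this] at hy
  exact hy

lemma half_lt (z : ℂ) : ‖z / (2 * (1 + ‖z‖))‖ < 1 / 2 := by
  have h : (0 : ℝ) < 2 * (1 + ‖z‖) := by positivity
  have e : (2 * (1 + (‖z‖ : ℂ))) = ((2 * (1 + ‖z‖) : ℝ) : ℂ) := by push_cast; ring
  rw [e, norm_div, Complex.norm_real, Real.norm_of_nonneg h.le, div_lt_iff₀ h]
  linarith [norm_nonneg z]

lemma den_ne (z : ℂ) : (2 * (1 + (‖z‖ : ℂ))) ≠ 0 := by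
  have h : (0 : ℝ) < 2 * (1 + ‖z‖) := by positivity
  have e : (2 * (1 + (‖z‖ : ℂ))) = ((2 * (1 + ‖z‖) : ℝ) : ℂ) := by push_cast; ring
  rw [e]; exact_mod_cast h.ne'

lemma g0_mem (z : ℂ) (hz : z ≠ 0) : z / (2 * (1 + ‖z‖)) ∈ s01 := by
  refine ⟨div_ne_zero hz (den_ne z), fun h => ?_⟩
  have := half_lt z
  rw [h, norm_one] at this
  linarith

noncomputable def g0 (Z : Type) [TopologicalSpace Z] : C(T × Z, s01 × Z) :=
  ⟨fun x => (⟨x.1.1 / (2 * (1 + ‖x.1.1‖)), g0_mem _ x.1.2⟩, x.2), by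
    fun_prop (disch := exact fun x => den_ne _)⟩

noncomputable def om (Z : Type) [TopologicalSpace Z] : C(s01 × Z, s01 × Z) :=
  ⟨fun x => (⟨1 - x.1.1, sub_ne_zero.2 x.1.2.2.symm, fun h => x.1.2.1 (by linear_combination -h)⟩, x.2), by
    fun_prop⟩

noncomputable def oi (Z : Type) [TopologicalSpace Z] : C(s01 × Z, s01 × Z) :=
  ⟨fun x => (⟨x.1.1⁻¹, inv_ne_zero x.1.2.1, fun h => x.1.2.2 (inv_eq_one.1 h)⟩, x.2), by
    have : ∀ x : s01 × Z, x.1.1 ≠ 0 := fun x => x.1.2.1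
    fun_prop (disch := exact this)⟩

noncomputable def ti (Z : Type) [TopologicalSpace Z] : C(T × Z, T × Z) :=
  ⟨fun x => (⟨x.1.1⁻¹, inv_ne_zero x.1.2⟩, x.2), by
    have : ∀ x : T × Z, x.1.1 ≠ 0 := fun x => x.1.2
    fun_prop (disch := exact this)⟩

lemma kill_pr (i : ℕ) (x : H i (T × Z)) (hx : hm i (pr T Z) x = 0) (c : Y) (f : C(T × Z, Y × Z))
    (hf : hm i f = hm i ((sl Z c).comp (pr T Z))) : hm i f x = 0 := by
  rw [hf, ← hm_comp, hx, map_zero]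

lemma gi_eq (z : ℂ) (hz : z ≠ 0) : (z⁻¹ / (2 * (1 + ‖z⁻¹‖)))⁻¹ = ((2 * (1 + ‖z‖⁻¹) : ℝ) : ℂ) * z := by
  rw [inv_div, norm_inv]
  push_cast
  field_simp

lemma pos_T (z : ℂ) (hz : z ≠ 0) (c d t : ℝ) (hc : 0 < c) (hd : 0 < d) (h0 : 0 ≤ t) (h1 : t ≤ 1) :
    c * z + t * (d * z - c * z) ≠ 0 := by
  have e : (c * z + t * (d * z - c * z) : ℂ) = ((c + t * (d - c) : ℝ) : ℂ) * z := by push_cast; ring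
  rw [e]
  refine mul_ne_zero ?_ hz
  have : 0 < c + t * (d - c) := by
    rcases eq_or_lt_of_le h0 with h | h
    · rw [← h]; simpa using hc
    · nlinarith [mul_pos h hd, mul_nonneg (sub_nonneg.2 h1) hc.le]
  exact_mod_cast this.ne'

lemma g0_eq (z : ℂ) : z / (2 * (1 + ‖z‖)) = (((2 * (1 + ‖z‖))⁻¹ : ℝ) : ℂ) * z := by
  push_cast
  rw [div_eq_mul_inv, mul_comm]

theorem l1 (i : ℕ) (x : H i (T × Z)) (hx : hm i (pr T Z) x = 0) :
    hm i ((oi Z).comp ((g0 Z).comp (ti Z))) x = hm i (g0 Z) x + hm i ((om Z).comp (g0 Z)) x := by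
  rw [← sub_eq_zero]
  have eT : ∀ (f : C(T × Z, T × Z)) (c : T × Z → ℝ) (_ : ∀ x, 0 < c x)
    (_ : ∀ x, (f x).1.1 = c x * x.1.1 ∧ (f x).2 = x.2), hm i f x = x := by
    intro f c hc hf
    conv_rhs => rw [← hm_id x]
    refine LinearMap.congr_fun (hm_lin i f (ContinuousMap.id _) (fun x => (hf x).2) ?_) x
    intro t h0 h1 x
    rw [(hf x).1]
    have := pos_T x.1.1 x.1.2 (c x) 1 t (hc x) one_pos h0 h1
    simpa using this
  apply l1_inj
  · rw [map_sub, map_add, hm_comp, hm_comp, hm_comp]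
    rw [eT ((px Z (inc s01T)).comp (g0 Z)) (fun x => (2 * (1 + ‖x.1.1‖))⁻¹)
        (fun x => by positivity) (fun x => ⟨g0_eq _, rfl⟩),
      eT ((px Z (inc s01T)).comp ((oi Z).comp ((g0 Z).comp (ti Z)))) (fun x => (2 * (1 + ‖x.1.1‖⁻¹)))
        (fun x => by positivity) (fun x => ⟨gi_eq _ x.1.2, rfl⟩)]
    rw [kill_pr i x hx (1 : T) _ ?_]
    · abel
    · refine hm_lin i _ _ (fun x => rfl) ?_
      intro t h0 h1 x h
      change (1 - x.1.1 / (2 * (1 + ‖x.1.1‖))) + t * (1 - (1 - x.1.1 / (2 * (1 + ‖x.1.1‖)))) = 0 at h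
      have h3 : (1 : ℂ) = ((1 - t : ℝ) : ℂ) * (x.1.1 / (2 * (1 + ‖x.1.1‖))) := by
        push_cast; linear_combination h
      have h4 := congrArg norm h3
      rw [norm_one, norm_mul, Complex.norm_real, Real.norm_of_nonneg (by linarith)] at h4
      have := half_lt x.1.1
      nlinarith [norm_nonneg (x.1.1 / (2 * (1 + ‖x.1.1‖)))]
  · rw [map_sub, map_add, hm_comp, hm_comp, hm_comp]
    rw [kill_pr i x hx (⟨0, zero_ne_one⟩ : s1) ((px Z (inc s01s1)).comp (g0 Z)) ?_]
    · rw [zero_add, sub_eq_zero]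
      let f1 : C(T × Z, s1 × Z) := ⟨fun x => (⟨1 + x.1.1, fun h => x.1.2 (by linear_combination h)⟩,
        x.2), by fun_prop⟩
      have a1 : hm i ((px Z (inc s01s1)).comp ((om Z).comp (g0 Z))) =
          hm i (f1.comp (ng Z)) := by
        refine hm_lin i _ _ (fun x => rfl) ?_
        intro t h0 h1 x h
        change (1 - x.1.1 / (2 * (1 + ‖x.1.1‖))) + t * ((1 + -x.1.1) -
          (1 - x.1.1 / (2 * (1 + ‖x.1.1‖)))) = 1 at h
        rw [g0_eq] at h
        refine pos_T x.1.1 x.1.2 ((2 * (1 + ‖x.1.1‖))⁻¹) 1 t (by positivity) one_pos h0 h1 ?_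
        push_cast at h ⊢
        linear_combination -h
      let f2 : C(T × Z, s1 × Z) := ⟨fun x => (⟨1 + ((2 * (1 + ‖x.1.1‖⁻¹) : ℝ) : ℂ) * x.1.1, fun h => by
        have h5 : ((2 * (1 + ‖x.1.1‖⁻¹) : ℝ) : ℂ) * x.1.1 = 0 := by linear_combination h
        refine (mul_ne_zero ?_ x.1.2) h5
        have : 0 < (2 * (1 + ‖x.1.1‖⁻¹) : ℝ) := by positivity
        exact_mod_cast this.ne'⟩,
        x.2), by
          have : ∀ x : T × Z, ‖x.1.1‖ ≠ 0 := fun x => norm_ne_zero_iff.2 x.1.2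
          fun_prop (disch := exact this)⟩
      have a2 : hm i f1 = hm i f2 := by
        refine hm_lin i _ _ (fun x => rfl) ?_
        intro t h0 h1 x h
        change (1 + x.1.1) + t * ((1 + ((2 * (1 + ‖x.1.1‖⁻¹) : ℝ) : ℂ) * x.1.1) - (1 + x.1.1)) = 1 at h
        refine pos_T x.1.1 x.1.2 1 (2 * (1 + ‖x.1.1‖⁻¹)) t one_pos (by positivity) h0 h1 ?_
        rw [Complex.ofReal_one]
        linear_combination h
      have a3 : hm i ((px Z (inc s01s1)).comp ((oi Z).comp ((g0 Z).comp (ti Z)))) = hm i f2 := by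
        refine hm_lin i _ _ (fun x => rfl) ?_
        intro t h0 h1 x h
        change (x.1.1⁻¹ / (2 * (1 + ‖x.1.1⁻¹‖)))⁻¹ + t * ((1 + ((2 * (1 + ‖x.1.1‖⁻¹) : ℝ) : ℂ) * x.1.1)
          - (x.1.1⁻¹ / (2 * (1 + ‖x.1.1⁻¹‖)))⁻¹) = 1 at h
        rw [gi_eq _ x.1.2] at h
        have h3 : ((2 * (1 + ‖x.1.1‖⁻¹) : ℝ) : ℂ) * x.1.1 = ((1 - t : ℝ) : ℂ) := by
          push_cast at h ⊢; linear_combination h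
        have h4 := congrArg norm h3
        rw [norm_mul, Complex.norm_real, Complex.norm_real, Real.norm_of_nonneg (by positivity),
          Real.norm_of_nonneg (by linarith)] at h4
        have hp : 0 < ‖x.1.1‖ := norm_pos_iff.2 x.1.2
        have : 2 * (1 + ‖x.1.1‖⁻¹) * ‖x.1.1‖ = 2 * ‖x.1.1‖ + 2 := by field_simp
        linarith
      rw [a1, a3, ← a2, ← hm_comp, ng_id]
    · refine hm_lin i _ _ (fun x => rfl) ?_
      intro t h0 h1 x h
      change (x.1.1 / (2 * (1 + ‖x.1.1‖))) + t * (0 - (x.1.1 / (2 * (1 + ‖x.1.1‖)))) = 1 at h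
      have h3 : (1 : ℂ) = ((1 - t : ℝ) : ℂ) * (x.1.1 / (2 * (1 + ‖x.1.1‖))) := by
        push_cast; linear_combination -h
      have h4 := congrArg norm h3
      rw [norm_one, norm_mul, Complex.norm_real, Real.norm_of_nonneg (by linarith)] at h4
      have := half_lt x.1.1
      nlinarith [norm_nonneg (x.1.1 / (2 * (1 + ‖x.1.1‖)))]

end CB

namespace CB

section transfer
variable {E X : Type} [TopologicalSpace E] [TopologicalSpace X]

theorem transfer (p : C(E, X)) {G : Type} [Group G] [Fintype G] (g : G → C(E, E))
    (hg : ∀ a b, g (a * b) = (g a).comp (g b)) (hp : ∀ a, p.comp (g a) = p)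
    (hl : ∀ n (σ : C(Dl n, X)), ∃ s : C(Dl n, E), p.comp s = σ)
    (hu : ∀ n (s s' : C(Dl n, E)), p.comp s = p.comp s' → ∃ a, s' = (g a).comp s)
    (i : ℕ) (y : H i X) : ∃ x, hm i p x = y := by
  choose l hl using hl
  let tr : ∀ n, Ch n X →ₗ[ℚ] Ch n E := fun n =>
    Finsupp.linearCombination ℚ (fun σ => ∑ a : G, Finsupp.single ((g a).comp (l n σ)) (1 : ℚ))
  have tr1 : ∀ n σ, tr n (Finsupp.single σ 1) = ∑ a : G, Finsupp.single ((g a).comp (l n σ)) (1 : ℚ) := by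
    intro n σ; simp [tr]
  have tr2 : ∀ n (s : C(Dl n, E)), tr n (Finsupp.single (p.comp s) 1) =
      ∑ a : G, Finsupp.single ((g a).comp s) (1 : ℚ) := by
    intro n s
    rw [tr1]
    obtain ⟨b, hb⟩ := hu n s (l n (p.comp s)) (hl n _).symm
    rw [hb]
    refine Fintype.sum_equiv (Equiv.mulRight b) _ _ fun a => ?_
    rw [Equiv.coe_mulRight, hg, ContinuousMap.comp_assoc]
  have trb : ∀ n (c : Ch (n + 1) X), bd n (tr (n + 1) c) = tr n (bd n c) := by
    intro n c
    have : bd n ∘ₗ tr (n + 1) = tr n ∘ₗ bd n := by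
      apply ext1
      intro σ
      rw [LinearMap.comp_apply, LinearMap.comp_apply, tr1, bd_single, map_sum, map_sum]
      have : ∀ j, tr n (((-1 : ℚ) ^ ((j : Fin (n + 2)) : ℕ)) • Finsupp.single (σ.comp (fc n j)) 1) =
          ((-1 : ℚ) ^ (j : ℕ)) • ∑ a : G, Finsupp.single ((g a).comp ((l _ σ).comp (fc n j))) (1 : ℚ) := by
        intro j
        rw [map_smul, ← tr2, ← ContinuousMap.comp_assoc, hl]
      simp_rw [this, bd_single, Finset.smul_sum]
      rw [Finset.sum_comm]
      rfl
    exact LinearMap.congr_fun this c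
  have trz : ∀ i (c : Ch i X), bz i c = 0 → bz i (tr i c) = 0 := by
    intro i c hc
    cases i with
    | zero => rfl
    | succ i =>
      change bd i _ = 0
      change bd i _ = 0 at hc
      rw [trb, hc, map_zero]
  have trp : ∀ i (c : Ch i X), cmap i p (tr i c) = (Fintype.card G : ℚ) • c := by
    intro i c
    have : cmap i p ∘ₗ tr i = (Fintype.card G : ℚ) • LinearMap.id := by
      apply ext1
      intro σ
      rw [LinearMap.comp_apply, tr1, map_sum]
      have : ∀ a : G, cmap i p (Finsupp.single ((g a).comp (l i σ)) 1) = Finsupp.single σ 1 := by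
        intro a
        rw [cmap_single, ← ContinuousMap.comp_assoc, hp, hl]
      simp_rw [this]
      simp
    exact LinearMap.congr_fun this c
  obtain ⟨c, hc, rfl⟩ := cls_surj y
  refine ⟨(Fintype.card G : ℚ)⁻¹ • cls (tr i c) (trz i c hc), ?_⟩
  rw [map_smul, hm_cls, cls_smul]
  apply cls_congr
  rw [trp, smul_smul, inv_mul_cancel₀, one_smul]
  exact_mod_cast Fintype.card_ne_zero

end transfer

variable {n a : ℕ}

lemma conf_ext {x y : ConfSp n a} (h : x.1 = y.1) : x = y := Subtype.ext h

def q (n a : ℕ) : C(ConfSp n a, UConfSp n a) := ⟨Quotient.mk _, continuous_quotient_mk'⟩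

lemma q_surj : Function.Surjective (q n a) := Quotient.mk_surjective

lemma conf_cont {Y : Type} [TopologicalSpace Y] {f : Y → ConfSp n a} (h : Continuous (fun y => (f y).1)) :
    Continuous f := Topology.IsInducing.subtypeVal.continuous_iff.2 h

lemma val_cont : Continuous (fun x : ConfSp n a => x.1) := continuous_subtype_val

lemma q_eq_perm {x y : ConfSp n a} : q n a x = q n a y ↔ ∃ σ : Equiv.Perm (Fin n), x.1 ∘ ⇑σ = y.1 :=
  Quotient.eq (r := confSetoid n a)

lemma q_eq {x y : ConfSp n a} : q n a x = q n a y ↔ Set.range x.1 = Set.range y.1 := by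
  rw [q_eq_perm]
  constructor
  · rintro ⟨σ, h⟩
    rw [← h, EquivLike.range_comp]
  · intro h
    let e1 := Equiv.ofInjective x.1 x.2.1
    let e2 := Equiv.ofInjective y.1 y.2.1
    refine ⟨(e2.trans (Equiv.setCongr h.symm)).trans e1.symm, ?_⟩
    funext k
    have := Equiv.apply_ofInjective_symm x.2.1 ((e2.trans (Equiv.setCongr h.symm)) k)
    exact this

def pm (σ : Equiv.Perm (Fin n)) : C(ConfSp n a, ConfSp n a) :=
  ⟨fun x => ⟨x.1 ∘ σ, x.2.1.comp σ.injective, fun k => x.2.2 _⟩,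
    conf_cont (continuous_pi fun k => (continuous_apply (σ k)).comp val_cont)⟩

instance : MulAction (Equiv.Perm (Fin n)) (ConfSp n a) where
  smul σ x := pm σ⁻¹ x
  one_smul x := rfl
  mul_smul σ τ x := conf_ext (by
    change x.1 ∘ ⇑(σ * τ)⁻¹ = (x.1 ∘ ⇑τ⁻¹) ∘ ⇑σ⁻¹
    rw [mul_inv_rev]; rfl)

lemma smul_val (σ : Equiv.Perm (Fin n)) (x : ConfSp n a) : (σ • x).1 = x.1 ∘ ⇑σ⁻¹ := rfl

lemma q_cov : IsQuotientCoveringMap (q n a) (Equiv.Perm (Fin n)) where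
  toIsQuotientMap := isQuotientMap_quotient_mk'
  toContinuousConstSMul := ⟨fun σ => (pm σ⁻¹).continuous⟩
  apply_eq_iff_mem_orbit := by
    intro x y
    rw [eq_comm, q_eq_perm]
    constructor
    · rintro ⟨σ, h⟩
      exact ⟨σ⁻¹, conf_ext (by rw [smul_val, inv_inv, h])⟩
    · rintro ⟨σ, rfl⟩
      exact ⟨σ⁻¹, rfl⟩
  disjoint := by
    intro x
    refine ⟨{y | ∀ i j, i ≠ j → 2 * ‖y.1 i - x.1 i‖ < ‖x.1 i - x.1 j‖}, ?_, ?_⟩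
    · apply IsOpen.mem_nhds
      · simp only [Set.ofPred_forall]
        refine isOpen_iInter_of_finite fun i => isOpen_iInter_of_finite fun j =>
          isOpen_iInter_of_finite fun _ => isOpen_lt ?_ continuous_const
        have : Continuous fun y : ConfSp n a => y.1 i := (continuous_apply i).comp val_cont
        exact continuous_const.mul (this.sub continuous_const).norm
      · intro i j hij
        simpa [sub_eq_zero] using fun h => hij (x.2.1 h)
    · rintro σ ⟨_, ⟨y, hy, rfl⟩, hy2⟩
      by_contra hne
      have : ∃ k, σ⁻¹ k ≠ k := by
        by_contra! h
        exact hne (inv_eq_one.1 (Equiv.ext h))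
      obtain ⟨k, hk⟩ := this
      have h1 := hy (σ⁻¹ k) k hk
      have h2 := hy2 k (σ⁻¹ k) hk.symm
      have e : (σ • y).1 k = y.1 (σ⁻¹ k) := rfl
      simp only [e] at h2
      have h3 := norm_sub_le_norm_sub_add_norm_sub (x.1 k) (y.1 (σ⁻¹ k)) (x.1 (σ⁻¹ k))
      rw [norm_sub_rev (x.1 k) (y.1 _)] at h3
      rw [norm_sub_rev (x.1 (σ⁻¹ k)) (x.1 k)] at h1
      linarith

lemma q_open : IsOpenMap (q n a) := by
  have := q_cov (n := n) (a := a)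
  exact this.isCoveringMap.isLocalHomeomorph.isOpenMap

lemma lift_dl {m : ℕ} (σ : C(Dl m, UConfSp n a)) : ∃ s : C(Dl m, ConfSp n a), (q n a).comp s = σ := by
  let cov := (q_cov (n := n) (a := a)).isCoveringMap
  let v := ve m 0
  obtain ⟨e, he⟩ := q_surj (σ v)
  have : ContractibleSpace (Dl m) :=
    (convex_stdSimplex ℝ (Fin (m + 1))).contractibleSpace ⟨_, (ve m 0).2⟩
  obtain ⟨y, ⟨F⟩⟩ := id_nullhomotopic (Dl m)
  obtain ⟨e, he⟩ := q_surj (σ y)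
  let K : C(unitInterval × Dl m, UConfSp n a) := σ.comp F.symm.toContinuousMap
  have h0 : ∀ w, K (0, w) = q n a (ContinuousMap.const (Dl m) e w) := by
    intro w
    change σ (F.symm (0, w)) = q n a e
    rw [F.symm.apply_zero, he]
    rfl
  refine ⟨(cov.liftHomotopy K _ h0).comp ⟨fun w => (1, w), by fun_prop⟩, ?_⟩
  ext1 w
  have := congrFun (cov.liftHomotopy_lifts K _ h0) (1, w)
  refine this.trans ?_
  change σ (F.symm (1, w)) = _
  rw [F.symm.apply_one]
  rfl

theorem transfer_conf (Z : Type) [TopologicalSpace Z] (i : ℕ) (y : H i (UConfSp n a × Z)) :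
    ∃ x, hm i (px Z (q n a)) x = y := by
  refine transfer (px Z (q n a)) (G := Equiv.Perm (Fin n)) (fun σ => px Z (pm σ⁻¹)) ?_ ?_ ?_ ?_ i y
  · intro σ τ
    rw [mul_inv_rev]
    rfl
  · intro σ
    ext1 ⟨x, z⟩
    refine Prod.ext ?_ rfl
    exact q_eq_perm.2 ⟨σ, by
      change (x.1 ∘ ⇑σ⁻¹) ∘ ⇑σ = x.1
      funext k; simp⟩
  · intro m σ
    obtain ⟨s, hs⟩ := lift_dl ((ContinuousMap.fst).comp σ)
    refine ⟨s.prodMk (ContinuousMap.snd.comp σ), ?_⟩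
    ext1 w
    exact Prod.ext (DFunLike.congr_fun hs w) rfl
  · intro m s s' h
    let cov := (q_cov (n := n) (a := a)).isCoveringMap
    have : ContractibleSpace (Dl m) :=
      (convex_stdSimplex ℝ (Fin (m + 1))).contractibleSpace ⟨_, (ve m 0).2⟩
    have h1 : ∀ w, q n a (s w).1 = q n a (s' w).1 := fun w => congrArg Prod.fst (DFunLike.congr_fun h w)
    have h2 : ∀ w, (s w).2 = (s' w).2 := fun w =>
      congrArg (fun z : UConfSp n a × Z => z.2) (DFunLike.congr_fun h w)
    obtain ⟨σ, hσ⟩ := q_eq_perm.1 (h1 (ve m 0))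
    refine ⟨σ⁻¹, ?_⟩
    have := cov.eq_of_comp_eq (g₁ := fun w => (s' w).1) (g₂ := fun w => pm σ (s w).1) (by fun_prop)
      (by fun_prop) (by
        funext w
        refine (h1 w).symm.trans ?_
        exact q_eq_perm.2 ⟨σ, rfl⟩) (ve m 0) (conf_ext hσ.symm)
    ext1 w
    refine Prod.ext ?_ (h2 w).symm
    rw [inv_inv]
    exact congrFun this w

end CB

namespace CB

lemma open_of_comp {E F X : Type} [TopologicalSpace E] [TopologicalSpace F] [TopologicalSpace X]
    {p : E → F} {f : F → X} (hp : Function.Surjective p) (hc : Continuous p) (h : IsOpenMap (f ∘ p)) :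
    IsOpenMap f := by
  intro V hV
  have := h _ (hV.preimage hc)
  rwa [Set.image_comp, Set.image_preimage_eq _ hp] at this

section
variable {n m a : ℕ} {X Y : Type} [TopologicalSpace X] [TopologicalSpace Y]

lemma q_oq : IsOpenQuotientMap (q n a) := ⟨q_surj, (q n a).continuous, q_open⟩

noncomputable def dsc (F : C(Y × ConfSp n a, X))
    (hF : ∀ y x x', q n a x = q n a x' → F (y, x) = F (y, x')) : C(Y × UConfSp n a, X) :=
  ⟨fun p => F (p.1, Function.surjInv q_surj p.2), by
    have h := IsOpenQuotientMap.prodMap (IsOpenQuotientMap.id (X := Y)) (q_oq (n := n) (a := a))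
    rw [h.isQuotientMap.continuous_iff]
    have : (fun p : Y × UConfSp n a => F (p.1, Function.surjInv q_surj p.2)) ∘
        Prod.map id (q n a) = F := by
      funext ⟨y, x⟩
      exact hF _ _ _ (Function.surjInv_eq _ _)
    rw [this]
    exact F.continuous⟩

lemma dsc_q (F : C(Y × ConfSp n a, X)) (hF) (y : Y) (x : ConfSp n a) : dsc F hF (y, q n a x) = F (y, x) :=
  hF _ _ _ (Function.surjInv_eq _ _)

noncomputable def dsc1 (F : C(ConfSp n a, X))
    (hF : ∀ x x', q n a x = q n a x' → F x = F x') : C(UConfSp n a, X) :=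
  ⟨fun p => F (Function.surjInv q_surj p), by
    rw [(q_oq (n := n) (a := a)).isQuotientMap.continuous_iff]
    have : (fun p : UConfSp n a => F (Function.surjInv q_surj p)) ∘ (q n a) = F := by
      funext x
      exact hF _ _ (Function.surjInv_eq _ _)
    rw [this]
    exact F.continuous⟩

lemma dsc1_q (F : C(ConfSp n a, X)) (hF) (x : ConfSp n a) : dsc1 F hF (q n a x) = F x :=
  hF _ _ (Function.surjInv_eq _ _)

/-! the forgetful map -/

lemma punct_succ (z : ℂ) : z ∈ punctures (a + 1) ↔ z ∈ punctures a ∨ z = (a + 1 : ℂ) := by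
  constructor
  · rintro ⟨k, h1, h2, rfl⟩
    rcases Nat.lt_or_ge a k with h | h
    · right
      have : k = a + 1 := by omega
      subst this
      push_cast
      rfl
    · exact Or.inl ⟨k, h1, h, rfl⟩
  · rintro (⟨k, h1, h2, rfl⟩ | rfl)
    · exact ⟨k, h1, by omega, rfl⟩
    · exact ⟨a + 1, by omega, le_rfl, by push_cast; rfl⟩

lemma punct_self : (a + 1 : ℂ) ∉ punctures a := by
  rintro ⟨k, h1, h2, h⟩
  have : a + 1 = k := by exact_mod_cast h
  omega

def fg (n a : ℕ) : C(ConfSp n (a + 1), ConfSp n a) :=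
  ⟨fun x => ⟨x.1, x.2.1, fun k h => x.2.2 k ((punct_succ _).2 (Or.inl h))⟩, conf_cont val_cont⟩

lemma fg_open : IsOpenMap (fg n a) := by
  have h : Topology.IsInducing (fg n a) := by
    have : Topology.IsInducing ((fun x : ConfSp n a => x.1) ∘ fg n a) :=
      Topology.IsInducing.subtypeVal
    exact this.of_comp (fg n a).continuous val_cont
  refine h.isOpenMap ?_
  have : Set.range (fg n a) = ⋂ k, {x | x.1 k ≠ (a + 1 : ℂ)} := by
    ext x
    simp only [Set.mem_range, Set.mem_iInter, Set.mem_ofPred_eq]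
    constructor
    · rintro ⟨y, rfl⟩ k h
      exact y.2.2 k ((punct_succ _).2 (Or.inr h))
    · intro h
      refine ⟨⟨x.1, x.2.1, fun k hk => ?_⟩, rfl⟩
      rcases (punct_succ _).1 hk with h' | h'
      exacts [x.2.2 k h', h k h']
  rw [this]
  refine isOpen_iInter_of_finite fun k => isOpen_ne_fun ?_ continuous_const
  exact (continuous_apply k).comp val_cont

noncomputable def ff (n a : ℕ) : C(UConfSp n (a + 1), UConfSp n a) :=
  dsc1 ((q n a).comp (fg n a)) fun x x' h => q_eq.2 (q_eq.1 h : Set.range x.1 = Set.range x'.1)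

lemma ff_q (x : ConfSp n (a + 1)) : ff n a (q n (a + 1) x) = q n a (fg n a x) := dsc1_q _ _ _

lemma ff_open : Topology.IsOpenEmbedding (ff n a) := by
  refine .of_continuous_injective_isOpenMap (ff n a).continuous ?_ ?_
  · intro u u' h
    obtain ⟨x, rfl⟩ := q_surj u
    obtain ⟨x', rfl⟩ := q_surj u'
    rw [ff_q, ff_q, q_eq] at h
    exact q_eq.2 h
  · refine open_of_comp q_surj (q n (a + 1)).continuous ?_
    have : ff n a ∘ q n (a + 1) = q n a ∘ fg n a := funext ff_q
    rw [this]
    exact q_open.comp fg_open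

/-! the tube -/

noncomputable def dl (b : ℂ) (x : Fin m → ℂ) : ℝ := 1 / 2 * ∏ k, min 1 ‖x k - b‖

lemma dl_cont (b : ℂ) : Continuous (fun x : Fin m → ℂ => dl b x) := by
  unfold dl
  fun_prop

lemma dl_perm (b : ℂ) (x : Fin m → ℂ) (σ : Equiv.Perm (Fin m)) : dl b (x ∘ σ) = dl b x := by
  unfold dl
  congr 1
  exact Equiv.prod_comp σ (fun k => min 1 ‖x k - b‖)

lemma dl_le (b : ℂ) (x : Fin m → ℂ) (k : Fin m) : 2 * dl b x ≤ ‖x k - b‖ := by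
  unfold dl
  rw [← Finset.mul_prod_erase _ _ (Finset.mem_univ k)]
  have h1 : ∏ k ∈ Finset.univ.erase k, min 1 ‖x k - b‖ ≤ 1 :=
    Finset.prod_le_one (fun _ _ => by positivity) fun _ _ => min_le_left _ _
  have h2 : min 1 ‖x k - b‖ ≤ ‖x k - b‖ := min_le_right _ _
  have h3 : 0 ≤ min 1 ‖x k - b‖ := by positivity
  nlinarith

lemma dl_pos (b : ℂ) (x : Fin m → ℂ) (h : ∀ k, x k ≠ b) : 0 < dl b x := by
  unfold dl
  refine mul_pos (by norm_num) (Finset.prod_pos fun k _ => lt_min one_pos ?_)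
  exact norm_pos_iff.2 (sub_ne_zero.2 (h k))

lemma dl_half (b : ℂ) (x : Fin m → ℂ) : dl b x ≤ 1 / 2 := by
  unfold dl
  have h1 : ∏ k, min 1 ‖x k - b‖ ≤ 1 :=
    Finset.prod_le_one (fun _ _ => by positivity) fun _ _ => min_le_left _ _
  linarith

/-- the new point near `b` -/
noncomputable def pt (b : ℂ) (w : ℂ) (x : Fin m → ℂ) : ℂ := b + (dl b x / (1 + ‖w‖) : ℝ) * w

lemma pt_cont (b : ℂ) : Continuous (fun p : ℂ × (Fin m → ℂ) => pt b p.1 p.2) := by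
  unfold pt
  have := dl_cont (m := m) b
  refine continuous_const.add (.mul (Complex.continuous_ofReal.comp (.div ?_ (by fun_prop) ?_)) continuous_fst)
  · exact this.comp continuous_snd
  · intro p
    positivity

lemma pt_cont2 (b : ℂ) {w : Y → ℂ} {x : Y → Fin m → ℂ} (hw : Continuous w) (hx : Continuous x) :
    Continuous fun y => pt b (w y) (x y) :=
  (pt_cont b).comp (f := fun y => (w y, x y)) (hw.prodMk hx)

lemma pt_norm (b w : ℂ) (x : Fin m → ℂ) (h : ∀ k, x k ≠ b) : ‖pt b w x - b‖ < dl b x := by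
  have h0 := dl_pos b x h
  unfold pt
  rw [add_sub_cancel_left, norm_mul, Complex.norm_real, Real.norm_of_nonneg (by positivity), div_mul_eq_mul_div,
    div_lt_iff₀ (by positivity)]
  nlinarith

lemma pt_ne (b w : ℂ) (x : Fin m → ℂ) (h : ∀ k, x k ≠ b) (k : Fin m) : x k ≠ pt b w x := by
  intro e
  have h1 := pt_norm b w x h
  have h2 := dl_le b x k
  have h0 := dl_pos b x h
  rw [e] at h2
  linarith

lemma conf_ne (x : ConfSp m (a + 1)) (k : Fin m) : x.1 k ≠ (a + 1 : ℂ) := fun h =>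
  x.2.2 k ((punct_succ _).2 (Or.inr h))

lemma punct_far (z : ℂ) (h : ‖z - (a + 1)‖ < 1) : z ∉ punctures a := by
  rintro ⟨k, h1, h2, rfl⟩
  have h3 : ‖((k : ℂ) - (a + 1))‖ = (a + 1 - k : ℝ) := by
    rw [norm_sub_rev]
    have : ((a : ℂ) + 1 - k) = ((a + 1 - k : ℝ) : ℂ) := by push_cast; rfl
    rw [this, Complex.norm_real, Real.norm_of_nonneg]
    have : (k : ℝ) ≤ a := by exact_mod_cast h2
    linarith
  have : (k : ℝ) ≤ a := by exact_mod_cast h2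
  linarith

noncomputable def ad (m a : ℕ) : C(ℂ × ConfSp m (a + 1), ConfSp (m + 1) a) :=
  ⟨fun p => ⟨Fin.cons (pt (a + 1) p.1 p.2.1) p.2.1, by
      rw [Fin.cons_injective_iff]
      refine ⟨?_, p.2.2.1⟩
      rintro ⟨k, hk⟩
      exact pt_ne _ _ _ (conf_ne p.2) k hk, by
      intro k
      refine Fin.cases ?_ (fun k => ?_) k
      · rw [Fin.cons_zero]
        apply punct_far
        have h1 := pt_norm (a + 1) p.1 p.2.1 (conf_ne p.2)
        have h2 := dl_half (a + 1) p.2.1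
        linarith
      · rw [Fin.cons_succ]
        exact (fg m a p.2).2.2 k⟩, by
    apply conf_cont
    refine Continuous.finCons (A := fun _ => ℂ) (f := fun p : ℂ × ConfSp m (a + 1) => pt (a + 1) p.1 p.2.1)
      (g := fun p => p.2.1) ?_ ?_
    · exact pt_cont2 _ continuous_fst (val_cont.comp continuous_snd)
    · exact val_cont.comp continuous_snd⟩

lemma ad_open : IsOpenMap (ad m a) := by
  let R : Set (ConfSp (m + 1) a) := {y | ‖y.1 0 - (a + 1)‖ < dl (a + 1) (fun k => y.1 (Fin.succ k))}
  have c0 : ∀ k, Continuous fun y : ConfSp (m + 1) a => y.1 k := fun k => (continuous_apply k).comp val_cont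
  have cd : Continuous fun y : ConfSp (m + 1) a => dl (a + 1 : ℂ) (fun k => y.1 (Fin.succ k)) :=
    (dl_cont _).comp (continuous_pi fun k => c0 _)
  have hR : IsOpen R := isOpen_lt ((c0 0).sub continuous_const).norm cd
  have hRb : ∀ y : R, ∀ k, y.1.1 (Fin.succ k) ≠ (a + 1 : ℂ) := by
    rintro ⟨y, hy⟩ k h
    have h1 : ‖y.1 0 - (a + 1)‖ < dl (a + 1) (fun k => y.1 (Fin.succ k)) := hy
    have h2 := dl_le (a + 1 : ℂ) (fun k => y.1 (Fin.succ k)) k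
    have h3 := norm_nonneg (y.1 0 - (a + 1))
    have h4 : ‖y.1 (Fin.succ k) - (a + 1)‖ = 0 := by
      rw [h, sub_self, norm_zero]
    beta_reduce at h2
    linarith
  let r : R → ℂ × ConfSp m (a + 1) := fun y =>
    ((((dl (a + 1) (fun k => y.1.1 (Fin.succ k)) - ‖y.1.1 0 - (a + 1)‖ : ℝ))⁻¹ : ℝ) * (y.1.1 0 - (a + 1)),
      ⟨fun k => y.1.1 (Fin.succ k), y.1.2.1.comp (Fin.succ_injective _), fun k hk => by
        rcases (punct_succ _).1 hk with h | h
        exacts [y.1.2.2 _ h, hRb y k h]⟩)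
  have hr : Continuous r := by
    refine .prodMk (.mul (Complex.continuous_ofReal.comp (.inv₀ ?_ ?_)) ?_) (conf_cont ?_)
    · exact (cd.sub ((c0 0).sub continuous_const).norm).comp continuous_subtype_val
    · rintro ⟨y, hy⟩
      exact (sub_pos.2 hy).ne'
    · exact ((c0 0).sub continuous_const).comp continuous_subtype_val
    · exact continuous_pi fun k => (c0 _).comp continuous_subtype_val
  have hmem : ∀ p, ad m a p ∈ R := fun p => pt_norm (a + 1) p.1 p.2.1 (conf_ne p.2)
  have h1 : ∀ p, r ⟨ad m a p, hmem p⟩ = p := by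
    rintro ⟨w, x⟩
    have h0 := dl_pos _ _ (conf_ne x)
    refine Prod.ext ?_ (conf_ext rfl)
    change ((dl (a + 1) x.1 - ‖pt (a + 1) w x.1 - (a + 1)‖ : ℝ)⁻¹ : ℝ) * (pt (a + 1) w x.1 - (a + 1)) = w
    unfold pt
    rw [add_sub_cancel_left, norm_mul, Complex.norm_real, Real.norm_of_nonneg (by positivity), ← mul_assoc,
      ← Complex.ofReal_mul]
    have : ((dl (a + 1) x.1 - dl (a + 1) x.1 / (1 + ‖w‖) * ‖w‖ : ℝ)⁻¹ : ℝ) * (dl (a + 1) x.1 / (1 + ‖w‖)) = 1 := by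
      have : dl (a + 1) x.1 - dl (a + 1) x.1 / (1 + ‖w‖) * ‖w‖ = dl (a + 1) x.1 / (1 + ‖w‖) := by
        field_simp
        ring
      rw [this, inv_mul_cancel₀]
      positivity
    rw [this]
    simp
  have h2 : ∀ y, ad m a (r y) = y.1 := by
    intro y
    apply conf_ext
    have hy : ‖y.1.1 0 - (a + 1)‖ < dl (a + 1) (fun k => y.1.1 (Fin.succ k)) := y.2
    have e : pt (a + 1) (r y).1 (r y).2.1 = y.1.1 0 := by
      change (a + 1 : ℂ) + ((dl (a + 1) (fun k => y.1.1 (Fin.succ k)) / (1 + ‖(((dl (a + 1) (fun k => y.1.1 (Fin.succ k)) - ‖y.1.1 0 - (a + 1)‖ : ℝ))⁻¹ : ℝ) * (y.1.1 0 - (a + 1))‖) : ℝ) : ℂ) *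
        ((((dl (a + 1) (fun k => y.1.1 (Fin.succ k)) - ‖y.1.1 0 - (a + 1)‖ : ℝ))⁻¹ : ℝ) * (y.1.1 0 - (a + 1))) = _
      generalize dl (a + 1) (fun k => y.1.1 (Fin.succ k)) = d at hy ⊢
      generalize hv : y.1.1 0 - (a + 1 : ℂ) = v at hy ⊢
      have hd : 0 < d := lt_of_le_of_lt (norm_nonneg _) hy
      have hs := sub_pos.2 hy
      rw [norm_mul, Complex.norm_real, Real.norm_of_nonneg (by positivity), ← mul_assoc, ← Complex.ofReal_mul]
      have : d / (1 + (d - ‖v‖)⁻¹ * ‖v‖) * (d - ‖v‖)⁻¹ = 1 := by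
        have e1 : 1 + (d - ‖v‖)⁻¹ * ‖v‖ = d * (d - ‖v‖)⁻¹ := by
          field_simp
          ring
        rw [e1]
        field_simp
      rw [this, ← hv]
      simp
    change (Fin.cons (pt (a + 1) (r y).1 (r y).2.1) (r y).2.1 : Fin (m + 1) → ℂ) = y.1.1
    rw [e]
    exact Fin.cons_self_tail _
  intro U hU
  have : ad m a '' U = Subtype.val '' (r ⁻¹' U) := by
    ext y
    constructor
    · rintro ⟨p, hp, rfl⟩
      exact ⟨⟨_, hmem p⟩, by rw [Set.mem_preimage, h1]; exact hp, rfl⟩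
    · rintro ⟨y, hy, rfl⟩
      exact ⟨r y, hy, h2 y⟩
  rw [this]
  exact hR.isOpenMap_subtype_val _ (hU.preimage hr)

lemma ad_range (p : ℂ × ConfSp m (a + 1)) : Set.range (ad m a p).1 =
    insert (pt (a + 1) p.1 p.2.1) (Set.range p.2.1) := Fin.range_cons _ _

lemma dl_range {b : ℂ} {x y : ConfSp m a} (h : q m a x = q m a y) : dl b x.1 = dl b y.1 := by
  obtain ⟨σ, h⟩ := q_eq_perm.1 h
  rw [← h, dl_perm]

lemma pt_range {b w : ℂ} {x y : ConfSp m a} (h : q m a x = q m a y) : pt b w x.1 = pt b w y.1 := by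
  unfold pt
  rw [dl_range h]

noncomputable def gg (m a : ℕ) : C(ℂ × UConfSp m (a + 1), UConfSp (m + 1) a) :=
  dsc ((q _ _).comp (ad m a)) fun y x x' h => by
    apply q_eq.2
    rw [ad_range, ad_range, pt_range h, q_eq.1 h]

lemma gg_q (w : ℂ) (x : ConfSp m (a + 1)) : gg m a (w, q _ _ x) = q _ _ (ad m a (w, x)) := dsc_q _ _ _ _

lemma pt_inj {b w w' : ℂ} {x : Fin m → ℂ} (h : ∀ k, x k ≠ b) (e : pt b w x = pt b w' x) : w = w' := by
  have h0 := dl_pos _ _ h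
  unfold pt at e
  have e := add_left_cancel e
  have e2 := congrArg norm e
  rw [norm_mul, norm_mul, Complex.norm_real, Complex.norm_real, Real.norm_of_nonneg (by positivity),
    Real.norm_of_nonneg (by positivity), div_mul_eq_mul_div, div_mul_eq_mul_div, div_eq_div_iff (by positivity) (by positivity)] at e2
  have : ‖w‖ = ‖w'‖ := by
    have : dl b x * ‖w‖ = dl b x * ‖w'‖ := by linarith
    exact mul_left_cancel₀ h0.ne' this
  rw [this] at e
  refine mul_left_cancel₀ ?_ e
  exact Complex.ofReal_ne_zero.2 (by positivity)

lemma gg_inj : Function.Injective (gg m a) := by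
  rintro ⟨w, u⟩ ⟨w', u'⟩ h
  obtain ⟨x, rfl⟩ := q_surj u
  obtain ⟨x', rfl⟩ := q_surj u'
  rw [gg_q, gg_q, q_eq, ad_range, ad_range] at h
  simp only at h
  have key : ∀ (w w' : ℂ) (x x' : ConfSp m (a + 1)), insert (pt (a + 1) w x.1) (Set.range x.1) =
      insert (pt (a + 1) w' x'.1) (Set.range x'.1) → pt (a + 1) w x.1 ≠ pt (a + 1) w' x'.1 →
      2 * ‖pt (a + 1) w' x'.1 - (a + 1)‖ < ‖pt (a + 1) w x.1 - (a + 1)‖ ∨ False := by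
    intro w w' x x' h hne
    left
    have : pt (a + 1) w' x'.1 ∈ insert (pt (a + 1) w x.1) (Set.range x.1) := by
      rw [h]; exact Set.mem_insert _ _
    have : pt (a + 1) w x.1 ∈ insert (pt (a + 1) w' x'.1) (Set.range x'.1) := by
      rw [← h]; exact Set.mem_insert _ _
    rcases this with h1 | ⟨k, hk⟩
    · exact absurd h1 hne
    · have h1 := dl_le (a + 1 : ℂ) x'.1 k
      rw [hk] at h1
      have h2 := pt_norm (a + 1) w' x'.1 (conf_ne x')
      linarith
  have e : pt (a + 1) w x.1 = pt (a + 1) w' x'.1 := by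
    by_contra hne
    rcases key _ _ _ _ h hne with h1 | h1
    · rcases key _ _ _ _ h.symm (Ne.symm hne) with h2 | h2
      · have := norm_nonneg (pt (a + 1) w x.1 - (a + 1))
        have := norm_nonneg (pt (a + 1) w' x'.1 - (a + 1))
        linarith
      · exact h2
    · exact h1
  have e2 : q m (a + 1) x = q m (a + 1) x' := by
    apply q_eq.2
    have n1 : pt (a + 1) w x.1 ∉ Set.range x.1 := by
      rintro ⟨k, hk⟩; exact pt_ne _ _ _ (conf_ne x) k hk
    have n2 : pt (a + 1) w' x'.1 ∉ Set.range x'.1 := by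
      rintro ⟨k, hk⟩; exact pt_ne _ _ _ (conf_ne x') k hk
    have := congrArg (fun s => s \ {pt (a + 1) w x.1}) h
    beta_reduce at this
    rw [Set.insert_sdiff_self_of_notMem n1] at this
    rw [e, Set.insert_sdiff_self_of_notMem n2] at this
    exact this
  refine Prod.ext ?_ e2
  rw [← pt_range e2] at e
  exact pt_inj (conf_ne x) e

lemma gg_open : Topology.IsOpenEmbedding (gg m a) := by
  refine .of_continuous_injective_isOpenMap (gg m a).continuous gg_inj ?_
  refine open_of_comp (p := Prod.map id (q m (a + 1))) (Function.surjective_id.prodMap q_surj)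
    (continuous_id.prodMap (q _ _).continuous) ?_
  have : gg m a ∘ Prod.map id (q m (a + 1)) = q _ _ ∘ ad m a := funext fun p => gg_q p.1 p.2
  rw [this]
  exact q_open.comp ad_open

lemma pt_eq_b {b w : ℂ} {x : Fin m → ℂ} (h : ∀ k, x k ≠ b) : pt b w x = b ↔ w = 0 := by
  constructor
  · intro e
    apply pt_inj h
    rw [e]
    simp [pt]
  · rintro rfl
    simp [pt]

noncomputable def ak (m a : ℕ) : C(T × ConfSp m (a + 1), ConfSp (m + 1) (a + 1)) :=
  ⟨fun p => ⟨(ad m a (p.1.1, p.2)).1, (ad m a (p.1.1, p.2)).2.1, by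
      intro k hk
      rcases (punct_succ _).1 hk with h | h
      · exact (ad m a (p.1.1, p.2)).2.2 _ h
      · revert h
        refine Fin.cases ?_ (fun k => ?_) k
        · intro h
          exact p.1.2 ((pt_eq_b (conf_ne p.2)).1 h)
        · exact conf_ne p.2 k⟩, by
    apply conf_cont
    refine (val_cont.comp (ad m a).continuous).comp (g := fun p => (ad m a p).1)
      (f := fun p : T × ConfSp m (a + 1) => (p.1.1, p.2)) ?_
    fun_prop⟩

noncomputable def kk (m a : ℕ) : C(T × UConfSp m (a + 1), UConfSp (m + 1) (a + 1)) :=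
  dsc ((q _ _).comp (ak m a)) fun y x x' h => by
    apply q_eq.2
    refine (ad_range (y.1, x)).trans (Eq.trans ?_ (ad_range (y.1, x')).symm)
    rw [pt_range h, q_eq.1 h]

lemma kk_q (w : T) (x : ConfSp m (a + 1)) : kk m a (w, q _ _ x) = q _ _ (ak m a (w, x)) := dsc_q _ _ _ _

def tl (U : Type) [TopologicalSpace U] : C(T × U, ℂ × U) := ⟨fun p => (p.1.1, p.2), by fun_prop⟩

theorem gysinMV : MV (ff (m + 1) a) (gg m a) (kk m a) (tl _) where
  hf := ff_open
  hg := gg_open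
  hk := by
    have hl : Topology.IsEmbedding (tl (UConfSp m (a + 1))) :=
      Topology.IsEmbedding.subtypeVal.prodMap Topology.IsEmbedding.id
    have : Topology.IsEmbedding ((ff (m + 1) a) ∘ (kk m a)) := by
      have e : (ff (m + 1) a) ∘ (kk m a) = gg m a ∘ tl _ := by
        funext ⟨w, u⟩
        obtain ⟨x, rfl⟩ := q_surj u
        change ff _ _ (kk m a (w, q _ _ x)) = gg m a (w.1, q _ _ x)
        rw [kk_q, ff_q, gg_q]
        rfl
      rw [e]
      exact gg_open.isEmbedding.comp hl
    exact Topology.IsEmbedding.of_comp (kk m a).continuous (ff (m + 1) a).continuous this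
  hl := Topology.IsEmbedding.subtypeVal.prodMap Topology.IsEmbedding.id
  comm := by
    ext1 ⟨w, u⟩
    obtain ⟨x, rfl⟩ := q_surj u
    change ff _ _ (kk m a (w, q _ _ x)) = gg m a (w.1, q _ _ x)
    rw [kk_q, ff_q, gg_q]
    rfl
  surj := by
    intro u
    obtain ⟨y, rfl⟩ := q_surj u
    by_cases h : ∃ k, y.1 k = (a + 1 : ℂ)
    · right
      obtain ⟨k, hk⟩ := h
      let x : ConfSp m (a + 1) := ⟨fun j => y.1 (k.succAbove j),
        y.2.1.comp (Fin.succAbove_right_injective), fun j hj => by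
          rcases (punct_succ _).1 hj with h | h
          · exact y.2.2 _ h
          · rw [← hk] at h
            exact Fin.succAbove_ne _ _ (y.2.1 h)⟩
      refine ⟨(0, q _ _ x), ?_⟩
      rw [gg_q, q_eq, ad_range]
      simp only
      rw [(pt_eq_b (conf_ne x)).2 rfl, ← hk]
      ext z
      simp only [Set.mem_insert_iff, Set.mem_range]
      constructor
      · rintro (rfl | ⟨j, rfl⟩)
        exacts [⟨k, rfl⟩, ⟨_, rfl⟩]
      · rintro ⟨j, rfl⟩
        rcases Fin.eq_self_or_eq_succAbove k j with h | ⟨i, h⟩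
        · left; rw [h]
        · right; exact ⟨i, by rw [h]⟩
    · left
      push Not at h
      refine ⟨q _ _ ⟨y.1, y.2.1, fun k hk => ?_⟩, ?_⟩
      · rcases (punct_succ _).1 hk with h' | h'
        exacts [y.2.2 k h', h k h']
      · exact (ff_q _).trans rfl
  pull := by
    rintro u ⟨w, v⟩ h
    obtain ⟨y, rfl⟩ := q_surj u
    obtain ⟨x, rfl⟩ := q_surj v
    rw [ff_q, gg_q, q_eq] at h
    have h : Set.range y.1 = Set.range (ad m a (w, x)).1 := h
    have hw : w ≠ 0 := by
      rintro rfl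
      have : (a + 1 : ℂ) ∈ Set.range y.1 := by
        rw [h, ad_range]
        left
        exact ((pt_eq_b (conf_ne x)).2 rfl).symm
      obtain ⟨k, hk⟩ := this
      exact conf_ne y k hk
    refine ⟨(⟨w, hw⟩, q _ _ x), ?_⟩
    rw [kk_q]
    exact q_eq.2 h.symm

variable (Z : Type) [TopologicalSpace Z]

theorem gysin {i : ℕ} (u : H i (UConfSp (m + 1) (a + 1) × Z)) (hu : hm i (px Z (ff (m + 1) a)) u = 0) :
    ∃ w : H i ((T × UConfSp m (a + 1)) × Z), hm i (px Z (kk m a)) w = u ∧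
      hm i (px Z (pr T (UConfSp m (a + 1)))) w = 0 := by
  obtain ⟨w, h1, h2⟩ := (gysinMV.prod Z).mv1 u 0 (by rw [hu]; simp)
  refine ⟨w, h1, ?_⟩
  have : px Z (pr T (UConfSp m (a + 1))) = (px Z (pr ℂ (UConfSp m (a + 1)))).comp (px Z (tl _)) := rfl
  rw [this, ← hm_comp, h2]
  simp

end
end CB

namespace CB

section
variable {n m a : ℕ} {X Y Z : Type} [TopologicalSpace X] [TopologicalSpace Y] [TopologicalSpace Z]

def rg (u : UConfSp n a) : Set ℂ := Quotient.lift (s := confSetoid n a) (fun x => Set.range x.1) (by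
  rintro x y ⟨σ, h⟩
  rw [← h, EquivLike.range_comp]) u

lemma rg_q (x : ConfSp n a) : rg (q n a x) = Set.range x.1 := rfl

lemma rg_inj {u v : UConfSp n a} (h : rg u = rg v) : u = v := by
  obtain ⟨x, rfl⟩ := q_surj u
  obtain ⟨y, rfl⟩ := q_surj v
  exact q_eq.2 h

def Good (a : ℕ) (x : Fin n → ℂ) : Prop := Function.Injective x ∧ ∀ k, x k ∉ punctures a

def mku (F : Y → Fin n → ℂ) (hc : Continuous F) (hF : ∀ y, Good a (F y)) (c : C(Y, Z)) : C(Y, UConfSp n a × Z) :=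
  ⟨fun y => (q n a ⟨F y, hF y⟩, c y), by
    refine .prodMk ((q n a).continuous.comp ?_) c.continuous
    exact conf_cont hc⟩

lemma mku_rg (F : Y → Fin n → ℂ) (hc : Continuous F) (hF : ∀ y, Good a (F y)) (c : C(Y, Z)) (y : Y) :
    rg (mku F hc hF c y).1 = Set.range (F y) := rfl

lemma mku_snd (F : Y → Fin n → ℂ) (hc : Continuous F) (hF : ∀ y, Good a (F y)) (c : C(Y, Z)) (y : Y) :
    (mku F hc hF c y).2 = c y := rfl

lemma hmk (i : ℕ) (f g : C(Y, UConfSp n a × Z)) (F : ℝ × Y → Fin n → ℂ) (hc : Continuous F)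
    (hF : ∀ t, 0 ≤ t → t ≤ 1 → ∀ y, Good a (F (t, y))) (h2 : ∀ y, (f y).2 = (g y).2)
    (hf : ∀ y, Set.range (F (0, y)) = rg (f y).1) (hg : ∀ y, Set.range (F (1, y)) = rg (g y).1) :
    hm i f = hm i g := by
  let c : C(unitInterval × Y, Z) := ⟨fun p => (f p.2).2, by fun_prop⟩
  let G := mku (fun p : unitInterval × Y => F (p.1.1, p.2)) (by fun_prop) (fun p => hF _ p.1.2.1 p.1.2.2 p.2) c
  refine hm_of i G G.continuous ?_ ?_
  · intro y
    exact Prod.ext (rg_inj (hf y)) rfl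
  · intro y
    exact Prod.ext (rg_inj (hg y)) (h2 y)

lemma hm_congr (i : ℕ) (f g : C(Y, UConfSp n a × Z)) (h2 : ∀ y, (f y).2 = (g y).2)
    (h1 : ∀ y, rg (f y).1 = rg (g y).1) : hm i f = hm i g := by
  congr 1
  ext1 y
  exact Prod.ext (rg_inj (h1 y)) (h2 y)

lemma good0 (x : Fin n → ℂ) : Good 0 x ↔ Function.Injective x := by
  refine ⟨fun h => h.1, fun h => ⟨h, ?_⟩⟩
  rintro k ⟨j, h1, h2, -⟩
  omega

lemma good1 (x : Fin n → ℂ) : Good 1 x ↔ Function.Injective x ∧ ∀ k, x k ≠ 1 := by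
  refine and_congr_right fun _ => forall_congr' fun k => not_congr ?_
  constructor
  · rintro ⟨j, h1, h2, h⟩
    have : j = 1 := by omega
    rw [h, this, Nat.cast_one]
  · intro h
    exact ⟨1, le_rfl, le_rfl, by rw [h, Nat.cast_one]⟩

lemma conf1_ne (x : ConfSp n 1) (k : Fin n) : x.1 k ≠ 1 := ((good1 x.1).1 x.2).2 k

def acons (m : ℕ) : C(ConfSp m 1, ConfSp (m + 1) 0) :=
  ⟨fun x => ⟨Fin.cons 1 x.1, (good0 _).2 (by
      rw [Fin.cons_injective_iff]
      refine ⟨?_, x.2.1⟩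
      rintro ⟨k, hk⟩
      exact conf1_ne x k hk)⟩, by
    apply conf_cont
    exact Continuous.finCons (A := fun _ => ℂ) (f := fun x : ConfSp m 1 => (1 : ℂ)) continuous_const val_cont⟩

noncomputable def ins (m : ℕ) : C(UConfSp m 1, UConfSp (m + 1) 0) :=
  dsc1 ((q _ _).comp (acons m)) fun x x' h => by
    apply q_eq.2
    change Set.range (Fin.cons 1 x.1 : Fin (m + 1) → ℂ) = Set.range (Fin.cons 1 x'.1 : Fin (m + 1) → ℂ)
    rw [Fin.range_cons, Fin.range_cons, q_eq.1 h]

lemma ins_rg (u : UConfSp m 1) : rg (ins m u) = insert 1 (rg u) := by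
  obtain ⟨x, rfl⟩ := q_surj u
  unfold ins
  rw [dsc1_q]
  exact Fin.range_cons _ _

lemma ff_rg (u : UConfSp n (a + 1)) : rg (ff n a u) = rg u := by
  obtain ⟨x, rfl⟩ := q_surj u
  rw [ff_q]
  rfl

theorem ins_onto (i : ℕ) (y : H i (UConfSp (m + 1) 0 × Z)) : ∃ u, hm i (px Z (ins m)) u = y := by
  obtain ⟨x, rfl⟩ := transfer_conf Z i y
  let F : ConfSp (m + 1) 0 × Z → Fin m → ℂ := fun p k => p.1.1 (Fin.succ k) - p.1.1 0 + 1
  have c0 : ∀ k, Continuous fun y : ConfSp (m + 1) 0 => y.1 k := fun k => (continuous_apply k).comp val_cont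
  have hc : Continuous F := continuous_pi fun k =>
    (((c0 _).comp continuous_fst).sub ((c0 _).comp continuous_fst)).add continuous_const
  have hF : ∀ p, Good 1 (F p) := by
    intro p
    rw [good1]
    constructor
    · intro j k h
      simp only [F, add_left_inj, sub_left_inj] at h
      exact Fin.succ_injective _ (p.1.2.1 h)
    · intro k h
      simp only [F, add_eq_right, sub_eq_zero] at h
      exact Fin.succ_ne_zero _ (p.1.2.1 h)
  refine ⟨hm i (mku F hc hF ContinuousMap.snd) x, ?_⟩
  rw [hm_comp]
  congr 1
  symm
  refine hmk i _ _ (fun p k => p.2.1.1 k - (p.1 : ℂ) * (p.2.1.1 0 - 1)) ?_ ?_ ?_ ?_ ?_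
  · refine continuous_pi fun k => ?_
    have c1 : ∀ k, Continuous fun p : ℝ × (ConfSp (m + 1) 0 × Z) => p.2.1.1 k := fun k =>
      (c0 k).comp (continuous_fst.comp continuous_snd)
    have c2 : Continuous fun p : ℝ × (ConfSp (m + 1) 0 × Z) => (p.1 : ℂ) := by fun_prop
    exact (c1 k).sub (c2.mul ((c1 0).sub continuous_const))
  · intro t h0 h1 p
    rw [good0]
    intro j k h
    simp only [sub_left_inj] at h
    exact p.1.2.1 h
  · intro p
    rfl
  · intro p
    simp only [Complex.ofReal_zero, zero_mul, sub_zero]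
    rfl
  · intro p
    change _ = rg (ins m (mku F hc hF ContinuousMap.snd p).1)
    rw [ins_rg, mku_rg, ← Fin.range_cons]
    congr 1
    funext k
    refine Fin.cases ?_ (fun k => ?_) k
    · simp only [Complex.ofReal_one, Fin.cons_zero]
      ring
    · simp only [Fin.cons_succ, F, Complex.ofReal_one]
      ring

/-! the standard families -/

noncomputable def far (k : ℕ) (h : ℝ) : Fin k → ℂ := fun j => Complex.I * ((3 ^ ((j : ℕ) + 2) * h : ℝ) : ℂ)

noncomputable def cf : (n : ℕ) → ℂ → Fin n → ℂ
  | 0, _ => Fin.elim0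
  | 1, _ => fun _ => 0
  | k + 2, z => Fin.cons 0 (Fin.cons z (far k (1 + ‖z‖)))

lemma far_im (k : ℕ) (h : ℝ) (j : Fin k) : (far k h j).im = 3 ^ ((j : ℕ) + 2) * h := by
  rw [far, Complex.I_mul_im, Complex.ofReal_re]

lemma far_re (k : ℕ) (h : ℝ) (j : Fin k) : (far k h j).re = 0 := by
  rw [far, Complex.I_mul_re, Complex.ofReal_im, neg_zero]

lemma far_norm (k : ℕ) (h : ℝ) (hh : 0 ≤ h) (j : Fin k) : ‖far k h j‖ = 3 ^ ((j : ℕ) + 2) * h := by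
  rw [far, norm_mul, Complex.norm_I, one_mul, Complex.norm_real, Real.norm_of_nonneg (by positivity)]

lemma nine_le (j : ℕ) : (9 : ℝ) ≤ 3 ^ (j + 2) := by
  have : (1 : ℝ) ≤ 3 ^ j := one_le_pow₀ (by norm_num)
  rw [pow_add]
  linarith

lemma far_ge (k : ℕ) (h : ℝ) (hh : 0 ≤ h) (j : Fin k) : 9 * h ≤ ‖far k h j‖ := by
  rw [far_norm _ _ hh]
  exact mul_le_mul_of_nonneg_right (nine_le _) hh

lemma far_inj (k : ℕ) (h : ℝ) (hh : 0 < h) : Function.Injective (far k h) := by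
  intro i j e
  have := congrArg Complex.im e
  rw [far_im, far_im] at this
  have := mul_right_cancel₀ hh.ne' this
  have := pow_right_injective₀ (by norm_num : (0 : ℝ) < 3) (by norm_num) this
  exact Fin.ext (by omega)

lemma far_cont (k : ℕ) {h : Y → ℝ} (hh : Continuous h) : Continuous fun y => far k (h y) :=
  continuous_pi fun j => by
    unfold far
    fun_prop

lemma cons_cont {u : Y → ℂ} {v : Y → Fin n → ℂ} (hu : Continuous u) (hv : Continuous v) :
    Continuous fun y => (Fin.cons (u y) (v y) : Fin (n + 1) → ℂ) :=
  Continuous.finCons (A := fun _ => ℂ) hu hv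

lemma cons_inj {u : ℂ} {v : Fin n → ℂ} (h : ∀ k, v k ≠ u) (hv : Function.Injective v) :
    Function.Injective (Fin.cons u v : Fin (n + 1) → ℂ) := by
  rw [Fin.cons_injective_iff]
  exact ⟨by rintro ⟨k, hk⟩; exact h k hk, hv⟩

lemma cons_ne {u w : ℂ} {v : Fin n → ℂ} (h0 : u ≠ w) (h : ∀ k, v k ≠ w) (k : Fin (n + 1)) :
    (Fin.cons u v : Fin (n + 1) → ℂ) k ≠ w := by
  refine Fin.cases ?_ (fun k => ?_) k
  · exact h0
  · exact h k

lemma ne_of_norm {x y : ℂ} (h : ‖x‖ < ‖y‖) : y ≠ x := by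
  rintro rfl; exact lt_irrefl _ h

lemma cf_inj (n : ℕ) (z : ℂ) (hz : z ≠ 0) : Function.Injective (cf n z) := by
  match n with
  | 0 => intro i; exact i.elim0
  | 1 => intro i j _; exact Subsingleton.elim _ _
  | k + 2 =>
    have h0 : 0 ≤ 1 + ‖z‖ := by positivity
    refine cons_inj (cons_ne hz fun j => ?_) (cons_inj (fun j => ?_) (far_inj _ _ (by positivity)))
    · apply ne_of_norm
      have := far_ge k _ h0 j
      rw [norm_zero]
      have := norm_nonneg z
      linarith
    · apply ne_of_norm
      have := far_ge k _ h0 j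
      have := norm_nonneg z
      linarith

lemma cf_cont (n : ℕ) {z : Y → ℂ} (hz : Continuous z) : Continuous fun y => cf n (z y) := by
  match n with
  | 0 => exact continuous_const
  | 1 => exact continuous_const
  | k + 2 => exact cons_cont continuous_const (cons_cont hz (far_cont _ (by fun_prop)))

noncomputable def sf (n : ℕ) (z : ℂ) : Fin n → ℂ := fun j => cf n z j - ((2 * ‖cf n z‖ : ℝ) : ℂ)

lemma sf_cont (n : ℕ) {z : Y → ℂ} (hz : Continuous z) : Continuous fun y => sf n (z y) := by
  have := cf_cont n hz
  unfold sf
  fun_prop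

lemma sf_re (n : ℕ) (z : ℂ) (j : Fin n) : (sf n z j).re ≤ 0 := by
  have h1 := norm_le_pi_norm (cf n z) j
  have h2 := Complex.re_le_norm (cf n z j)
  have h3 := norm_nonneg (cf n z)
  rw [sf, Complex.sub_re, Complex.ofReal_re]
  linarith

lemma sf_ne (n : ℕ) (z : ℂ) (j : Fin n) : sf n z j ≠ 1 := by
  intro h
  have := sf_re n z j
  rw [h, Complex.one_re] at this
  linarith

lemma sf_inj (n : ℕ) (z : ℂ) (hz : z ≠ 0) : Function.Injective (sf n z) := by
  intro i j h
  exact cf_inj n z hz (sub_left_injective h)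

noncomputable def cF (n : ℕ) (Z : Type) [TopologicalSpace Z] : C(T × Z, UConfSp n 0 × Z) :=
  mku (fun p => cf n p.1.1) (cf_cont n (by fun_prop)) (fun p => (good0 _).2 (cf_inj n _ p.1.2)) ContinuousMap.snd

noncomputable def sF (n : ℕ) (Z : Type) [TopologicalSpace Z] : C(T × Z, UConfSp n 1 × Z) :=
  mku (fun p => sf n p.1.1) (sf_cont n (by fun_prop)) (fun p => (good1 _).2 ⟨sf_inj n _ p.1.2, sf_ne n _⟩)
    ContinuousMap.snd

def SS (n : ℕ) : Prop := ∀ (Z : Type) [TopologicalSpace Z] (i : ℕ) (y : H i (UConfSp n 0 × Z)),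
  ∃ x, hm i (cF n Z) x = y

lemma ff_sF (i : ℕ) : hm i ((px Z (ff n 0)).comp (sF n Z)) = hm i (cF n Z) := by
  refine hmk i _ _ (fun p k => cf n p.2.1.1 k - ((1 - p.1) * (2 * ‖cf n p.2.1.1‖) : ℝ)) ?_ ?_ ?_ ?_ ?_
  · have := cf_cont n (z := fun p : ℝ × (T × Z) => p.2.1.1) (by fun_prop)
    fun_prop
  · intro t h0 h1 p
    rw [good0]
    intro j k h
    exact cf_inj n _ p.1.2 (sub_left_injective h)
  · intro p; rfl
  · intro p
    change _ = rg (ff n 0 (sF n Z p).1)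
    rw [ff_rg, sF, mku_rg]
    have : (fun k => cf n p.1.1 k - ((1 - (0 : ℝ)) * (2 * ‖cf n p.1.1‖) : ℝ)) = sf n p.1.1 := by
      unfold sf
      rw [sub_zero, one_mul]
    exact congrArg Set.range this
  · intro p
    rw [cF, mku_rg]
    simp

lemma DD0 (i : ℕ) (u : H i (UConfSp 0 1 × Z)) : ∃ x, u = hm i (sF 0 Z) x := by
  refine ⟨hm i (sl Z 1) (hm i (pr _ Z) u), ?_⟩
  rw [hm_comp, hm_comp]
  conv_lhs => rw [← hm_id u]
  congr 1
  refine hm_congr i _ _ (fun p => rfl) fun p => ?_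
  obtain ⟨⟨u, c⟩, rfl⟩ : ∃ p' : ConfSp 0 1 × Z, (q 0 1 p'.1, p'.2) = p := by
    obtain ⟨x, hx⟩ := q_surj p.1
    exact ⟨(x, p.2), Prod.ext hx rfl⟩
  change Set.range u.1 = Set.range _
  rw [Set.range_eq_empty, Set.range_eq_empty]

lemma DD (hS : SS (m + 1)) (i : ℕ) (u : H i (UConfSp (m + 1) 1 × Z)) :
    ∃ (x : H i (T × Z)) (v : H i ((T × UConfSp m 1) × Z)),
      u = hm i (sF (m + 1) Z) x + hm i (px Z (kk m 0)) v ∧ hm i (px Z (pr T (UConfSp m 1))) v = 0 := by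
  obtain ⟨x, hx⟩ := hS Z i (hm i (px Z (ff (m + 1) 0)) u)
  obtain ⟨v, h1, h2⟩ := gysin (a := 0) Z (u - hm i (sF (m + 1) Z) x) (by
    rw [map_sub, hm_comp, ff_sF, hx, sub_self])
  exact ⟨x, v, by rw [h1]; abel, h2⟩

lemma SSle (hn : n ≤ 1) : SS n := by
  intro Z _ i y
  obtain ⟨x, rfl⟩ := transfer_conf Z i y
  refine ⟨hm i (sl Z 1) (hm i (pr _ Z) x), ?_⟩
  rw [hm_comp, hm_comp]
  congr 1
  symm
  refine hmk i _ _ (fun p k => (1 - (p.1 : ℂ)) * p.2.1.1 k + (p.1 : ℂ) * cf n 1 k) ?_ ?_ ?_ ?_ ?_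
  · refine continuous_pi fun k => ?_
    have c1 : Continuous fun p : ℝ × (ConfSp n 0 × Z) => p.2.1.1 k :=
      ((continuous_apply k).comp val_cont).comp (continuous_fst.comp continuous_snd)
    fun_prop
  · intro t h0 h1 p
    rw [good0]
    intro j k _
    exact Fin.ext (by omega)
  · intro p; rfl
  · intro p
    simp
    rfl
  · intro p
    simp
    rfl

end
end CB

namespace CB

section
variable {n m a : ℕ} {X Y Z : Type} [TopologicalSpace X] [TopologicalSpace Y] [TopologicalSpace Z]

lemma cvx_pos {t a b : ℝ} (h0 : 0 ≤ t) (h1 : t ≤ 1) (ha : 0 < a) (hb : 0 < b) : 0 < (1 - t) * a + t * b := by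
  rcases h0.eq_or_lt with h | h
  · rw [← h]; linarith
  · have := mul_pos h hb
    have := mul_nonneg (sub_nonneg.2 h1) ha.le
    linarith

lemma far_succ (k : ℕ) (h : ℝ) : Set.range (far (k + 1) h) =
    insert (Complex.I * ((3 ^ (k + 2) * h : ℝ) : ℂ)) (Set.range (far k h)) := by
  ext z
  simp only [Set.mem_range, Set.mem_insert_iff, far]
  constructor
  · rintro ⟨j, rfl⟩
    rcases Fin.eq_castSucc_or_eq_last j with ⟨j, rfl⟩ | rfl
    · exact Or.inr ⟨j, rfl⟩
    · exact Or.inl rfl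
  · rintro (rfl | ⟨j, rfl⟩)
    · exact ⟨Fin.last k, rfl⟩
    · exact ⟨Fin.castSucc j, rfl⟩

lemma cf_bound (k : ℕ) (z : ℂ) (j : Fin (k + 2)) : 2 * ‖cf (k + 2) z j‖ < 3 ^ (k + 2) * (1 + ‖z‖) := by
  have h9 := nine_le k
  have hz := norm_nonneg z
  refine Fin.cases ?_ (fun j => Fin.cases ?_ (fun j => ?_) j) j
  · change 2 * ‖(0 : ℂ)‖ < _
    rw [norm_zero, mul_zero]
    positivity
  · change 2 * ‖z‖ < _
    nlinarith
  · change 2 * ‖far k (1 + ‖z‖) j‖ < _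
    rw [far_norm _ _ (by positivity)]
    have : (3 : ℝ) ^ ((j : ℕ) + 2) ≤ 3 ^ (k + 1) := pow_le_pow_right₀ (by norm_num) (by omega)
    have e : (3 : ℝ) ^ (k + 2) = 3 * 3 ^ (k + 1) := by ring
    have : 0 < (3 : ℝ) ^ (k + 1) := by positivity
    rw [e]
    nlinarith

lemma reim (z : ℂ) : z.re + z.im ≤ 2 * ‖z‖ := by
  have := Complex.re_le_norm z
  have := Complex.im_le_norm z
  linarith

lemma imre (z : ℂ) : z.im - z.re ≤ 2 * ‖z‖ := by
  have := Complex.abs_re_le_norm z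
  have := neg_abs_le z.re
  have := Complex.im_le_norm z
  linarith

lemma insA (k : ℕ) (i : ℕ) :
    hm i ((px Z (ins (k + 2))).comp (sF (k + 2) Z)) = hm i (cF (k + 3) Z) := by
  refine hmk i _ _ (fun p => Fin.cons (((1 - p.1 : ℝ) : ℂ) + Complex.I * ((p.1 * (3 ^ (k + 2) * (1 + ‖p.2.1.1‖)) : ℝ) : ℂ))
    (fun j => cf (k + 2) p.2.1.1 j - ((1 - p.1) * (2 * ‖cf (k + 2) p.2.1.1‖) : ℝ))) ?_ ?_ (fun p => rfl) ?_ ?_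
  · have := cf_cont (k + 2) (z := fun p : ℝ × (T × Z) => p.2.1.1) (by fun_prop)
    exact cons_cont (by fun_prop) (by fun_prop)
  · intro t h0 h1 p
    rw [good0]
    refine cons_inj (fun j e => ?_) fun j k h => cf_inj _ _ p.1.2 (sub_left_injective h)
    have e1 := congrArg Complex.re e
    have e2 := congrArg Complex.im e
    simp only [Complex.sub_re, Complex.sub_im, Complex.ofReal_re, Complex.ofReal_im, Complex.add_re, Complex.add_im,
      Complex.I_mul_re, Complex.I_mul_im] at e1 e2
    have b1 := cf_bound k p.1.1 j
    have b2 := norm_le_pi_norm (cf (k + 2) p.1.1) j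
    have b3 := reim (cf (k + 2) p.1.1 j)
    have := cvx_pos (a := 1 + 2 * ‖cf (k + 2) p.1.1‖ - 2 * ‖cf (k + 2) p.1.1 j‖) h0 h1 (by linarith) (sub_pos.2 b1)
    linarith
  · intro p
    change _ = rg (ins (k + 2) (sF (k + 2) Z p).1)
    rw [ins_rg, sF, mku_rg, Fin.range_cons]
    unfold sf
    simp only [sub_zero, one_mul, zero_mul, Complex.ofReal_zero, mul_zero, add_zero, Complex.ofReal_one]
  · intro p
    rw [cF, mku_rg, Fin.range_cons]
    simp only [sub_self, zero_mul, Complex.ofReal_zero, sub_zero, zero_add, one_mul, cf, Fin.range_cons, far_succ]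
    grind

lemma cf_one (z : ℂ) : cf 1 z = cf 1 1 := rfl

lemma insA1 (i : ℕ) (x : H i (T × Z)) :
    hm i ((px Z (ins 1)).comp (sF 1 Z)) x = hm i (cF 2 Z) (hm i (sl Z 1) (hm i (pr _ Z) x)) := by
  rw [hm_comp, hm_comp]
  congr 1
  refine hm_congr i _ _ (fun p => rfl) fun p => ?_
  change rg (ins 1 (sF 1 Z p).1) = Set.range (cf 2 1)
  rw [ins_rg, sF, mku_rg]
  have : sf 1 p.1.1 = fun _ => 0 := by
    funext j
    have : cf 1 p.1.1 = 0 := rfl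
    simp [sf, this]
  rw [this]
  simp only [cf, Fin.range_cons, Set.range_const]
  rw [Set.range_eq_empty (far 0 _)]
  grind

noncomputable def Th (m : ℕ) (Z : Type) [TopologicalSpace Z] :
    C(UConfSp m 1 × (T × Z), UConfSp (m + 2) 0 × Z) :=
  ⟨fun p => (ins (m + 1) (kk m 0 (p.2.1, p.1)), p.2.2), by fun_prop⟩

lemma kk_rg (z : T) (x : ConfSp m 1) : rg (kk m 0 (z, q m 1 x)) = insert (pt 1 z.1 x.1) (Set.range x.1) := by
  rw [kk_q]
  have h : ((0 : ℕ) : ℂ) + 1 = 1 := by simp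
  have := ad_range (a := 0) (z.1, x)
  rw [h] at this
  exact this

lemma Th_rg (x : ConfSp m 1) (p : T × Z) : rg (Th m Z (q m 1 x, p)).1 =
    insert 1 (insert (pt 1 p.1.1 x.1) (Set.range x.1)) := by
  change rg (ins (m + 1) (kk m 0 (p.1, q m 1 x))) = _
  rw [ins_rg, kk_rg]

lemma cf_im (k : ℕ) (j : Fin (k + 2)) : (cf (k + 2) 1 j).im = if (j : ℕ) < 2 then 0 else 3 ^ (j : ℕ) * 2 := by
  refine Fin.cases ?_ (fun j => Fin.cases ?_ (fun j => ?_) j) j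
  · change (0 : ℂ).im = _
    simp
  · change (1 : ℂ).im = _
    simp
  · change (far k (1 + ‖(1 : ℂ)‖) j).im = _
    rw [far_im, norm_one]
    have : ¬ ((j.succ.succ : Fin (k + 2)) : ℕ) < 2 := by simp
    rw [if_neg this]
    simp only [Fin.val_succ]
    norm_num

lemma cf_mono (m : ℕ) : (∀ j, 0 ≤ (cf m 1 j).im) ∧ ∀ i j, i < j → (cf m 1 i).im ≤ (cf m 1 j).im := by
  match m with
  | 0 => exact ⟨fun j => j.elim0, fun j => j.elim0⟩
  | 1 => exact ⟨fun j => le_refl (0 : ℝ), fun _ _ _ => le_refl (0 : ℝ)⟩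
  | k + 2 =>
    refine ⟨fun j => ?_, fun i j h => ?_⟩
    · rw [cf_im]
      split_ifs <;> positivity
    · rw [cf_im, cf_im]
      split_ifs with h1 h2
      · exact le_rfl
      · positivity
      · exact absurd (lt_trans (show (i : ℕ) < j from h) (by assumption)) h1
      · have : (3 : ℝ) ^ (i : ℕ) ≤ 3 ^ (j : ℕ) := pow_le_pow_right₀ (by norm_num) (le_of_lt h)
        linarith

noncomputable def s1c (m : ℕ) : ConfSp m 1 := ⟨sf m 1, (good1 _).2 ⟨sf_inj m _ one_ne_zero, sf_ne m _⟩⟩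

lemma pt_sub (w : ℂ) (x : Fin m → ℂ) : pt 1 w x = 1 + (dl 1 x / (1 + ‖w‖) : ℝ) * w := rfl

lemma pt_s (w : ℂ) (x : Fin m → ℂ) (h : ∀ k, x k ≠ 1) : dl 1 x / (1 + ‖w‖) * ‖w‖ < dl 1 x := by
  have := pt_norm 1 w x h
  have h0 := dl_pos _ _ h
  rwa [pt, add_sub_cancel_left, norm_mul, Complex.norm_real, Real.norm_of_nonneg (by positivity)] at this

lemma W1 (m i : ℕ) : hm i ((Th m Z).comp (sl (T × Z) (q m 1 (s1c m)))) = hm i (cF (m + 2) Z) := by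
  let s : T × Z → ℝ := fun p => dl 1 (sf m 1) / (1 + ‖p.1.1‖)
  have sc : Continuous s := Continuous.div continuous_const (by fun_prop) fun p => by positivity
  have hd := dl_pos 1 (sf m 1) (sf_ne m 1)
  have hd2 := dl_half 1 (sf m 1)
  have sp : ∀ p, 0 < s p := fun p => by positivity
  have ss : ∀ p : T × Z, 2 * (s p * ‖p.1.1‖) < 1 := fun p => by
    have := pt_s p.1.1 (sf m 1) (sf_ne m 1)
    simp only [s]
    linarith
  obtain ⟨m1, m2⟩ := cf_mono m
  have sim : ∀ j, (sf m 1 j).im = (cf m 1 j).im := by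
    intro j
    rw [sf, Complex.sub_im, Complex.ofReal_im, sub_zero]
  refine hmk i _ _ (fun p => Fin.cons ((1 - p.1 : ℝ) : ℂ)
    (Fin.cons (((1 - p.1 : ℝ) : ℂ) + (((1 - p.1) * s p.2 + p.1 : ℝ) : ℂ) * p.2.1.1)
      (fun j => ((1 - p.1 : ℝ) : ℂ) * sf m 1 j + (p.1 : ℂ) * far m (1 + ‖p.2.1.1‖) j))) ?_ ?_ (fun p => rfl) ?_ ?_
  · have := far_cont m (h := fun p : ℝ × (T × Z) => 1 + ‖p.2.1.1‖) (by fun_prop)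
    exact cons_cont (by fun_prop) (cons_cont (by fun_prop) (by fun_prop))
  · intro t h0 h1 p
    rw [good0]
    have hz := norm_nonneg p.1.1
    have q0 := cvx_pos h0 h1 (sp p) one_pos
    rw [mul_one] at q0
    have fim : ∀ j, (((1 - t : ℝ) : ℂ) * sf m 1 j + (t : ℂ) * far m (1 + ‖p.1.1‖) j).im =
        (1 - t) * (cf m 1 j).im + t * (3 ^ ((j : ℕ) + 2) * (1 + ‖p.1.1‖)) := by
      intro j
      rw [Complex.add_im, Complex.im_ofReal_mul, Complex.im_ofReal_mul, far_im, sim]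
    have fre : ∀ j, (((1 - t : ℝ) : ℂ) * sf m 1 j + (t : ℂ) * far m (1 + ‖p.1.1‖) j).re =
        (1 - t) * (sf m 1 j).re := by
      intro j
      rw [Complex.add_re, Complex.re_ofReal_mul, Complex.re_ofReal_mul, far_re, mul_zero, add_zero]
    have pos : ∀ j, 2 * (((1 - t) * s p + t) * ‖p.1.1‖) <
        (((1 - t : ℝ) : ℂ) * sf m 1 j + (t : ℂ) * far m (1 + ‖p.1.1‖) j).im -
        (((1 - t : ℝ) : ℂ) * sf m 1 j + (t : ℂ) * far m (1 + ‖p.1.1‖) j).re + (1 - t) := by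
      intro j
      rw [fim, fre]
      have r1 := sf_re m 1 j
      have r2 := m1 j
      have r3 : 0 < 3 ^ ((j : ℕ) + 2) * (1 + ‖p.1.1‖) - 2 * ‖p.1.1‖ := by
        have := nine_le j
        nlinarith
      have := cvx_pos h0 h1 (sub_pos.2 (ss p)) r3
      have r4 := mul_nonneg (sub_nonneg.2 h1) r2
      have r5 := mul_nonneg (sub_nonneg.2 h1) (neg_nonneg.2 r1)
      linarith
    refine cons_inj (cons_ne ?_ fun j e => ?_) (cons_inj (fun j e => ?_) ?_)
    · rw [Ne, add_eq_left, mul_eq_zero, not_or]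
      exact ⟨Complex.ofReal_ne_zero.2 q0.ne', p.1.2⟩
    · have := pos j
      rw [e, Complex.ofReal_im, Complex.ofReal_re] at this
      have := mul_nonneg q0.le hz
      linarith
    · have := pos j
      rw [e, Complex.add_im, Complex.add_re, Complex.ofReal_im, Complex.ofReal_re] at this
      have h3 := imre ((((1 - t) * s p + t : ℝ) : ℂ) * p.1.1)
      rw [norm_mul, Complex.norm_real, Real.norm_of_nonneg q0.le] at h3
      linarith
    · rcases h0.eq_or_lt with h | h
      · rw [← h]
        simp only [sub_zero, Complex.ofReal_one, one_mul, Complex.ofReal_zero, zero_mul, add_zero]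
        exact sf_inj m 1 one_ne_zero
      · refine Function.Injective.of_lt_imp_ne ?_
        intro j k hjk e
        have := congrArg Complex.im e
        rw [fim, fim] at this
        have r1 := mul_le_mul_of_nonneg_left (m2 j k hjk) (sub_nonneg.2 h1)
        have r2 : (3 : ℝ) ^ ((j : ℕ) + 2) < 3 ^ ((k : ℕ) + 2) :=
          pow_lt_pow_right₀ (by norm_num) (by have : (j : ℕ) < k := hjk; omega)
        have r3 : t * (3 ^ ((j : ℕ) + 2) * (1 + ‖p.1.1‖)) < t * (3 ^ ((k : ℕ) + 2) * (1 + ‖p.1.1‖)) := by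
          gcongr
        linarith
  · intro p
    refine Eq.trans ?_ (Th_rg (s1c m) p).symm
    rw [Fin.range_cons, Fin.range_cons, pt_sub]
    simp only [sub_zero, Complex.ofReal_one, one_mul, Complex.ofReal_zero, zero_mul, add_zero]
    rfl
  · intro p
    rw [cF, mku_rg]
    simp only [sub_self, Complex.ofReal_one, one_mul, Complex.ofReal_zero, zero_mul, zero_add]
    rfl

lemma F0triv (hm1 : ∀ w, cf m w = cf m 1) (i : ℕ) (x : H i (T × (T × Z))) (hx : hm i (pr T (T × Z)) x = 0) :
    hm i ((Th m Z).comp (sF m (T × Z))) x = 0 := by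
  have : (Th m Z).comp (sF m (T × Z)) = ((Th m Z).comp (sl (T × Z) (q m 1 (s1c m)))).comp (pr T (T × Z)) := by
    ext1 p
    refine congrArg (Th m Z) (Prod.ext (rg_inj ?_) rfl)
    change Set.range (sf m p.1.1) = Set.range (sf m 1)
    unfold sf
    rw [hm1]
  rw [this, ← hm_comp, hx, map_zero]

noncomputable def rho (p : T × (T × Z)) : ℝ := 1 + ‖p.1.1‖ + ‖p.2.1.1‖

lemma rho_cont : Continuous (rho : T × (T × Z) → ℝ) := by
  unfold rho
  fun_prop

lemma cfg_inj (k : ℕ) (p s h : ℝ) (w z : ℂ) (hw : w ≠ 0) (hz : z ≠ 0) (h1 : ‖w‖ < p - s * ‖z‖) (hs : 0 < s)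
    (hh : ‖w‖ < h) : Function.Injective
      (Fin.cons (p : ℂ) (Fin.cons (p + s * z) (Fin.cons 0 (Fin.cons w (far k h)))) : Fin (k + 4) → ℂ) := by
  have n1 := norm_nonneg w
  have n2 := mul_nonneg hs.le (norm_nonneg z)
  have r1 : ∀ x : ℂ, x.re ≤ ‖w‖ → x ≠ p + s * z := by
    rintro x hx rfl
    rw [Complex.add_re, Complex.ofReal_re, Complex.re_ofReal_mul] at hx
    have := Complex.abs_re_le_norm z
    have := neg_abs_le z.re
    nlinarith
  have r2 : ∀ x : ℂ, x.re ≤ ‖w‖ → x ≠ p := by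
    rintro x hx rfl
    rw [Complex.ofReal_re] at hx
    linarith
  have h0 : 0 ≤ h := by linarith
  refine cons_inj (cons_ne ?_ (cons_ne (r2 _ n1) (cons_ne (r2 _ (Complex.re_le_norm w)) fun j => r2 _ ?_)))
    (cons_inj (cons_ne (r1 _ n1) (cons_ne (r1 _ (Complex.re_le_norm w)) fun j => r1 _ ?_))
      (cons_inj (cons_ne hw fun j => ?_) (cons_inj (fun j => ?_) (far_inj k h (by linarith)))))
  · rw [Ne, add_eq_left, mul_eq_zero, not_or]
    exact ⟨Complex.ofReal_ne_zero.2 hs.ne', hz⟩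
  · rw [far_re]; exact n1
  · rw [far_re]; exact n1
  · apply ne_of_norm
    have := far_ge k h h0 j
    rw [norm_zero]
    linarith
  · apply ne_of_norm
    have := far_ge k h h0 j
    linarith

lemma cfg2_inj (k : ℕ) (a b z w : ℂ) (h : ℝ) (hw : w ≠ 0) (hz : z ≠ 0) (h1 : ‖z‖ + ‖w‖ < ‖a - b‖)
    (ha : ‖a‖ + ‖z‖ < 9 * h) (hb : ‖b‖ + ‖w‖ < 9 * h) : Function.Injective
      (Fin.cons a (Fin.cons (a + z) (Fin.cons b (Fin.cons (b + w) (far k h)))) : Fin (k + 4) → ℂ) := by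
  have n1 := norm_nonneg w
  have n2 := norm_nonneg z
  have n3 := norm_nonneg a
  have n4 := norm_nonneg b
  have h0 : 0 < h := by linarith
  have s : ∀ x : ℂ, ‖x‖ < 9 * h → ∀ j, far k h j ≠ x := fun x hx j => ne_of_norm (hx.trans_le (far_ge k h h0.le j))
  have s1 := norm_add_le a z
  have s2 := norm_add_le b w
  have d : ∀ x y : ℂ, ‖x‖ ≤ ‖z‖ → ‖y‖ ≤ ‖w‖ → b + y ≠ a + x := by
    intro x y hx hy e
    have : a - b = y - x := by linear_combination -e
    rw [this] at h1
    have := norm_sub_le y x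
    linarith
  refine cons_inj (cons_ne (by simpa using hz) (cons_ne ?_ (cons_ne ?_ (s _ (by linarith)))))
    (cons_inj (cons_ne ?_ (cons_ne (d _ _ le_rfl le_rfl) (s _ (by linarith))))
      (cons_inj (cons_ne (by simpa using hw) (s _ (by linarith))) (cons_inj (s _ (by linarith)) (far_inj k h h0))))
  · simpa using d 0 0 (by simp) (by simp)
  · simpa using d 0 w (by simp) le_rfl
  · simpa using d z 0 le_rfl (by simp)

noncomputable def GG (k : ℕ) (Z : Type) [TopologicalSpace Z] : C(T × (T × Z), UConfSp (k + 4) 0 × Z) :=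
  mku (fun p => Fin.cons (((2 * rho p : ℝ)) : ℂ) (Fin.cons (((2 * rho p : ℝ) : ℂ) + ((1 : ℝ) : ℂ) * p.2.1.1)
      (Fin.cons 0 (Fin.cons p.1.1 (far k (rho p)))))) (by
    have := rho_cont (Z := Z)
    exact cons_cont (by fun_prop) (cons_cont (by fun_prop) (cons_cont (by fun_prop) (cons_cont (by fun_prop)
      (far_cont _ this))))) (fun p => (good0 _).2 (by
    have n1 := norm_nonneg p.1.1
    have n2 := norm_nonneg p.2.1.1
    apply cfg_inj k _ _ _ _ _ p.1.2 p.2.1.2 _ one_pos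
    · unfold rho; linarith
    · unfold rho; linarith)) ⟨fun p => p.2.2, by fun_prop⟩

lemma cons_sub (u c : ℂ) (v : Fin n → ℂ) : (fun j => (Fin.cons u v : Fin (n + 1) → ℂ) j - c) =
    (Fin.cons (u - c) (fun j => v j - c) : Fin (n + 1) → ℂ) := by
  funext j
  refine Fin.cases ?_ (fun j => ?_) j <;> simp

lemma F0a (k i : ℕ) : hm i ((Th (k + 2) Z).comp (sF (k + 2) (T × Z))) = hm i (GG k Z) := by
  let N : T × (T × Z) → ℝ := fun p => 2 * ‖cf (k + 2) p.1.1‖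
  have Nc : Continuous N := by
    have := cf_cont (k + 2) (z := fun p : T × (T × Z) => p.1.1) (by fun_prop)
    fun_prop
  let s : T × (T × Z) → ℝ := fun p => dl 1 (sf (k + 2) p.1.1) / (1 + ‖p.2.1.1‖)
  have sc : Continuous s := Continuous.div ((dl_cont 1).comp (sf_cont _ (by fun_prop))) (by fun_prop)
    fun p => by positivity
  have rc := rho_cont (Z := Z)
  refine hmk i _ _ (fun p j => (Fin.cons (((1 - p.1) * (1 + N p.2) + p.1 * (2 * rho p.2) : ℝ) : ℂ)
    (Fin.cons ((((1 - p.1) * (1 + N p.2) + p.1 * (2 * rho p.2) : ℝ) : ℂ) + ((((1 - p.1) * s p.2 + p.1 * 1 : ℝ)) : ℂ) * p.2.2.1.1)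
      (Fin.cons 0 (Fin.cons p.2.1.1 (far k ((1 - p.1) * (1 + ‖p.2.1.1‖) + p.1 * rho p.2))))) : Fin (k + 4) → ℂ) j -
      (((1 - p.1) * N p.2 : ℝ) : ℂ)) ?_ ?_ (fun p => rfl) ?_ ?_
  · have : Continuous (fun p : ℝ × (T × (T × Z)) => (Fin.cons (((1 - p.1) * (1 + N p.2) + p.1 * (2 * rho p.2) : ℝ) : ℂ)
    (Fin.cons ((((1 - p.1) * (1 + N p.2) + p.1 * (2 * rho p.2) : ℝ) : ℂ) + ((((1 - p.1) * s p.2 + p.1 * 1 : ℝ)) : ℂ) * p.2.2.1.1)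
      (Fin.cons 0 (Fin.cons p.2.1.1 (far k ((1 - p.1) * (1 + ‖p.2.1.1‖) + p.1 * rho p.2))))) : Fin (k + 4) → ℂ)) :=
      cons_cont (by fun_prop) (cons_cont (by fun_prop) (cons_cont (by fun_prop) (cons_cont (by fun_prop)
      (far_cont _ (by fun_prop)))))
    fun_prop
  · intro t h0 h1 p
    rw [good0]
    have n1 := norm_nonneg p.1.1
    have n2 := norm_nonneg p.2.1.1
    have hd := dl_pos 1 (sf (k + 2) p.1.1) (sf_ne _ _)
    have hd2 := dl_half 1 (sf (k + 2) p.1.1)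
    have hs := pt_s p.2.1.1 (sf (k + 2) p.1.1) (sf_ne _ _)
    have sp : 0 < s p := by positivity
    have hN : 2 * ‖p.1.1‖ ≤ N p := by
      have := norm_le_pi_norm (cf (k + 2) p.1.1) 1
      have e : cf (k + 2) p.1.1 1 = p.1.1 := rfl
      rw [e] at this
      simp only [N]
      linarith
    have hs : s p * ‖p.2.1.1‖ < 1 / 2 := lt_of_lt_of_le hs hd2
    refine (sub_left_injective).comp (cfg_inj k _ _ _ _ _ p.1.2 p.2.1.2 ?_ (cvx_pos h0 h1 sp one_pos) ?_)
    · have := cvx_pos (a := 1 + N p - s p * ‖p.2.1.1‖ - ‖p.1.1‖) (b := 2 * rho p - ‖p.2.1.1‖ - ‖p.1.1‖) h0 h1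
        (by linarith) (by unfold rho; linarith)
      linarith
    · have := cvx_pos (a := 1) (b := rho p - ‖p.1.1‖) h0 h1 one_pos (by unfold rho; linarith)
      linarith
  · intro p
    let x : ConfSp (k + 2) 1 := ⟨sf (k + 2) p.1.1, (good1 _).2 ⟨sf_inj _ _ p.1.2, sf_ne _ _⟩⟩
    refine Eq.trans ?_ (Th_rg x p.2).symm
    simp only [cons_sub, sub_zero, one_mul, zero_mul, add_zero]
    rw [Fin.range_cons, Fin.range_cons, pt_sub]
    congr 1
    · push_cast; ring
    · congr 1
      · push_cast
        simp only [s, x]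
        push_cast
        ring
      · change _ = Set.range (sf (k + 2) p.1.1)
        unfold sf
        simp only [cf, cons_sub]
        rfl
  · intro p
    rw [GG, mku_rg]
    simp only [sub_self, zero_mul, Complex.ofReal_zero, sub_zero, zero_add, one_mul]

lemma F0b (k i : ℕ) : hm i ((GG k Z).comp (th Z)) = hm i (GG k Z) := by
  have rc := rho_cont (Z := Z)
  have he : ∀ t : ℝ, ‖Complex.exp (t * Real.pi * Complex.I)‖ = 1 := by
    intro t
    have := Complex.norm_exp_ofReal_mul_I (t * Real.pi)
    push_cast at this
    exact this
  symm
  refine hmk i _ _ (fun p => Fin.cons ((rho p.2 : ℂ) * (1 + Complex.exp (p.1 * Real.pi * Complex.I)))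
    (Fin.cons ((rho p.2 : ℂ) * (1 + Complex.exp (p.1 * Real.pi * Complex.I)) + p.2.2.1.1)
    (Fin.cons ((rho p.2 : ℂ) * (1 - Complex.exp (p.1 * Real.pi * Complex.I)))
    (Fin.cons ((rho p.2 : ℂ) * (1 - Complex.exp (p.1 * Real.pi * Complex.I)) + p.2.1.1)
    (far k (rho p.2)))))) ?_ ?_ (fun p => rfl) ?_ ?_
  · exact cons_cont (by fun_prop) (cons_cont (by fun_prop) (cons_cont (by fun_prop) (cons_cont (by fun_prop)
      (far_cont _ (by fun_prop)))))
  · intro t h0 h1 p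
    rw [good0]
    have n1 := norm_nonneg p.1.1
    have n2 := norm_nonneg p.2.1.1
    have hr : 0 < rho p := by unfold rho; positivity
    have hr2 : ‖p.1.1‖ + ‖p.2.1.1‖ < rho p := by unfold rho; linarith
    have e1 : ‖1 + Complex.exp (t * Real.pi * Complex.I)‖ ≤ 2 := by
      refine (norm_add_le _ _).trans ?_
      rw [he, norm_one]; norm_num
    have e2 : ‖1 - Complex.exp (t * Real.pi * Complex.I)‖ ≤ 2 := by
      refine (norm_sub_le _ _).trans ?_
      rw [he, norm_one]; norm_num
    apply cfg2_inj k _ _ _ _ _ p.1.2 p.2.1.2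
    · have : (rho p : ℂ) * (1 + Complex.exp (t * Real.pi * Complex.I)) -
        (rho p : ℂ) * (1 - Complex.exp (t * Real.pi * Complex.I)) = (rho p : ℂ) * (2 * Complex.exp (t * Real.pi * Complex.I)) := by
        ring
      rw [this, norm_mul, norm_mul, he, Complex.norm_real, Real.norm_of_nonneg hr.le]
      simp only [Complex.norm_ofNat]
      linarith
    · rw [norm_mul, Complex.norm_real, Real.norm_of_nonneg hr.le]
      nlinarith
    · rw [norm_mul, Complex.norm_real, Real.norm_of_nonneg hr.le]
      nlinarith
  · intro p
    rw [GG, mku_rg]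
    simp only [Complex.ofReal_zero, zero_mul, Complex.exp_zero, sub_self, mul_zero, zero_add]
    push_cast
    rw [one_mul, one_add_one_eq_two, mul_comm]
  · intro p
    change _ = rg (GG k Z (th Z p)).1
    rw [GG, mku_rg]
    simp only [Complex.ofReal_one, one_mul, Complex.exp_pi_mul_I, add_neg_cancel, mul_zero, zero_add, sub_neg_eq_add,
      Fin.range_cons, th]
    have : rho (p.2.1, p.1, p.2.2) = rho p := by unfold rho; ring
    simp only [ContinuousMap.coe_mk, this]
    have : ((rho p : ℂ)) * (1 + 1) = ((2 * rho p : ℝ) : ℂ) := by push_cast; ring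
    rw [this]
    grind

theorem F0 (k i : ℕ) (x : H i (T × (T × Z))) (hx : Hff x) :
    hm i ((Th (k + 2) Z).comp (sF (k + 2) (T × Z))) x = 0 := by
  rw [F0a]
  apply eq_zero_of_neg
  conv_lhs => rw [← F0b, ← hm_comp, swap i x hx, map_neg]

end
end CB

namespace CB

section
variable {k : ℕ} {X Y Z : Type} [TopologicalSpace X] [TopologicalSpace Y] [TopologicalSpace Z]

def tr (a b d : ℂ) (c : Fin k → ℂ) : Fin (k + 3) → ℂ :=
  Fin.cons (1 + a) (Fin.cons (1 + b) (Fin.cons (1 + d) c))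

lemma tr_range (a b d : ℂ) (c : Fin k → ℂ) :
    Set.range (tr a b d c) = insert (1 + a) (insert (1 + b) (insert (1 + d) (Set.range c))) := by
  unfold tr
  rw [Fin.range_cons, Fin.range_cons, Fin.range_cons]

lemma tr_cont {a b d : Y → ℂ} {c : Y → Fin k → ℂ} (ha : Continuous a) (hb : Continuous b) (hd : Continuous d)
    (hc : Continuous c) : Continuous fun y => tr (a y) (b y) (d y) (c y) :=
  cons_cont (by fun_prop) (cons_cont (by fun_prop) (cons_cont (by fun_prop) hc))

lemma tr_good {a b d : ℂ} {c : ConfSp k 1} (h1 : b ≠ a) (h2 : d ≠ a) (h3 : d ≠ b) (ha : ‖a‖ < 2 * dl 1 c.1)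
    (hb : ‖b‖ < 2 * dl 1 c.1) (hd : ‖d‖ < 2 * dl 1 c.1) : Good 0 (tr a b d c.1) := by
  have s : ∀ x : ℂ, ‖x‖ < 2 * dl 1 c.1 → ∀ j, c.1 j ≠ 1 + x := by
    intro x hx j e
    have := dl_le 1 c.1 j
    rw [e, add_sub_cancel_left] at this
    linarith
  rw [good0]
  exact cons_inj (cons_ne (by simpa using h1) (cons_ne (by simpa using h2) (s _ ha)))
    (cons_inj (cons_ne (by simpa using h3) (s _ hb)) (cons_inj (s _ hd) c.2.1))

noncomputable def sg (a b d : ℂ) (c : Fin k → ℂ) : ℝ := dl 1 c / (1 + ‖a‖ + ‖b‖ + ‖d‖)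

lemma sg_pos (a b d : ℂ) (c : ConfSp k 1) : 0 < sg a b d c.1 := by
  have := dl_pos 1 c.1 (conf1_ne c)
  unfold sg
  positivity

lemma sg_lt (a b d : ℂ) (c : ConfSp k 1) (x : ℂ) (hx : ‖x‖ ≤ ‖a‖ + ‖b‖ + ‖d‖) :
    ‖(sg a b d c.1 : ℂ) * x‖ < dl 1 c.1 := by
  have := dl_pos 1 c.1 (conf1_ne c)
  rw [norm_mul, Complex.norm_real, Real.norm_of_nonneg (sg_pos a b d c).le]
  unfold sg
  rw [div_mul_eq_mul_div, div_lt_iff₀ (by positivity)]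
  nlinarith

noncomputable def n3 (a b d : ℂ) (c : Fin k → ℂ) : Fin (k + 3) → ℂ :=
  tr (sg a b d c * a) (sg a b d c * b) (sg a b d c * d) c

lemma n3_cont {a b d : Y → ℂ} {c : Y → Fin k → ℂ} (ha : Continuous a) (hb : Continuous b) (hd : Continuous d)
    (h1 : Continuous c) : Continuous fun y => n3 (a y) (b y) (d y) (c y) := by
  have h2 : Continuous fun y => dl 1 (c y) := (dl_cont 1).comp h1
  have h3 : Continuous fun y => sg (a y) (b y) (d y) (c y) := by
    unfold sg
    exact h2.div (by fun_prop) fun y => by positivity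
  exact tr_cont (by fun_prop) (by fun_prop) (by fun_prop) h1

lemma n3_good {a b d : ℂ} {c : ConfSp k 1} (h1 : b ≠ a) (h2 : d ≠ a) (h3 : d ≠ b) : Good 0 (n3 a b d c.1) := by
  have h0 : (sg a b d c.1 : ℂ) ≠ 0 := Complex.ofReal_ne_zero.2 (sg_pos a b d c).ne'
  have hp := dl_pos 1 c.1 (conf1_ne c)
  have na := norm_nonneg a
  have nb := norm_nonneg b
  have nd := norm_nonneg d
  have s := fun x hx => (sg_lt a b d c x hx).trans (show dl 1 c.1 < 2 * dl 1 c.1 by linarith)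
  exact tr_good ((mul_right_injective₀ h0).ne h1) ((mul_right_injective₀ h0).ne h2) ((mul_right_injective₀ h0).ne h3)
    (s _ (by linarith)) (s _ (by linarith)) (s _ (by linarith))

lemma n3_swap (a b d : ℂ) (c : Fin k → ℂ) : Set.range (n3 a b d c) = Set.range (n3 b a d c) := by
  unfold n3
  rw [tr_range, tr_range, Set.insert_comm]
  have : sg a b d c = sg b a d c := by
    unfold sg
    congr 1
    ring
  rw [this]

lemma n3_swap2 (a b d : ℂ) (c : Fin k → ℂ) : Set.range (n3 a b d c) = Set.range (n3 a d b c) := by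
  unfold n3
  rw [tr_range, tr_range, Set.insert_comm (1 + _ * b)]
  have : sg a b d c = sg a d b c := by
    unfold sg
    congr 1
    ring
  rw [this]

lemma PP_cont : Continuous fun p : s01 × (T × (ConfSp k 1 × Z)) => n3 0 p.2.1.1 (p.2.1.1 * p.1.1) p.2.2.1.1 :=
  n3_cont (by fun_prop) (by fun_prop) (by fun_prop) (val_cont.comp (by fun_prop))

lemma PP_good (p : s01 × (T × (ConfSp k 1 × Z))) : Good 0 (n3 0 p.2.1.1 (p.2.1.1 * p.1.1) p.2.2.1.1) :=
  n3_good (c := p.2.2.1) p.2.1.2 (mul_ne_zero p.2.1.2 p.1.2.1) (fun h => p.1.2.2 ((mul_eq_left₀ p.2.1.2).1 h))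

noncomputable def PP (k : ℕ) (Z : Type) [TopologicalSpace Z] :
    C(s01 × (T × (ConfSp k 1 × Z)), UConfSp (k + 3) 0 × Z) :=
  mku (fun p => n3 0 p.2.1.1 (p.2.1.1 * p.1.1) p.2.2.1.1) PP_cont PP_good ⟨fun p => p.2.2.2, by fun_prop⟩

lemma PP_rg (p : s01 × (T × (ConfSp k 1 × Z))) :
    rg (PP k Z p).1 = Set.range (n3 0 p.2.1.1 (p.2.1.1 * p.1.1) p.2.2.1.1) := rfl

lemma PP_om (i : ℕ) : hm i ((PP k Z).comp (om _)) = hm i (PP k Z) := by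
  symm
  let E : ℝ → ℂ := fun s => Complex.exp (s * Real.pi * Complex.I)
  have Ec : Continuous E := by fun_prop
  have E0 : ∀ s, E s ≠ 0 := fun s => Complex.exp_ne_zero _
  refine hmk i _ _ (fun p => n3 (p.2.2.1.1 * (p.1 + E p.1 * 0)) (p.2.2.1.1 * (p.1 + E p.1 * 1))
    (p.2.2.1.1 * (p.1 + E p.1 * p.2.1.1)) p.2.2.2.1.1) ?_ ?_ (fun p => rfl) ?_ ?_
  · exact n3_cont (by fun_prop) (by fun_prop) (by fun_prop) (val_cont.comp (by fun_prop))
  · intro t h0 h1 p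
    have s : ∀ x y : ℂ, x ≠ y → p.2.1.1 * (t + E t * x) ≠ p.2.1.1 * (t + E t * y) := by
      intro x y h
      exact (mul_right_injective₀ p.2.1.2).ne ((add_right_injective _).ne ((mul_right_injective₀ (E0 t)).ne h))
    exact n3_good (c := p.2.2.1) (s _ _ one_ne_zero) (s _ _ p.1.2.1) (s _ _ p.1.2.2)
  · intro p
    have : E 0 = 1 := by simp [E]
    simp only [this, Complex.ofReal_zero, zero_add, one_mul, mul_zero, mul_one]
    rfl
  · intro p
    have : E 1 = -1 := by simp [E]
    rw [n3_swap, ContinuousMap.comp_apply, PP_rg]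
    simp only [this, Complex.ofReal_one, mul_zero, add_zero, mul_one, add_neg_cancel, neg_one_mul,
      ← sub_eq_add_neg]
    rfl

lemma PP_oi (i : ℕ) : hm i ((PP k Z).comp ((oi _).comp ((g0 _).comp (ti _)))) =
    hm i ((PP k Z).comp ((g0 _).comp ((th _).comp ((aa _).comp (th _))))) := by
  let K : T × (T × (ConfSp k 1 × Z)) → ℝ := fun p => 2 * (1 + ‖p.1.1‖⁻¹)
  have Kc : Continuous K := by
    have : ∀ p : T × (T × (ConfSp k 1 × Z)), ‖p.1.1‖ ≠ 0 := fun p => norm_ne_zero_iff.2 p.1.2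
    fun_prop (disch := exact this)
  have Kp : ∀ p, 0 < K p := fun p => by positivity
  refine hmk i _ _ (fun p => n3 0 (((1 - p.1) * 1 + p.1 * (K p.2)⁻¹ : ℝ) * p.2.2.1.1)
    (((1 - p.1) * 1 + p.1 * (K p.2)⁻¹ : ℝ) * (p.2.2.1.1 * (K p.2 * p.2.1.1))) p.2.2.2.1.1) ?_ ?_ (fun p => rfl) ?_ ?_
  · have K0 : ∀ x : ℝ × (T × (T × (ConfSp k 1 × Z))), K x.2 ≠ 0 := fun x => (Kp _).ne'
    exact n3_cont (by fun_prop) (by fun_prop (disch := exact K0)) (by fun_prop (disch := exact K0))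
      (val_cont.comp (by fun_prop))
  · intro t h0 h1 p
    have h := cvx_pos h0 h1 one_pos (inv_pos.2 (Kp p))
    have h := Complex.ofReal_ne_zero.2 h.ne'
    have e := gi_eq p.1.1 p.1.2
    have g := (((oi _).comp ((g0 _).comp (ti _))) p).1.2
    have g1 : (K p : ℂ) * p.1.1 ∈ s01 := by
      rw [← e]
      exact g
    refine n3_good (c := p.2.2.1) (mul_ne_zero h p.2.1.2) (mul_ne_zero h (mul_ne_zero p.2.1.2 g1.1)) ?_
    refine (mul_right_injective₀ h).ne ?_
    exact fun h => g1.2 ((mul_eq_left₀ p.2.1.2).1 h)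
  · intro p
    rw [ContinuousMap.comp_apply, PP_rg]
    have e := gi_eq p.1.1 p.1.2
    simp only [sub_zero, one_mul, zero_mul, add_zero, Complex.ofReal_one]
    rw [← e]
    rfl
  · intro p
    rw [ContinuousMap.comp_apply, PP_rg, n3_swap2]
    have e := gi_eq p.1.1 p.1.2
    have hK := Complex.ofReal_ne_zero.2 (Kp p).ne'
    have hp := p.1.2
    have e1 : (p.1.1)⁻¹ / (2 * (1 + ‖(p.1.1)⁻¹‖)) = ((K p : ℂ) * p.1.1)⁻¹ := by
      rw [← e, inv_inv]
    change _ = Set.range (n3 0 (p.2.1.1 * p.1.1) (p.2.1.1 * p.1.1 * ((p.1.1)⁻¹ / (2 * (1 + ‖(p.1.1)⁻¹‖)))) p.2.2.1.1)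
    rw [e1]
    have a1 : (((1 - 1) * 1 + 1 * (K p)⁻¹ : ℝ) * (p.2.1.1 * (K p * p.1.1)) : ℂ) = p.2.1.1 * p.1.1 := by
      push_cast
      field_simp
      ring
    have a2 : (((1 - 1) * 1 + 1 * (K p)⁻¹ : ℝ) * p.2.1.1 : ℂ) = p.2.1.1 * p.1.1 * ((K p : ℂ) * p.1.1)⁻¹ := by
      have : p.1.1 ≠ 0 := hp
      push_cast
      field_simp
      ring
    rw [a1, a2]

noncomputable def Ps (k : ℕ) (Z : Type) [TopologicalSpace Z] :
    C(T × (T × (ConfSp k 1 × Z)), UConfSp (k + 3) 0 × Z) :=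
  ⟨fun p => Th (k + 1) Z (kk k 0 (p.1, q k 1 p.2.2.1), p.2.1, p.2.2.2), by fun_prop⟩

lemma ak_val (w : T) (x : ConfSp k 1) : (ak k 0 (w, x)).1 = (Fin.cons (pt 1 w.1 x.1) x.1 : Fin (k + 1) → ℂ) := by
  have h : ((0 : ℕ) : ℂ) + 1 = 1 := by simp
  change (Fin.cons (pt (((0 : ℕ) : ℂ) + 1) w.1 x.1) x.1 : Fin (k + 1) → ℂ) = _
  rw [h]

lemma Ps_eq (i : ℕ) : hm i (Ps k Z) = hm i ((PP k Z).comp ((g0 _).comp ((th _).comp (shi _)))) := by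
  let A : T × (T × (ConfSp k 1 × Z)) → Fin (k + 1) → ℂ := fun p => (ak k 0 (p.1, p.2.2.1)).1
  have Ac : Continuous A := val_cont.comp (by fun_prop)
  have cc : Continuous fun p : T × (T × (ConfSp k 1 × Z)) => p.2.2.1.1 := val_cont.comp (by fun_prop)
  let s1 : T × (T × (ConfSp k 1 × Z)) → ℝ := fun p => dl 1 (A p) / (1 + ‖p.2.1.1‖)
  let s2 : T × (T × (ConfSp k 1 × Z)) → ℝ := fun p => dl 1 p.2.2.1.1 / (1 + ‖p.1.1‖)
  have c1 : Continuous s1 := ((dl_cont 1).comp Ac).div (by fun_prop) fun p => by positivity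
  have c2 : Continuous s2 := ((dl_cont 1).comp cc).div (by fun_prop) fun p => by positivity
  let L : T × (T × (ConfSp k 1 × Z)) → ℝ := fun p => (2 * (1 + ‖p.2.1.1 / p.1.1‖))⁻¹
  have w0 : ∀ p : T × (T × (ConfSp k 1 × Z)), p.1.1 ≠ 0 := fun p => p.1.2
  have Lc : Continuous L := by
    refine Continuous.inv₀ ?_ fun p => by positivity
    fun_prop (disch := exact w0)
  have Lp : ∀ p, 0 < L p := fun p => by positivity
  let d : T × (T × (ConfSp k 1 × Z)) → ℂ := fun p => p.1.1 * (p.2.1.1 / p.1.1 / (2 * (1 + ‖p.2.1.1 / p.1.1‖)))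
  have dL : ∀ p, d p = L p * p.2.1.1 := by
    intro p
    simp only [d, L]
    rw [g0_eq]
    have := w0 p
    field_simp
  let S : T × (T × (ConfSp k 1 × Z)) → ℝ := fun p => sg 0 p.1.1 (d p) p.2.2.1.1
  have Sc : Continuous S := by
    simp only [S, dL]
    unfold sg
    exact ((dl_cont 1).comp cc).div (by fun_prop) fun p => by positivity
  refine hmk i _ _ (fun p => tr 0 (((1 - p.1) * s1 p.2 + p.1 * (S p.2 * L p.2) : ℝ) * p.2.2.1.1)
    (((1 - p.1) * s2 p.2 + p.1 * S p.2 : ℝ) * p.2.1.1) p.2.2.2.1.1) ?_ ?_ (fun p => rfl) ?_ ?_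
  · exact tr_cont (by fun_prop) (by fun_prop) (by fun_prop) (cc.comp continuous_snd)
  · intro t h0 h1 p
    have hd := dl_pos 1 p.2.2.1.1 (conf1_ne p.2.2.1)
    have hA := dl_pos 1 (A p) (conf1_ne (ak k 0 (p.1, p.2.2.1)))
    have p1 : 0 < s1 p := by positivity
    have p2 : 0 < s2 p := by positivity
    have p3 : 0 < S p := sg_pos _ _ _ _
    have q1 := cvx_pos h0 h1 p1 (mul_pos p3 (Lp p))
    have q2 := cvx_pos h0 h1 p2 p3
    have b2 : s2 p * ‖p.1.1‖ < dl 1 p.2.2.1.1 := pt_s _ _ (conf1_ne p.2.2.1)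
    have b1 : s1 p * ‖p.2.1.1‖ < s2 p * ‖p.1.1‖ := by
      have u1 : s1 p * ‖p.2.1.1‖ < dl 1 (A p) := pt_s _ _ (conf1_ne (ak k 0 (p.1, p.2.2.1)))
      have u2 := dl_le 1 (A p) 0
      have u3 : A p 0 = pt 1 p.1.1 p.2.2.1.1 := by
        simp only [A]
        rw [ak_val]
        rfl
      rw [u3, pt_sub, add_sub_cancel_left, norm_mul, Complex.norm_real, Real.norm_of_nonneg (le_of_lt p2)] at u2
      change _ ≤ s2 p * _ at u2
      linarith
    have b4 : S p * ‖p.1.1‖ < dl 1 p.2.2.1.1 := by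
      have := sg_lt 0 p.1.1 (d p) p.2.2.1 p.1.1 (by
        have := norm_nonneg (d p)
        rw [norm_zero]
        linarith)
      rw [norm_mul, Complex.norm_real, Real.norm_of_nonneg p3.le] at this
      exact this
    have wp : 0 < ‖p.1.1‖ := norm_pos_iff.2 (w0 p)
    have b3 : S p * L p * ‖p.2.1.1‖ < S p * ‖p.1.1‖ := by
      rw [mul_assoc]
      refine mul_lt_mul_of_pos_left ?_ p3
      have h5 := half_lt (p.2.1.1 / p.1.1)
      have h6 : L p * ‖p.2.1.1‖ = ‖p.1.1‖ * ‖p.2.1.1 / p.1.1 / (2 * (1 + ‖p.2.1.1 / p.1.1‖))‖ := by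
        rw [← norm_mul]
        change _ = ‖d p‖
        rw [dL, norm_mul, Complex.norm_real, Real.norm_of_nonneg (Lp p).le]
      rw [h6]
      nlinarith
    have n1 := cvx_pos (a := s2 p * ‖p.1.1‖ - s1 p * ‖p.2.1.1‖) (b := S p * ‖p.1.1‖ - S p * L p * ‖p.2.1.1‖) h0 h1
      (by linarith) (by linarith)
    have n2 := cvx_pos (a := dl 1 p.2.2.1.1 - s2 p * ‖p.1.1‖) (b := dl 1 p.2.2.1.1 - S p * ‖p.1.1‖) h0 h1
      (by linarith) (by linarith)
    have e1 : ‖(((1 - t) * s1 p + t * (S p * L p) : ℝ) * p.2.1.1 : ℂ)‖ = ((1 - t) * s1 p + t * (S p * L p)) * ‖p.2.1.1‖ := by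
      rw [norm_mul, Complex.norm_real, Real.norm_of_nonneg q1.le]
    have e2 : ‖(((1 - t) * s2 p + t * S p : ℝ) * p.1.1 : ℂ)‖ = ((1 - t) * s2 p + t * S p) * ‖p.1.1‖ := by
      rw [norm_mul, Complex.norm_real, Real.norm_of_nonneg q2.le]
    refine tr_good (c := p.2.2.1) (mul_ne_zero (Complex.ofReal_ne_zero.2 q1.ne') p.2.1.2)
      (mul_ne_zero (Complex.ofReal_ne_zero.2 q2.ne') p.1.2) (ne_of_norm ?_) ?_ ?_ ?_
    · rw [e1, e2]; linarith
    · rw [norm_zero]; linarith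
    · rw [e1]; linarith
    · rw [e2]; linarith
  · intro p
    have h := Th_rg (ak k 0 (p.1, p.2.2.1)) (p.2.1, p.2.2.2)
    have e : q (k + 1) 1 (ak k 0 (p.1, p.2.2.1)) = kk k 0 (p.1, q k 1 p.2.2.1) := (kk_q _ _).symm
    rw [e] at h
    refine Eq.trans ?_ h.symm
    rw [tr_range, pt_sub, ak_val, Fin.range_cons, pt_sub]
    simp only [sub_zero, one_mul, zero_mul, add_zero]
    simp only [s1, s2, A, ak_val, pt_sub]
  · intro p
    rw [ContinuousMap.comp_apply, PP_rg]
    change _ = Set.range (n3 0 p.1.1 (d p) p.2.2.1.1)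
    rw [n3_swap2]
    unfold n3
    have : sg 0 (d p) p.1.1 p.2.2.1.1 = S p := by
      simp only [S, sg]
      congr 1
      ring
    rw [this, mul_zero, dL]
    simp only [sub_self, zero_mul, zero_add, one_mul, Complex.ofReal_mul, mul_assoc]

theorem J0 (i : ℕ) (x : H i (T × (T × (ConfSp k 1 × Z)))) (hx : Hff x) : hm i (Ps k Z) x = 0 := by
  rw [Ps_eq]
  let y := hm i (th _) (hm i (shi _) x)
  have hy : Hff y := th_ff i _ (shi_ff i _ hx)
  have e1 := l1 i y hy.2
  have e2 := congrArg (hm i (PP k Z)) e1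
  have hA : hm i (th _) (hm i (aa _) (hm i (th _) y)) = - y := by
    rw [aa_neg i _ (th_ff i _ hy), map_neg, swap i _ hy, map_neg, swap i _ hy, neg_neg]
  have e3 : hm i (PP k Z) (hm i ((oi _).comp ((g0 _).comp (ti _))) y) = - hm i (PP k Z) (hm i (g0 _) y) := by
    rw [hm_comp, PP_oi, ← hm_comp, ← hm_comp, ← hm_comp, ← hm_comp, hA, map_neg, map_neg]
  rw [e3, map_add, ← hm_comp (om _), hm_comp _ (om _), PP_om] at e2
  have e4 : hm i (PP k Z) (hm i (g0 _) y) = 0 := by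
    have : (3 : ℚ) • hm i (PP k Z) (hm i (g0 _) y) = 0 := by
      have := sub_eq_zero.2 e2
      rw [← neg_eq_zero, ← this]
      module
    exact (smul_eq_zero.1 this).resolve_left (by norm_num)
  rw [← hm_comp, ← hm_comp, ← hm_comp]
  exact e4
end
end CB

namespace CB

section
variable {i k m : ℕ} {X Y Z : Type} [TopologicalSpace X] [TopologicalSpace Y] [TopologicalSpace Z]

def fz (X Z : Type) [TopologicalSpace X] [TopologicalSpace Z] : C(X × (T × Z), X × Z) :=
  ⟨fun p => (p.1, p.2.2), by fun_prop⟩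

def gz (X Z : Type) [TopologicalSpace X] [TopologicalSpace Z] : C(X × Z, X × (T × Z)) :=
  ⟨fun p => (p.1, 1, p.2), by fun_prop⟩

noncomputable def E1 (x : H i (X × (T × Z))) : H i (X × (T × Z)) := x - hm i (gz X Z) (hm i (fz X Z) x)

lemma fz_E1 (x : H i (X × (T × Z))) : hm i (fz X Z) (E1 x) = 0 := by
  unfold E1
  rw [map_sub, hm_comp _ (gz X Z)]
  have : hm i ((fz X Z).comp (gz X Z)) (hm i (fz X Z) x) = hm i (fz X Z) x := hm_id _
  rw [this, sub_self]

lemma E1_eq (x : H i (X × (T × Z))) (h : hm i (fz X Z) x = 0) : E1 x = x := by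
  rw [E1, h, map_zero, sub_zero]

lemma E1_add (x y : H i (X × (T × Z))) : E1 (x + y) = E1 x + E1 y := by
  simp only [E1, map_add]
  abel

lemma E1_nat {Z' : Type} [TopologicalSpace Z'] (f : C(X × (T × Z), Y × (T × Z')))
    (h : (gz Y Z').comp ((fz Y Z').comp f) = f.comp ((gz X Z).comp (fz X Z))) (x : H i (X × (T × Z))) :
    E1 (hm i f x) = hm i f (E1 x) := by
  unfold E1
  rw [map_sub, hm_comp (fz Y Z'), hm_comp (gz Y Z'), h, ← hm_comp, ← hm_comp]

lemma ffE (x : H i (T × (T × Z))) (hx : hm i (fz T Z) x = 0) :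
    Hff (x - hm i (sl (T × Z) 1) (hm i (pr T (T × Z)) x)) := by
  constructor
  · have h : hm i (p1 Z) (hm i (sl (T × Z) 1) (hm i (pr T (T × Z)) x)) =
        hm i (sl Z 1) (hm i (pr T Z) (hm i (fz T Z) x)) := by
      rw [hm_comp, hm_comp, hm_comp, hm_comp]
      rfl
    rw [map_sub, h, hx, map_zero, map_zero, sub_zero]
    exact hx
  · rw [map_sub, hm_pr_sl, sub_self]

def QQ (k : ℕ) (Z : Type) [TopologicalSpace Z] :
    C(T × (T × (ConfSp k 1 × Z)), (T × UConfSp k 1) × (T × Z)) :=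
  ⟨fun p => ((p.1, q k 1 p.2.2.1), p.2.1, p.2.2.2), by fun_prop⟩

lemma QQ_onto (v : H i ((T × UConfSp k 1) × (T × Z))) : ∃ r, hm i (QQ k Z) r = v := by
  let f : C((T × UConfSp k 1) × (T × Z), UConfSp k 1 × (T × (T × Z))) :=
    ⟨fun p => (p.1.2, p.1.1, p.2), by fun_prop⟩
  let g : C(UConfSp k 1 × (T × (T × Z)), (T × UConfSp k 1) × (T × Z)) :=
    ⟨fun p => ((p.2.1, p.1), p.2.2), by fun_prop⟩
  let f' : C(ConfSp k 1 × (T × (T × Z)), T × (T × (ConfSp k 1 × Z))) :=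
    ⟨fun p => (p.2.1, p.2.2.1, p.1, p.2.2.2), by fun_prop⟩
  obtain ⟨r, hr⟩ := transfer_conf (T × (T × Z)) i (hm i f v)
  refine ⟨hm i f' r, ?_⟩
  have e : (QQ k Z).comp f' = g.comp (px (T × (T × Z)) (q k 1)) := rfl
  rw [hm_comp, e, ← hm_comp, hr, hm_comp]
  exact hm_id v

lemma kill2 (v : H i ((T × UConfSp k 1) × (T × Z))) (hv : hm i (px (T × Z) (pr T (UConfSp k 1))) v = 0) :
    hm i (Th (k + 1) Z) (hm i (px (T × Z) (kk k 0)) (E1 v)) = 0 := by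
  obtain ⟨r, rfl⟩ := QQ_onto v
  rw [E1_nat (QQ k Z) rfl]
  have h1 := ffE (E1 r) (fz_E1 r)
  have h2 : hm i (QQ k Z) (hm i (sl _ 1) (hm i (pr T _) (E1 r))) = 0 := by
    let σ : C(UConfSp k 1 × (T × Z), (T × UConfSp k 1) × (T × Z)) := ⟨fun p => ((1, p.1), p.2), by fun_prop⟩
    have h3 : hm i (px (T × Z) (pr T (UConfSp k 1))) (hm i (QQ k Z) (E1 r)) = 0 := by
      rw [← E1_nat (QQ k Z) rfl, ← E1_nat (px (T × Z) (pr T (UConfSp k 1))) rfl, hv, E1, map_zero, map_zero, sub_zero]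
    have h4 := congrArg (hm i σ) h3
    rw [map_zero, hm_comp, hm_comp] at h4
    rw [hm_comp, hm_comp]
    exact h4
  have h5 := J0 i _ h1
  rw [map_sub] at h5
  have h6 : ∀ y, hm i (Ps k Z) y = hm i (Th (k + 1) Z) (hm i (px (T × Z) (kk k 0)) (hm i (QQ k Z) y)) := by
    intro y
    rw [hm_comp, hm_comp]
    rfl
  rw [h6, h6, h2, map_zero, map_zero, sub_zero] at h5
  exact h5

lemma kill1 (x : H i (T × (T × Z))) : ∃ y, hm i (Th m Z) (hm i (sF m (T × Z)) (E1 x)) = hm i (cF (m + 2) Z) y := by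
  have h1 := ffE (E1 x) (fz_E1 x)
  refine ⟨hm i (pr T (T × Z)) (E1 x), ?_⟩
  have h2 : hm i ((Th m Z).comp (sF m (T × Z))) (E1 x - hm i (sl (T × Z) 1) (hm i (pr T (T × Z)) (E1 x))) = 0 := by
    match m with
    | 0 => exact F0triv (fun w => rfl) i _ h1.2
    | 1 => exact F0triv (fun w => rfl) i _ h1.2
    | k + 2 => exact F0 k i _ h1
  rw [map_sub, sub_eq_zero] at h2
  rw [hm_comp, h2, ← W1, hm_comp]
  rfl

lemma key (hS : ∀ k, m = k + 1 → SS m) (v : H i (UConfSp m 1 × (T × Z))) (hv : hm i (fz _ Z) v = 0) :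
    ∃ y, hm i (Th m Z) v = hm i (cF (m + 2) Z) y := by
  rw [← E1_eq v hv]
  match m with
  | 0 =>
    obtain ⟨x, rfl⟩ := DD0 i v
    rw [E1_nat (sF 0 (T × Z)) rfl]
    exact kill1 x
  | k + 1 =>
    obtain ⟨x, v, rfl, hw⟩ := DD (hS k rfl) i v
    rw [E1_add, E1_nat (sF (k + 1) (T × Z)) rfl, E1_nat (px (T × Z) (kk k 0)) rfl, map_add, kill2 v hw, add_zero]
    exact kill1 x

theorem SSall (n : ℕ) : SS n := by
  induction n using Nat.strong_induction_on with
  | _ n ih =>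
  match n with
  | 0 => exact SSle (by omega)
  | 1 => exact SSle le_rfl
  | m + 2 =>
    intro Z _ i y
    obtain ⟨u, rfl⟩ := ins_onto i y
    obtain ⟨x, v, rfl, hv⟩ := DD (ih (m + 1) (by omega)) i u
    let f : C((T × UConfSp m 1) × Z, UConfSp m 1 × (T × Z)) := ⟨fun p => (p.1.2, p.1.1, p.2), by fun_prop⟩
    obtain ⟨y, hy⟩ := key (fun k _ => ih m (by omega)) (hm i f v) (by
      rw [hm_comp]
      exact hv)
    have e1 : hm i (px Z (ins (m + 1))) (hm i (px Z (kk m 0)) v) = hm i (cF (m + 2) Z) y := by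
      rw [← hy, hm_comp, hm_comp]
      rfl
    rw [map_add, e1]
    match m with
    | 0 =>
      refine ⟨hm i (sl Z 1) (hm i (pr _ Z) x) + y, ?_⟩
      rw [map_add, ← insA1, hm_comp]
    | k + 1 =>
      refine ⟨x + y, ?_⟩
      rw [map_add, ← insA, hm_comp]

end
end CB

namespace CB
section
variable {X Y Z : Type} [TopologicalSpace X] [TopologicalSpace Y] [TopologicalSpace Z]

def Bo (i : ℕ) (X : Type) [TopologicalSpace X] (d : ℕ) : Prop :=
  Module.Finite ℚ (H i X) ∧ Module.finrank ℚ (H i X) ≤ d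

lemma Bo.surj {i d : ℕ} (h : Bo i X d) (f : C(X, Y)) (hf : Function.Surjective (hm i f)) :
    Bo i Y d := by
  have := h.1
  exact ⟨Module.Finite.of_surjective _ hf,
    ((hm i f).finrank_le_finrank_of_surjective hf).trans h.2⟩

lemma Bo.mono {i d e : ℕ} (h : Bo i X d) (hd : d ≤ e) : Bo i X e := ⟨h.1, h.2.trans hd⟩

lemma Bo.ker {i d e : ℕ} (h : Bo i Y d) (f : C(X, Y)) (h1 : Module.Finite ℚ (LinearMap.ker (hm i f)))
    (h2 : Module.finrank ℚ (LinearMap.ker (hm i f)) ≤ e) : Bo i X (d + e) := by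
  have := h.1
  have hF : Module.Finite ℚ (H i X) := by
    have : Module.Finite ℚ (H i X ⧸ LinearMap.ker (hm i f)) :=
      Module.Finite.equiv (hm i f).quotKerEquivRange.symm
    exact Module.Finite.of_submodule_quotient (LinearMap.ker (hm i f))
  refine ⟨hF, ?_⟩
  have h3 := (hm i f).finrank_range_add_finrank_ker
  have h4 := Submodule.finrank_le (LinearMap.range (hm i f))
  have := h.2
  omega

lemma hm_lr (i : ℕ) (f : C(X, Y)) (g : C(Y, X)) (h : g.comp f = ContinuousMap.id X) (y : H i X) :
    hm i g (hm i f y) = y := by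
  rw [hm_comp, h, hm_id]

lemma Bo.retr {i d : ℕ} (h : Bo i X d) (f : C(X, Y)) (g : C(Y, X))
    (e : f.comp g = ContinuousMap.id Y) : Bo i Y d :=
  h.surj f fun y => ⟨_, hm_lr i g f e y⟩

lemma alt_sum (n : ℕ) : ∑ j : Fin n, (-1 : ℚ) ^ (j : ℕ) = if Even n then 0 else 1 := by
  rw [Fin.sum_univ_eq_sum_range (fun j => (-1 : ℚ) ^ j), neg_one_geom_sum]

lemma pt_bd [Subsingleton X] (n : ℕ) (σ : C(Dl (n + 1), X)) (τ : C(Dl n, X)) :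
    bd n (Finsupp.single σ 1) = (if Even n then 0 else 1 : ℚ) • Finsupp.single τ 1 := by
  rw [bd_single]
  have : ∀ j, σ.comp (fc n j) = τ := fun j => by ext; exact Subsingleton.elim _ _
  simp only [this, ← Finset.sum_smul, alt_sum]
  congr 1
  simp [Nat.even_add]

lemma pt_form [Subsingleton X] (n : ℕ) (c : Ch n X) (τ : C(Dl n, X)) : 
    c = c τ • Finsupp.single τ 1 := by
  ext σ
  have : σ = τ := by ext; exact Subsingleton.elim _ _
  subst this
  simp

lemma pt_pos [Subsingleton X] [Nonempty X] (i : ℕ) : Bo (i + 1) X 0 := by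
  obtain ⟨p⟩ := ‹Nonempty X›
  have : ∀ y : H (i + 1) X, y = 0 := by
    intro y
    obtain ⟨c, hc, rfl⟩ := cls_surj y
    rw [cls_eq_zero]
    have hf := pt_form _ c (ContinuousMap.const _ p)
    by_cases h : Even i
    · refine ⟨c (ContinuousMap.const _ p) • Finsupp.single (ContinuousMap.const _ p) 1, ?_⟩
      rw [map_smul, pt_bd _ _ (ContinuousMap.const _ p), if_neg (by simp [Nat.even_add, h]), one_smul]
      exact hf.symm
    · refine ⟨0, ?_⟩
      rw [hf] at hc ⊢
      change bd i _ = 0 at hc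
      rw [map_smul, pt_bd _ _ (ContinuousMap.const _ p), if_neg h, one_smul] at hc
      have := DFunLike.congr_fun hc (ContinuousMap.const _ p)
      simp at this
      simp [this]
  have hs : Subsingleton (H (i + 1) X) := ⟨fun a b => by rw [this a, this b]⟩
  exact ⟨inferInstance, by rw [Module.finrank_zero_of_subsingleton]⟩

lemma pt_zero [Subsingleton X] [Nonempty X] : Bo 0 X 1 := by
  obtain ⟨p⟩ := ‹Nonempty X›
  have hz : bz 0 (Finsupp.single (ContinuousMap.const (Dl 0) p) 1) = 0 := rfl
  have h : ∀ y : H 0 X, ∃ c : ℚ, c • cls (Finsupp.single (ContinuousMap.const (Dl 0) p) 1) hz = y := by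
    intro y
    obtain ⟨c, hc, rfl⟩ := cls_surj y
    refine ⟨c (ContinuousMap.const _ p), ?_⟩
    refine Eq.trans (cls_smul (hc := hz) _) ?_
    exact cls_congr (pt_form _ c (ContinuousMap.const _ p)).symm
  have hs : Function.Surjective (LinearMap.toSpanSingleton ℚ (H 0 X)
    (cls (Finsupp.single (ContinuousMap.const (Dl 0) p) 1) hz)) := h
  exact ⟨Module.Finite.of_surjective _ hs,
    (LinearMap.finrank_le_finrank_of_surjective hs).trans (by simp)⟩

def gb : ℕ → ℕ → ℕ
  | 0, i => if i ≤ 1 then 1 else 0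
  | a + 1, i => ∑ j ∈ Finset.range (i + 1), gb a j

lemma gb_zero (a : ℕ) : gb a 0 = 1 := by
  induction a with
  | zero => simp [gb]
  | succ a ih => simp [gb, ih]

lemma gb_succ (a i : ℕ) : gb (a + 1) (i + 1) = gb a (i + 1) + gb (a + 1) i := by
  simp only [gb]
  rw [Finset.sum_range_succ, add_comm]

lemma gb_le (a i : ℕ) : gb (a + 1) i ≤ 2 * (i + 1) ^ a := by
  induction a generalizing i with
  | zero =>
    have h : ∀ i, gb 1 i ≤ 2 ∧ gb 1 0 = 1 := by
      intro i
      refine ⟨?_, gb_zero 1⟩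
      match i with
      | 0 => simp [gb_zero]
      | i + 1 =>
        induction i with
        | zero => simp [gb_succ, gb_zero]; simp [gb]
        | succ i ih => rw [gb_succ]; simpa [gb] using ih
    simpa using (h i).1
  | succ a ih =>
    rw [gb]
    calc _ ≤ ∑ j ∈ Finset.range (i + 1), 2 * (i + 1) ^ a := by
          refine Finset.sum_le_sum fun j hj => (ih j).trans ?_
          have := Finset.mem_range.1 hj
          gcongr
          omega
      _ = _ := by simp; ring

lemma pt_all [Subsingleton X] [Nonempty X] (a i : ℕ) : Bo i X (gb a i) := by
  cases i with
  | zero => rw [gb_zero]; exact pt_zero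
  | succ i => exact (pt_pos i).mono (Nat.zero_le _)

lemma T_bo (i : ℕ) : Bo i (T × Unit) (gb 0 i) := by
  have hk := (pt_all (X := Unit) 0)
  match i with
  | 0 =>
    refine ((hk 0).ker (pr T Unit) (e := 0) ?_ ?_)
    all_goals rw [(LinearMap.ker_eq_bot' (f := hm 0 (pr T Unit))).2 slit_zero]
    · infer_instance
    · simp
  | i + 1 =>
    have := (hk i).1
    have h := slit_dim (Z := Unit) i
    have h2 := (pt_pos (X := Unit) i).ker (pr T Unit) h.1 (h.2.trans (hk i).2)
    match i with
    | 0 => exact h2.mono (by simp [gb])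
    | i + 1 =>
      have h := slit_dim (Z := Unit) (i + 1)
      exact (pt_pos (X := Unit) (i + 1)).ker (pr T Unit) h.1 (h.2.trans (pt_pos i).2)

instance : Subsingleton (UConfSp 0 a) := ⟨fun x y => by
  obtain ⟨x, rfl⟩ := q_surj x
  obtain ⟨y, rfl⟩ := q_surj y
  congr 1
  exact Subtype.ext (funext fun i => i.elim0)⟩

instance : Nonempty (UConfSp 0 a) :=
  ⟨q 0 a ⟨fun i => i.elim0, fun i => i.elim0, fun i => i.elim0⟩⟩

def rea (X Y Z : Type) [TopologicalSpace X] [TopologicalSpace Y] [TopologicalSpace Z] :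
    C(X × (Y × Z), (X × Y) × Z) := ⟨fun p => ((p.1, p.2.1), p.2.2), by fun_prop⟩

def rea2 (X Y Z : Type) [TopologicalSpace X] [TopologicalSpace Y] [TopologicalSpace Z] :
    C((X × Y) × Z, X × (Y × Z)) := ⟨fun p => (p.1.1, (p.1.2, p.2)), by fun_prop⟩

lemma ker_le (m a i : ℕ) : LinearMap.ker (hm i (px Unit (ff (m + 1) a))) ≤
    (LinearMap.ker (hm i (pr T (UConfSp m (a + 1) × Unit)))).map
      (hm i ((px Unit (kk m a)).comp (rea _ _ _))) := by
  intro u hu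
  obtain ⟨w, h1, h2⟩ := gysin (Z := Unit) u hu
  refine ⟨hm i (rea2 _ _ _) w, ?_, ?_⟩
  · change hm i _ _ = 0
    rw [hm_comp]
    exact h2
  · rw [hm_comp, ← h1]
    rfl

theorem U_bo (n a i : ℕ) : Bo i (UConfSp n a × Unit) (gb a i) := by
  induction a generalizing n i with
  | zero => exact (T_bo i).surj (cF n Unit) (SSall n Unit i)
  | succ a iha =>
    induction n generalizing i with
    | zero => exact pt_all _ _
    | succ m ihm =>
      have hk := ker_le m a i
      match i with
      | 0 =>
        rw [(LinearMap.ker_eq_bot' (f := hm 0 (pr T (UConfSp m (a + 1) × Unit)))).2 slit_zero,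
          Submodule.map_bot, le_bot_iff] at hk
        have h1 : gb (a + 1) 0 = gb a 0 + 0 := by rw [gb_zero, gb_zero]
        rw [h1]
        refine ((iha (m + 1) 0).ker (px Unit (ff (m + 1) a)) (e := 0) ?_ ?_)
        all_goals rw [hk]
        · infer_instance
        · simp
      | i + 1 =>
        have := (ihm i).1
        have h := slit_dim (Z := UConfSp m (a + 1) × Unit) i
        have := h.1
        rw [gb_succ]
        refine (iha (m + 1) (i + 1)).ker (px Unit (ff (m + 1) a)) ?_ ?_
        · exact Submodule.finiteDimensional_of_le hk
        · exact (Submodule.finrank_mono hk).trans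
            ((Submodule.finrank_map_le _ _).trans (h.2.trans (ihm i).2))

theorem U_bo1 (n a i : ℕ) : Bo i (UConfSp n a) (gb a i) :=
  (U_bo n a i).retr ⟨Prod.fst, continuous_fst⟩ ⟨fun x => (x, ()), by fun_prop⟩ rfl

end
end CB

namespace CB
section
variable (X : Type) [TopologicalSpace X]

noncomputable abbrev SK : ChainComplex (ModuleCat.{0} ℚ) ℕ :=
  AlternatingFaceMapComplex.obj
    (((SimplicialObject.whiskering _ _).obj (ModuleCat.free ℚ)).obj (TopCat.toSSet.obj (TopCat.of X)))

noncomputable def SKiso (n : ℕ) : (SK X).X n ≅ ModuleCat.of ℚ (Ch n X) :=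
  (Finsupp.domLCongr (TopCat.toSSetObjEquiv (TopCat.of X) (Opposite.op (SimplexCategory.mk n)))
    : _ ≃ₗ[ℚ] (C(Dl n, X) →₀ ℚ)).toModuleIso

lemma SKiso_single (n : ℕ) (x) : (SKiso X n).hom (ModuleCat.freeMk x) =
    (Finsupp.single ((TopCat.toSSetObjEquiv (TopCat.of X) (Opposite.op (SimplexCategory.mk n))) x) 1 : Ch n X) :=
  Finsupp.domLCongr_single _ _ _

noncomputable abbrev SM : SimplicialObject (ModuleCat.{0} ℚ) :=
  ((SimplicialObject.whiskering _ _).obj (ModuleCat.free ℚ)).obj (TopCat.toSSet.obj (TopCat.of X))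

lemma SKface (n : ℕ) (j : Fin (n + 2)) : (SKiso X (n + 1)).hom ≫
    ModuleCat.ofHom (Finsupp.lmapDomain ℚ ℚ (fun σ : C(Dl (n + 1), X) => σ.comp (fc n j))) =
    (SM X).δ j ≫ (SKiso X n).hom := by
  apply ModuleCat.free_hom_ext
  intro x
  have h1 := congrArg (Finsupp.lmapDomain ℚ ℚ (fun σ : C(Dl (n + 1), X) => σ.comp (fc n j)))
    (SKiso_single X (n + 1) x)
  have h2 := congrArg (SKiso X n).hom
    (ModuleCat.free_map_apply (R := ℚ) ((TopCat.toSSet.obj (TopCat.of X)).δ j) x)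
  refine h1.trans (Eq.trans ?_ h2.symm)
  refine Eq.trans ?_ (SKiso_single X n _).symm
  exact Finsupp.mapDomain_single

lemma SKcomm (n : ℕ) : (SKiso X (n + 1)).hom ≫ ModuleCat.ofHom (bd n) =
    (SK X).d (n + 1) n ≫ (SKiso X n).hom := by
  have h : ModuleCat.ofHom (bd (X := X) n) = ∑ j : Fin (n + 2), (-1 : ℤ) ^ (j : ℕ) •
      ModuleCat.ofHom (Finsupp.lmapDomain ℚ ℚ (fun σ : C(Dl (n + 1), X) => σ.comp (fc n j))) := by
    ext1
    rw [ModuleCat.hom_sum, ModuleCat.hom_ofHom, bd]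
    refine Finset.sum_congr rfl fun j _ => ?_
    rw [ModuleCat.hom_zsmul, ← Int.cast_smul_eq_zsmul ℚ]
    simp
  rw [h, AlternatingFaceMapComplex.obj_d_eq]
  erw [Preadditive.comp_sum, Preadditive.sum_comp]
  refine Finset.sum_congr rfl fun j _ => ?_
  rw [Preadditive.comp_zsmul, SKface, Preadditive.zsmul_comp]

lemma betti_eq (k : ℕ) : bettiNumber (k + 1) (TopCat.of X) = Module.finrank ℚ (H (k + 1) X) := by
  let S : ShortComplex (ModuleCat.{0} ℚ) := ShortComplex.mk
    (ModuleCat.ofHom (bd (X := X) (k + 1))) (ModuleCat.ofHom (bd (X := X) k))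
    (by ext1; exact LinearMap.ext fun c => bd_bd k c)
  let e1 : (SK X).homology (k + 1) ≅ ((SK X).sc' (k + 2) (k + 1) k).homology :=
    ShortComplex.homologyMapIso ((SK X).isoSc' (k + 2) (k + 1) k (by simp) (by simp))
  let e2 : ((SK X).sc' (k + 2) (k + 1) k) ≅ S :=
    ShortComplex.isoMk (SKiso X _) (SKiso X _) (SKiso X _) (SKcomm X _) (SKcomm X _)
  let e3 := e1 ≪≫ ShortComplex.homologyMapIso e2 ≪≫ S.moduleCatHomologyIso
  have h := e3.toLinearEquiv.finrank_eq
  refine h.trans ?_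
  refine LinearEquiv.finrank_eq (M := LinearMap.ker (bd (X := X) k) ⧸ LinearMap.range S.moduleCatToCycles)
    (N := HQ (k + 1) X) ?_
  refine Submodule.quotEquivOfEq _ _ ?_
  ext ⟨c, hc⟩
  constructor
  · rintro ⟨b, hb⟩
    exact ⟨b, congrArg Subtype.val hb⟩
  · rintro ⟨b, hb⟩
    exact ⟨b, Subtype.ext hb⟩
end
end CB

/-- For every `a ≥ 1` there is `C > 0` such that for all `n ≥ 0` and
all `i ≥ 1`, `dim_ℚ H_i(UConf_n(ℂ ∖ {1, …, a}); ℚ) ≤ C · i^{a−1}`:  these Betti numbers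
are bounded by a polynomial in `i` of degree `a − 1`, uniformly in `n`. -/
theorem stmt_3 (a : ℕ) (ha : 1 ≤ a) :
    ∃ C : ℝ, 0 < C ∧ ∀ n i : ℕ, 1 ≤ i →
      (bettiNumber i (TopCat.of (UConfSp n a)) : ℝ) ≤ C * (i : ℝ) ^ (a - 1) := by
  obtain ⟨a, rfl⟩ := Nat.exists_eq_add_of_le' ha
  refine ⟨2 * 2 ^ a, by positivity, fun n i hi => ?_⟩
  obtain ⟨k, rfl⟩ := Nat.exists_eq_add_of_le' hi
  rw [CB.betti_eq]
  have h := (CB.U_bo1 n (a + 1) (k + 1)).2.trans (CB.gb_le a (k + 1))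
  have h2 : 2 * (k + 1 + 1) ^ a ≤ 2 * 2 ^ a * (k + 1) ^ a := by
    rw [mul_assoc, ← mul_pow]
    gcongr
    omega
  have h3 := h.trans h2
  simp only [Nat.add_sub_cancel]
  exact_mod_cast h3
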